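/- arXiv:1910.01041 — 4 statements merged into one kernel-verified Lean document; each statement's English description precedes it below -/
import Mathlib

section
/- (Łojasiewicz–Simon gradient inequality of Feehan–Maridakis, Proposition 3.1.) Assume that j is a definite embedding, that there is a real-analytic map M : U → W with T(M(x)) = E'(x) in V* for every x ∈ U, and that there is a Fredholm operator L : V → W of index zero with T(L v) = E''(x∞)(v, ·) in V* for every v ∈ V. Then there exist constants C ∈ (0,∞), σ ∈ (0,1], and θ ∈ (0, 1/2] such that for every x ∈ U with ‖x − x∞‖_V ≤ σ one has |E(x) − E(x∞)|^{1−θ} ≤ C ‖M(x)‖_W. -/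
theorem MvPolynomial.derivation_aeval {R S : Type*} [CommRing R] [CommRing S] [Algebra R S] {m : ℕ}
    (d : Derivation R S S) (Y : Fin m → S) (P : MvPolynomial (Fin m) R) :
    d (MvPolynomial.aeval Y P) =
      ∑ j, MvPolynomial.aeval Y (MvPolynomial.pderiv j P) * d (Y j) := by
  induction P using MvPolynomial.induction_on with
  | C a => simp
  | add p q hp hq => simp [hp, hq, add_mul, Finset.sum_add_distrib]
  | mul_X p i hp =>
    simp only [map_mul, MvPolynomial.aeval_X, Derivation.leibniz, smul_eq_mul, hp,
      MvPolynomial.pderiv_X, map_add, add_mul, Finset.sum_add_distrib, Finset.mul_sum]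
    congr 1
    · rw [Finset.sum_eq_single i] <;> simp +contextual [eq_comm]
    · exact Finset.sum_congr rfl fun j _ => by ring

theorem Algebra.FormallySmooth.of_charZero (L k : Type*) [Field L] [Field k] [Algebra L k]
    [CharZero L] : Algebra.FormallySmooth L k := by
  obtain ⟨ι, v, hv⟩ := exists_isTranscendenceBasis' L k
  have := hv.isAlgebraic_field
  exact .of_algebraicIndependent_of_isSeparable hv.1

open Polynomial in
theorem no_logarithm_of_isNilpotent {L R : Type*} [Field L] [CharZero L] [CommRing R] [IsLocalRing R]
    [Algebra L R] {π : R} (hπ : IsLocalRing.maximalIdeal R = Ideal.span {π}) (hnil : IsNilpotent π)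
    {m : ℕ} (y a : Fin m → R) (P : MvPolynomial (Fin m) L)
    (hP : ∀ j, MvPolynomial.aeval y (MvPolynomial.pderiv j P) = MvPolynomial.aeval y P * a j)
    (h0 : MvPolynomial.aeval y P ≠ 0)
    (hm : MvPolynomial.aeval y P ∈ IsLocalRing.maximalIdeal R) : False := by
  classical
  set k := IsLocalRing.ResidueField R
  have hsm := Algebra.FormallySmooth.of_charZero L k
  have hk0 : CharZero k := charZero_of_injective_algebraMap (algebraMap L k).injective
  let res : R →ₐ[L] k := IsScalarTower.toAlgHom L R k
  have hres : Function.Surjective res := IsLocalRing.residue_surjective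
  have hker : RingHom.ker (res : R →+* k) = Ideal.span {π} := by
    rw [← hπ]; exact IsLocalRing.ker_residue
  have hkn : IsNilpotent (RingHom.ker (res : R →+* k)) := by
    obtain ⟨n, hn⟩ := hnil
    refine ⟨n, ?_⟩
    rw [hker, Ideal.span_singleton_pow, hn]; simp
  let σ : k →ₐ[L] R := Algebra.FormallySmooth.liftOfSurjective (AlgHom.id L k) res hres hkn
  have hσ : ∀ x, res (σ x) = x := fun x =>
    Algebra.FormallySmooth.liftOfSurjective_apply _ res hres hkn x
  let ψ : k[X] →ₐ[L] R := { Polynomial.eval₂RingHom (σ : k →+* R) π with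
    commutes' := fun r => by
      change Polynomial.eval₂ (σ : k →+* R) π (algebraMap L k[X] r) = _
      rw [IsScalarTower.algebraMap_apply L k k[X], Polynomial.algebraMap_eq, Polynomial.eval₂_C]
      exact σ.commutes r }
  have hψX : ψ X = π := Polynomial.eval₂_X _ _
  have hψC : ∀ c, ψ (C c) = σ c := by intro c; exact Polynomial.eval₂_C _ _
  have hresψ : ∀ p, res (ψ p) = p.coeff 0 := by
    intro p
    have hresπ : res π = 0 := by
      have : π ∈ RingHom.ker (res : R →+* k) := by rw [hker]; exact Ideal.mem_span_singleton_self _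
      exact this
    induction p using Polynomial.induction_on' with
    | add p q hp hq => simp [hp, hq]
    | monomial n c =>
      rw [← C_mul_X_pow_eq_monomial, map_mul, map_pow, hψX, hψC, map_mul, hσ, map_pow, hresπ]
      rcases n with _ | n <;> simp
  have hunit : ∀ x : R, res x ≠ 0 → IsUnit x := by
    intro x hx
    by_contra h
    exact hx ((IsLocalRing.residue_eq_zero_iff x).2 ((IsLocalRing.mem_maximalIdeal x).2 h))
  have hdiv : ∀ x : R, res x = 0 → ∃ z, x = π * z := by
    intro x hx
    have : x ∈ RingHom.ker (res : R →+* k) := hx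
    rw [hker, Ideal.mem_span_singleton] at this
    exact this
  -- minimal nilpotency exponent
  have hex : ∃ n, π ^ n = 0 := hnil
  set n := Nat.find hex with hn
  have hnz : π ^ n = 0 := Nat.find_spec hex
  have hlt : ∀ j < n, π ^ j ≠ 0 := fun j hj => Nat.find_min hex hj
  have hsurj : Function.Surjective ψ := by
    have key : ∀ N : ℕ, ∀ x : R, ∃ p z, x = ψ p + π ^ N * z := by
      intro N
      induction N with
      | zero => exact fun x => ⟨0, x, by simp⟩
      | succ N ih =>
        intro x
        obtain ⟨p, z, hz⟩ := ih x
        obtain ⟨w, hw⟩ := hdiv (z - σ (res z)) (by rw [map_sub, hσ, sub_self])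
        refine ⟨p + X ^ N * C (res z), w, ?_⟩
        rw [map_add, map_mul, map_pow, hψX, hψC, hz]
        linear_combination π ^ N * hw
    intro x
    obtain ⟨p, z, hz⟩ := key n x
    exact ⟨p, by rw [hz, hnz]; simp⟩
  have hzero : ∀ p, ψ p = 0 → X ^ n ∣ p := by
    intro p hp
    by_cases hp0 : p = 0
    · simp [hp0]
    obtain ⟨q, hq⟩ := exists_eq_pow_rootMultiplicity_mul_and_not_dvd p hp0 0
    obtain ⟨hq1, hq2⟩ := hq
    set j := rootMultiplicity 0 p
    rw [C_0, sub_zero] at hq1 hq2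
    have hu : IsUnit (ψ q) := hunit _ (by
      rw [hresψ]; rwa [X_dvd_iff] at hq2)
    rw [hq1, map_mul, map_pow, hψX, hu.mul_left_eq_zero] at hp
    have : n ≤ j := by
      by_contra h
      exact hlt j (not_le.1 h) hp
    rw [hq1]
    exact (pow_dvd_pow _ this).mul_right _
  choose Y hY using fun j => hsurj (y j)
  choose A hA using fun j => hsurj (a j)
  have hev : ∀ Q : MvPolynomial (Fin m) L, ψ (MvPolynomial.aeval Y Q) = MvPolynomial.aeval y Q := by
    intro Q
    rw [← AlgHom.comp_apply, MvPolynomial.comp_aeval]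
    congr 2
    funext j
    exact hY j
  set T := MvPolynomial.aeval Y P with hT
  have hTψ : ψ T = MvPolynomial.aeval y P := hev P
  have hTne : T ≠ 0 := by
    rintro h
    rw [h, map_zero] at hTψ
    exact h0 hTψ.symm
  obtain ⟨q, hq1, hq2⟩ := exists_eq_pow_rootMultiplicity_mul_and_not_dvd T hTne 0
  set e := rootMultiplicity 0 T
  rw [C_0, sub_zero] at hq1 hq2
  have hen : e < n := by
    by_contra h
    apply h0
    rw [← hTψ, hq1, map_mul, map_pow, hψX, pow_eq_zero_of_le (not_lt.1 h) hnz, zero_mul]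
  have he0 : e ≠ 0 := by
    intro h
    apply hq2
    rw [h, pow_zero, one_mul] at hq1
    rw [← hq1, X_dvd_iff, ← hresψ, hTψ]
    exact (IsLocalRing.residue_eq_zero_iff _).2 hm
  have hdT : X ^ e ∣ derivative T := by
    have h1 := MvPolynomial.derivation_aeval ((Polynomial.derivative' (R := k)).restrictScalars L) Y P
    have h2 : derivative T = ∑ j, MvPolynomial.aeval Y (MvPolynomial.pderiv j P) * derivative (Y j) := h1
    rw [h2]
    refine Finset.dvd_sum fun j _ => Dvd.dvd.mul_right ?_ _
    have h3 : X ^ n ∣ MvPolynomial.aeval Y (MvPolynomial.pderiv j P) - T * A j := by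
      apply hzero
      rw [map_sub, map_mul, hev, hev, hA, hP, sub_self]
    have h4 : X ^ e ∣ T * A j := by rw [hq1]; exact (dvd_mul_right _ _).mul_right _
    have := dvd_add ((pow_dvd_pow X hen.le).trans h3) h4
    simpa using this
  have hder : derivative T = X ^ (e - 1) * (C (e : k) * q) + X ^ e * derivative q := by
    conv_lhs => rw [hq1]
    rw [derivative_mul, derivative_X_pow]
    ring
  rw [hder, dvd_add_left (dvd_mul_right _ _)] at hdT
  have h5 : X ^ (e - 1) * X ∣ X ^ (e - 1) * (C (e : k) * q) := by
    rwa [← pow_succ, Nat.sub_add_cancel (Nat.pos_of_ne_zero he0)]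
  have h6 : X ∣ C (e : k) * q := (mul_dvd_mul_iff_left (pow_ne_zero _ X_ne_zero)).1 h5
  rw [X_dvd_iff, coeff_C_mul] at h6
  rw [X_dvd_iff] at hq2
  exact (mul_ne_zero (Nat.cast_ne_zero.2 he0) hq2) h6

universe u

theorem no_logarithm_of_isLocalRing {L V : Type*} [Field L] [CharZero L] [CommRing V]
    [IsLocalRing V] [IsNoetherianRing V] [Algebra L V]
    (hpr : (IsLocalRing.maximalIdeal V).IsPrincipal)
    {m : ℕ} (y a : Fin m → V) (P : MvPolynomial (Fin m) L)
    (hP : ∀ j, MvPolynomial.aeval y (MvPolynomial.pderiv j P) = MvPolynomial.aeval y P * a j)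
    (h0 : MvPolynomial.aeval y P ≠ 0)
    (hm : MvPolynomial.aeval y P ∈ IsLocalRing.maximalIdeal V) : False := by
  obtain ⟨π, hπ⟩ := hpr
  obtain ⟨n, hn⟩ : ∃ n, MvPolynomial.aeval y P ∉ IsLocalRing.maximalIdeal V ^ n := by
    by_contra! h
    have h1 := Ideal.iInf_pow_eq_bot_of_isLocalRing (IsLocalRing.maximalIdeal V)
      (IsLocalRing.maximalIdeal.isMaximal V).ne_top
    have h2 : MvPolynomial.aeval y P ∈ ⨅ i, IsLocalRing.maximalIdeal V ^ i := by
      simpa using h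
    rw [h1] at h2
    exact h0 h2
  set I := IsLocalRing.maximalIdeal V ^ n
  have : Nontrivial (V ⧸ I) := Ideal.Quotient.nontrivial_iff.2 (by
    intro h
    rw [h] at hn
    exact hn trivial)
  have hsur : Function.Surjective (Ideal.Quotient.mk I) := Ideal.Quotient.mk_surjective
  have : IsLocalRing (V ⧸ I) := IsLocalRing.of_surjective' (Ideal.Quotient.mk I) hsur
  have hmax : IsLocalRing.maximalIdeal (V ⧸ I) = Ideal.span {Ideal.Quotient.mk I π} := by
    rw [← IsLocalRing.map_maximalIdeal_of_surjective (Ideal.Quotient.mk I) hsur, hπ]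
    change Ideal.map _ (Ideal.span {π}) = _
    rw [Ideal.map_span, Set.image_singleton]
  have hev : ∀ Q : MvPolynomial (Fin m) L,
      MvPolynomial.aeval (fun j => Ideal.Quotient.mk I (y j)) Q =
        Ideal.Quotient.mk I (MvPolynomial.aeval y Q) := by
    intro Q
    have := MvPolynomial.comp_aeval (R := L) y (Ideal.Quotient.mkₐ L I)
    exact (DFunLike.congr_fun this Q).symm
  refine no_logarithm_of_isNilpotent hmax ⟨n, ?_⟩ (fun j => Ideal.Quotient.mk I (y j))
    (fun j => Ideal.Quotient.mk I (a j)) P (fun j => ?_) ?_ ?_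
  · rw [← map_pow, Ideal.Quotient.eq_zero_iff_mem]
    apply Ideal.pow_mem_pow
    rw [hπ]
    exact Submodule.mem_span_singleton_self π
  · rw [hev, hev, hP, map_mul]
  · rw [hev, Ne, Ideal.Quotient.eq_zero_iff_mem]
    exact hn
  · rw [hev, ← IsLocalRing.map_maximalIdeal_of_surjective (Ideal.Quotient.mk I) hsur]
    exact Ideal.mem_map_of_mem _ hm

theorem IsLocalRing.maximalIdeal_isPrincipal_of_height_le_one {R : Type*} [CommRing R] [IsDomain R]
    [IsLocalRing R] [IsNoetherianRing R] [IsIntegrallyClosed R]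
    (h : (IsLocalRing.maximalIdeal R).height ≤ 1) :
    (IsLocalRing.maximalIdeal R).IsPrincipal := by
  have h34 := (tfae_of_isNoetherianRing_of_isLocalRing_of_isDomain R).out 3 4
  refine h34.1 ⟨inferInstance, fun P hP0 hP => ?_⟩
  by_contra hne
  have hlt : P < IsLocalRing.maximalIdeal R := lt_of_le_of_ne (IsLocalRing.le_maximalIdeal hP.ne_top) hne
  have h1 := Ideal.height_add_one_le_of_lt_of_isPrime hlt
  have h2 := Ideal.height_add_one_le_of_lt_of_isPrime (bot_lt_iff_ne_bot.2 hP0)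
  have h3 : (1 : ℕ∞) + 1 ≤ 1 := by
    calc (1 : ℕ∞) + 1 ≤ (⊥ : Ideal R).height + 1 + 1 := by gcongr; exact le_add_self
      _ ≤ P.height + 1 := by gcongr
      _ ≤ 1 := h1.trans h
  exact absurd h3 (by decide)

theorem exists_localRing_of_finiteType (L : Type*) (B : Type u) [Field L] [CharZero L] [CommRing B]
    [IsDomain B] [Algebra L B] [Algebra.FiniteType L B] (t : B)
    (ht : ∀ c : FractionRing B, IsIntegral B c → c * algebraMap B (FractionRing B) t ≠ 1) :
    ∃ (V : Type u) (_ : CommRing V) (_ : IsLocalRing V) (_ : IsNoetherianRing V)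
      (f : B →+* V), (IsLocalRing.maximalIdeal V).IsPrincipal ∧ Function.Injective f ∧
      f t ∈ IsLocalRing.maximalIdeal V := by
  obtain ⟨s, g, hginj, hgfin⟩ := exists_finite_inj_algHom_of_fg L B
  set A := MvPolynomial (Fin s) L
  let : Algebra A B := g.toRingHom.toAlgebra
  have : Module.Finite A B := hgfin
  have : FaithfulSMul A B := (faithfulSMul_iff_algebraMap_injective A B).2 hginj
  set K := FractionRing B
  let : Algebra (FractionRing A) K := FractionRing.liftAlgebra A K
  have : FiniteDimensional (FractionRing A) K :=
    .of_isLocalization A B (nonZeroDivisors A)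
  have : CharZero A := charZero_of_injective_algebraMap (MvPolynomial.C_injective (Fin s) L)
  have : CharZero (FractionRing A) :=
    charZero_of_injective_algebraMap (IsFractionRing.injective A (FractionRing A))
  set C := integralClosure A K
  have : IsNoetherianRing C := IsIntegralClosure.isNoetherianRing A (FractionRing A) K C
  have : IsIntegrallyClosed C := integralClosure.isIntegrallyClosedOfFiniteExtension (FractionRing A)
  have hBint : ∀ b : B, IsIntegral A (algebraMap B K b) := fun b =>
    (Algebra.IsIntegral.isIntegral (R := A) b).map (IsScalarTower.toAlgHom A B K)
  let i : B →+* C := (algebraMap B K).codRestrict C.toSubring hBint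
  have hi : Function.Injective i := fun x z h =>
    IsFractionRing.injective B K (congrArg Subtype.val h)
  have hnu : ¬ IsUnit (i t) := by
    rintro h
    obtain ⟨c, hc⟩ := h.exists_left_inv
    exact ht c.1 (c.2.tower_top (A := B)) (congrArg Subtype.val hc)
  obtain ⟨M, hM, htM⟩ := exists_max_ideal_of_mem_nonunits hnu
  obtain ⟨p, hp, -⟩ := Ideal.exists_minimalPrimes_le (I := Ideal.span {i t}) (J := M)
    ((Ideal.span_singleton_le_iff_mem _).2 htM)
  have := hp.isPrime
  have hht := Ideal.height_le_one_of_isPrincipal_of_mem_minimalPrimes (Ideal.span {i t}) p hp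
  let V := Localization.AtPrime p
  have : IsNoetherianRing V := IsLocalization.isNoetherianRing p.primeCompl V inferInstance
  have : IsIntegrallyClosed V :=
    isIntegrallyClosed_of_isLocalization V p.primeCompl p.primeCompl_le_nonZeroDivisors
  refine ⟨V, inferInstance, inferInstance, inferInstance, (algebraMap C V).comp i, ?_, ?_, ?_⟩
  · apply IsLocalRing.maximalIdeal_isPrincipal_of_height_le_one
    rwa [← IsLocalization.height_under p.primeCompl, Localization.AtPrime.under_maximalIdeal]
  · exact (IsLocalization.injective V p.primeCompl_le_nonZeroDivisors).comp hi
  · have h1 : i t ∈ p := hp.1.2 (Ideal.mem_span_singleton_self _)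
    exact (IsLocalization.AtPrime.to_map_mem_maximal_iff V p (i t)).2 h1

/-- In a field of characteristic zero, an element whose inverse lies outside an integrally closed
subring cannot have all its logarithmic partial derivatives in that subring. -/
theorem no_logarithm {L F : Type*} [Field L] [CharZero L] [Field F] [Algebra L F]
    (O : Subring F) (hO : ∀ x : F, IsIntegral O x → x ∈ O) (hL : ∀ c : L, algebraMap L F c ∈ O)
    {m : ℕ} (y a : Fin m → F) (hy : ∀ j, y j ∈ O) (ha : ∀ j, a j ∈ O)
    (P : MvPolynomial (Fin m) L)
    (hP : ∀ j, MvPolynomial.aeval y (MvPolynomial.pderiv j P) = MvPolynomial.aeval y P * a j)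
    (h0 : MvPolynomial.aeval y P ≠ 0) (hinv : (MvPolynomial.aeval y P)⁻¹ ∉ O) : False := by
  classical
  let OL : Subalgebra L F := { O with algebraMap_mem' := hL }
  let B : Subalgebra L F := Algebra.adjoin L (Set.range y ∪ Set.range a)
  have hBO : ∀ x ∈ B, x ∈ O := by
    have : B ≤ OL := Algebra.adjoin_le (by
      rintro x (⟨j, rfl⟩ | ⟨j, rfl⟩)
      · exact hy j
      · exact ha j)
    exact fun x hx => this hx
  have : Algebra.FiniteType L B := (Subalgebra.fg_iff_finiteType B).1
    (Subalgebra.fg_def.2 ⟨_, (Set.finite_range y).union (Set.finite_range a), rfl⟩)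
  let y' : Fin m → B := fun j => ⟨y j, Algebra.subset_adjoin (Or.inl ⟨j, rfl⟩)⟩
  let a' : Fin m → B := fun j => ⟨a j, Algebra.subset_adjoin (Or.inr ⟨j, rfl⟩)⟩
  have hev : ∀ Q : MvPolynomial (Fin m) L,
      (MvPolynomial.aeval y' Q : F) = MvPolynomial.aeval y Q := by
    intro Q
    have := MvPolynomial.comp_aeval (R := L) y' B.val
    exact DFunLike.congr_fun this Q
  obtain ⟨V, _, _, _, f, hpr, hinj, hmem⟩ := exists_localRing_of_finiteType L B
    (MvPolynomial.aeval y' P) (by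
      intro c hc h1
      let e : FractionRing B →ₐ[B] F := IsFractionRing.liftAlgHom (g := Algebra.ofId B F)
        Subtype.val_injective
      have h2 : e c * MvPolynomial.aeval y P = 1 := by
        rw [← hev, ← map_one e, ← h1, map_mul]
        congr 1
        exact (e.commutes _).symm
      have h3 : IsIntegral B (e c) := hc.map e
      have h4 : e c ∈ O := by
        apply hO
        obtain ⟨p, hp, hp2⟩ := h3
        refine ⟨p.map (Subring.inclusion hBO : B.toSubring →+* O), hp.map _, ?_⟩
        rw [Polynomial.eval₂_map]
        exact hp2
      apply hinv
      rwa [← eq_inv_of_mul_eq_one_left h2])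
  let : Algebra L V := (f.comp (algebraMap L B)).toAlgebra
  let f' : B →ₐ[L] V := { f with commutes' := fun _ => rfl }
  have hev2 : ∀ Q : MvPolynomial (Fin m) L,
      MvPolynomial.aeval (fun j => f' (y' j)) Q = f' (MvPolynomial.aeval y' Q) := by
    intro Q
    have := MvPolynomial.comp_aeval (R := L) y' f'
    exact (DFunLike.congr_fun this Q).symm
  refine no_logarithm_of_isLocalRing hpr (fun j => f' (y' j)) (fun j => f' (a' j)) P (fun j => ?_) ?_ ?_
  · rw [hev2, hev2, ← map_mul]
    congr 1
    apply Subtype.ext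
    rw [hev, hP, ← hev]
    rfl
  · rw [hev2]
    intro h
    have h5 : MvPolynomial.aeval y' P = 0 := hinj (h.trans (map_zero f).symm)
    apply h0
    rw [← hev, h5]
    rfl
  · rw [hev2]
    exact hmem

section FunctionalCalculus

variable {E : Type*} [NormedAddCommGroup E] [NormedSpace ℝ E]
  {A : Type*} [NormedRing A] [NormedAlgebra ℝ A]

/-- The power series of `(x, t) ↦ f (x, t • S)`, where `p` is the power series of a function `f` of
`(x, t)` and `S` is an element of a Banach algebra. -/
noncomputable def FormalMultilinearSeries.substSnd (p : FormalMultilinearSeries ℝ (E × ℝ) ℝ) (S : A) :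
    FormalMultilinearSeries ℝ (E × ℝ) A := fun n =>
  ∑ s : Finset (Fin n), ((p n).compContinuousLinearMap fun i =>
    if i ∈ s then (ContinuousLinearMap.inl ℝ E ℝ).comp (ContinuousLinearMap.fst ℝ E ℝ)
    else (ContinuousLinearMap.inr ℝ E ℝ).comp (ContinuousLinearMap.snd ℝ E ℝ)).smulRight
      (S ^ sᶜ.card)

theorem FormalMultilinearSeries.norm_substSnd_le [NormOneClass A]
    (p : FormalMultilinearSeries ℝ (E × ℝ) ℝ) {S : A} (hS : ‖S‖ ≤ 1) (n : ℕ) :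
    ‖p.substSnd S n‖ ≤ 2 ^ n * ‖p n‖ := by
  have h1 : ∀ s : Finset (Fin n), ‖((p n).compContinuousLinearMap fun i =>
      if i ∈ s then (ContinuousLinearMap.inl ℝ E ℝ).comp (ContinuousLinearMap.fst ℝ E ℝ)
      else (ContinuousLinearMap.inr ℝ E ℝ).comp (ContinuousLinearMap.snd ℝ E ℝ)).smulRight
        (S ^ sᶜ.card)‖ ≤ ‖p n‖ := by
    intro s
    rw [ContinuousMultilinearMap.norm_smulRight]
    have h2 : ‖S ^ sᶜ.card‖ ≤ 1 := (norm_pow_le _ _).trans (pow_le_one₀ (norm_nonneg _) hS)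
    have h3 : ∀ i, ‖(if i ∈ s then (ContinuousLinearMap.inl ℝ E ℝ).comp (ContinuousLinearMap.fst ℝ E ℝ)
        else (ContinuousLinearMap.inr ℝ E ℝ).comp (ContinuousLinearMap.snd ℝ E ℝ))‖ ≤ 1 := by
      intro i
      split_ifs
      · refine ContinuousLinearMap.opNorm_le_bound _ zero_le_one fun z => ?_
        simp [Prod.norm_def]
      · refine ContinuousLinearMap.opNorm_le_bound _ zero_le_one fun z => ?_
        simp [Prod.norm_def]
    have h4 := (p n).norm_compContinuousLinearMap_le fun i =>
      if i ∈ s then (ContinuousLinearMap.inl ℝ E ℝ).comp (ContinuousLinearMap.fst ℝ E ℝ)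
      else (ContinuousLinearMap.inr ℝ E ℝ).comp (ContinuousLinearMap.snd ℝ E ℝ)
    have h5 := Finset.prod_le_one (s := Finset.univ) (fun i _ => norm_nonneg _) (fun i _ => h3 i)
    calc _ ≤ ‖p n‖ * 1 := by
          refine (mul_le_mul_of_nonneg_left h2 (norm_nonneg _)).trans ?_
          rw [mul_one]
          exact h4.trans (mul_le_mul_of_nonneg_left h5 (norm_nonneg _))
      _ = ‖p n‖ := mul_one _
  refine (norm_sum_le _ _).trans ((Finset.sum_le_sum fun s _ => h1 s).trans ?_)
  simp

theorem FormalMultilinearSeries.substSnd_apply (p : FormalMultilinearSeries ℝ (E × ℝ) ℝ) (S : A)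
    (l : A →L[ℝ] ℝ) (c s : ℝ) (hl : ∀ k : ℕ, l (S ^ k) = s ^ k * c) (n : ℕ) (z : E × ℝ) :
    l (p.substSnd S n fun _ => z) = p n (fun _ => (z.1, s * z.2)) * c := by
  have h1 : (fun _ : Fin n => (z.1, s * z.2)) =
      (fun _ => ((z.1, 0) : E × ℝ)) + (fun _ => (0, s * z.2)) := by
    funext i; simp
  rw [h1, (p n).map_add_univ, Finset.sum_mul]
  simp only [FormalMultilinearSeries.substSnd, sum_apply, map_sum]
  refine Finset.sum_congr rfl fun t _ => ?_
  rw [ContinuousMultilinearMap.smulRight_apply, map_smul, hl, smul_eq_mul, ← mul_assoc]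
  congr 1
  rw [ContinuousMultilinearMap.compContinuousLinearMap_apply]
  have h2 : (t.piecewise (fun _ => ((z.1, 0) : E × ℝ)) (fun _ => (0, s * z.2))) =
      fun i => (if i ∈ t then (1 : ℝ) else s) •
        (if i ∈ t then ((z.1, 0) : E × ℝ) else (0, z.2)) := by
    funext i
    by_cases hi : i ∈ t <;> simp [hi]
  rw [h2, ContinuousMultilinearMap.map_smul_univ]
  rw [Finset.prod_ite, Finset.prod_const_one, one_mul, Finset.prod_const, smul_eq_mul, mul_comm]
  congr 2
  · congr 1
    ext i
    simp
  · funext i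
    by_cases hi : i ∈ t <;> simp [hi]

theorem AnalyticAt.exists_substSnd [NormOneClass A] [CompleteSpace A] {f : E × ℝ → ℝ}
    (hf : AnalyticAt ℝ f 0) {S : A} (hS : ‖S‖ ≤ 1) :
    ∃ F : E × ℝ → A, ∃ ε > 0, AnalyticOnNhd ℝ F (Metric.ball 0 ε) ∧
      ∀ z ∈ Metric.ball (0 : E × ℝ) ε, ∀ (l : A →L[ℝ] ℝ) (c s : ℝ), |s| ≤ 1 →
        (∀ k : ℕ, l (S ^ k) = s ^ k * c) → l (F z) = f (z.1, s * z.2) * c := by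
  obtain ⟨p, hp⟩ := hf
  obtain ⟨r, hr⟩ := hp
  obtain ⟨r', hr'0, hr'⟩ := ENNReal.lt_iff_exists_nnreal_btwn.1 hr.r_pos
  have hr'pos : (0 : ℝ) < r' := by exact_mod_cast hr'0
  obtain ⟨C, hC0, hC⟩ := p.norm_mul_pow_le_of_lt_radius (hr'.trans_le hr.r_le)
  have hrad : ((r' / 2 : NNReal) : ENNReal) ≤ (p.substSnd S).radius := by
    refine FormalMultilinearSeries.le_radius_of_bound _ C fun n => ?_
    calc ‖p.substSnd S n‖ * ((r' / 2 : NNReal) : ℝ) ^ n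
        ≤ (2 ^ n * ‖p n‖) * ((r' / 2 : NNReal) : ℝ) ^ n := by
          gcongr; exact p.norm_substSnd_le hS n
      _ = ‖p n‖ * (r' : ℝ) ^ n := by
          push_cast; rw [div_pow]; field_simp
      _ ≤ C := hC n
  have hpos : 0 < (p.substSnd S).radius := lt_of_lt_of_le (by
    rw [ENNReal.coe_pos]; exact half_pos (by exact_mod_cast hr'0)) hrad
  have hF := (p.substSnd S).hasFPowerSeriesOnBall hpos
  have hball : ∀ z ∈ Metric.ball (0 : E × ℝ) (r' / 2 : ℝ), z ∈ Metric.eball (0 : E × ℝ) (p.substSnd S).radius := by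
    intro z hz
    refine lt_of_lt_of_le ?_ hrad
    rw [Metric.mem_ball] at hz
    rw [edist_dist, ENNReal.ofReal_lt_iff_lt_toReal dist_nonneg ENNReal.coe_ne_top]
    rw [ENNReal.coe_toReal]
    simpa using hz
  refine ⟨(p.substSnd S).sum, r' / 2, by positivity, fun z hz => hF.analyticAt_of_mem (hball z hz), ?_⟩
  intro z hz l c s hs hl
  have h1 := (hF.hasSum (by simpa using hball z hz)).mapL l
  rw [zero_add] at h1
  have h2 : (z.1, s * z.2) ∈ Metric.eball (0 : E × ℝ) r := by
    refine lt_of_lt_of_le ?_ hr'.le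
    rw [edist_dist, ENNReal.ofReal_lt_iff_lt_toReal dist_nonneg (by simp)]
    rw [Metric.mem_ball, dist_zero_right] at hz
    rw [dist_zero_right, ENNReal.coe_toReal]
    have h3 : ‖(z.1, s * z.2)‖ ≤ ‖z‖ := by
      rw [Prod.norm_def, Prod.norm_def]
      refine max_le_max le_rfl ?_
      rw [norm_mul]
      exact mul_le_of_le_one_left (norm_nonneg _) hs
    linarith
  have h4 := (hr.hasSum h2).mul_right c
  rw [zero_add] at h4
  simp only [p.substSnd_apply S l c s hl] at h1
  exact h1.unique h4

end FunctionalCalculus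

section Weierstrass

open Filter Topology

theorem exists_unilateral_shift : ∃ (X : Type) (_ : NormedAddCommGroup X) (_ : NormedSpace ℝ X)
    (_ : CompleteSpace X) (_ : Nontrivial X) (S A : X →L[ℝ] X) (e : X) (c : X →L[ℝ] ℝ),
    ‖S‖ ≤ 1 ∧ (∀ x, A (S x) = x) ∧ (∀ x, c (S x) = 0) ∧ c e = 1 ∧ A e = 0 ∧
      (∀ x, x = S (A x) + c x • e) ∧ ∀ x, (∀ n, c ((A ^ n) x) = 0) → x = 0 := by
  let S₀ : BoundedContinuousFunction ℕ ℝ →ₗ[ℝ] BoundedContinuousFunction ℕ ℝ :=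
    { toFun := fun x => BoundedContinuousFunction.ofNormedAddCommGroupDiscrete
        (fun n => Nat.casesOn n 0 (fun k => x k)) ‖x‖ (fun n => by
          cases n with
          | zero => simp
          | succ n => exact x.norm_coe_le_norm n)
      map_add' := fun x y => by
        ext n; cases n <;> simp
      map_smul' := fun c x => by
        ext n; cases n <;> simp }
  let A₀ : BoundedContinuousFunction ℕ ℝ →ₗ[ℝ] BoundedContinuousFunction ℕ ℝ :=
    { toFun := fun x => BoundedContinuousFunction.ofNormedAddCommGroupDiscrete
        (fun n => x (n + 1)) ‖x‖ (fun n => x.norm_coe_le_norm _)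
      map_add' := fun x y => by
        ext n; simp
      map_smul' := fun c x => by
        ext n; simp }
  have hS₀ : ∀ x, ‖S₀ x‖ ≤ 1 * ‖x‖ := fun x => by
    rw [one_mul, BoundedContinuousFunction.norm_le (norm_nonneg _)]
    intro n
    cases n with
    | zero => change ‖(0 : ℝ)‖ ≤ ‖x‖; simp
    | succ n => exact x.norm_coe_le_norm n
  have hA₀ : ∀ x, ‖A₀ x‖ ≤ 1 * ‖x‖ := fun x => by
    rw [one_mul, BoundedContinuousFunction.norm_le (norm_nonneg _)]
    exact fun n => x.norm_coe_le_norm _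
  let S : BoundedContinuousFunction ℕ ℝ →L[ℝ] BoundedContinuousFunction ℕ ℝ := S₀.mkContinuous 1 hS₀
  let A : BoundedContinuousFunction ℕ ℝ →L[ℝ] BoundedContinuousFunction ℕ ℝ := A₀.mkContinuous 1 hA₀
  let e : BoundedContinuousFunction ℕ ℝ := BoundedContinuousFunction.ofNormedAddCommGroupDiscrete
        (fun n => if n = 0 then 1 else 0) 1 (fun n => by split_ifs <;> simp)
  let c : BoundedContinuousFunction ℕ ℝ →L[ℝ] ℝ := BoundedContinuousFunction.evalCLM ℝ 0
  have hAn : ∀ n (x : BoundedContinuousFunction ℕ ℝ) k, (A ^ n) x k = x (n + k) := by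
    intro n
    induction n with
    | zero => intro x k; simp
    | succ n ih =>
      intro x k
      rw [pow_succ']
      change (A ^ n) x (k + 1) = _
      rw [ih]
      congr 1
      omega
  refine ⟨BoundedContinuousFunction ℕ ℝ, inferInstance, inferInstance, inferInstance, ⟨e, 0, fun h => ?_⟩, S, A, e, c,
    LinearMap.mkContinuous_norm_le _ zero_le_one _, fun x => ?_, fun x => ?_, ?_, ?_, fun x => ?_,
    fun x hx => ?_⟩
  · have := DFunLike.congr_fun h 0
    simp [e] at this
  · ext n; rfl
  · rfl
  · rfl
  · ext n; rfl
  · ext n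
    cases n with
    | zero => change x 0 = 0 + x 0 * 1; simp
    | succ n => change x (n + 1) = x (n + 1) + x 0 * 0; simp
  · ext n
    have := hx n
    change (A ^ n) x 0 = 0 at this
    rwa [hAn] at this

/-- A Banach space of power series in one variable, with multiplication `S` by the variable, the
constant series `e`, and the evaluations `ev s` at `s` close to `0`. -/
theorem exists_powerSeriesSpace : ∃ (X : Type) (_ : NormedAddCommGroup X) (_ : NormedSpace ℝ X)
    (_ : CompleteSpace X) (_ : Nontrivial X) (S : X →L[ℝ] X) (e : X) (ev : ℝ → X →L[ℝ] ℝ),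
    ‖S‖ ≤ 1 ∧ AnalyticAt ℝ ev 0 ∧ (∀ᶠ s in 𝓝 0, ∀ x, ev s (S x) = s * ev s x) ∧
      (∀ᶠ s in 𝓝 0, ev s e = 1) ∧ (∀ x, (∀ᶠ s in 𝓝 0, ev s x = 0) → x = 0) ∧
      ∀ k : ℕ, Function.Bijective fun p : X × (Fin k → ℝ) =>
        (S ^ k) p.1 + ∑ i, p.2 i • (S ^ (i : ℕ)) e := by
  obtain ⟨X, _, _, _, _, S, A, e, c, hS, hAS, hcS, hce, hAe, hdec, hsep⟩ := exists_unilateral_shift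
  let R : ℝ → X →L[ℝ] X := fun s => Ring.inverse (1 - s • A)
  have hu0 : (1 - (0 : ℝ) • A) = ((1 : (X →L[ℝ] X)ˣ) : X →L[ℝ] X) := by simp
  have hR : AnalyticAt ℝ R 0 := by
    have h1 : AnalyticAt ℝ (Ring.inverse : (X →L[ℝ] X) → X →L[ℝ] X) (1 - (0 : ℝ) • A) := by
      rw [hu0]; exact analyticAt_inverse _
    have h2 : AnalyticAt ℝ (fun s : ℝ => 1 - s • A) 0 := by fun_prop
    exact AnalyticAt.comp (f := fun s : ℝ => 1 - s • A) h1 h2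
  have hunit : ∀ᶠ s : ℝ in 𝓝 0, IsUnit (1 - s • A) := by
    have h2 : ContinuousAt (fun s : ℝ => 1 - s • A) 0 := by fun_prop
    exact h2.eventually (Units.isOpen.mem_nhds (by
      change (1 - (0 : ℝ) • A) ∈ _; rw [hu0]; exact Units.isUnit _))
  let ev : ℝ → X →L[ℝ] ℝ := fun s => c.comp (R s)
  have hev : AnalyticAt ℝ ev 0 :=
    ((ContinuousLinearMap.compL ℝ X X ℝ c).analyticAt _).comp hR
  have hrec : ∀ᶠ s : ℝ in 𝓝 0, ∀ x, ev s x = s * ev s (A x) + c x := by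
    filter_upwards [hunit] with s hs x
    have h1 : R s * (1 - s • A) = 1 := Ring.inverse_mul_cancel _ hs
    have h2 := DFunLike.congr_fun h1 x
    simp only [mul_apply_eq_comp, sub_apply,
      one_apply_eq_self, smul_apply, map_sub, map_smul] at h2
    have h3 := congrArg c h2
    rw [map_sub, map_smul, smul_eq_mul] at h3
    change c (R s x) = s * c (R s (A x)) + c x
    linarith
  have hev0 : ∀ x, ev 0 x = c x := fun x => by
    have := hrec.self_of_nhds x
    simpa using this
  refine ⟨X, inferInstance, inferInstance, inferInstance, inferInstance, S, e, ev, hS, hev, ?_, ?_,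
    ?_, ?_⟩
  · filter_upwards [hrec] with s hs x
    rw [hs (S x), hAS, hcS, add_zero]
  · filter_upwards [hrec] with s hs
    rw [hs e, hAe, hce]
    simp
  · intro x hx
    apply hsep
    have key : ∀ n, ∀ᶠ s in 𝓝 0, ev s ((A ^ n) x) = 0 := by
      intro n
      induction n with
      | zero => simpa using hx
      | succ n ih =>
        have h0 : c ((A ^ n) x) = 0 := by rw [← hev0]; exact ih.self_of_nhds
        have h1 : ∀ᶠ s in 𝓝[≠] (0 : ℝ), ev s ((A ^ (n + 1)) x) = 0 := by
          filter_upwards [hrec.filter_mono nhdsWithin_le_nhds, ih.filter_mono nhdsWithin_le_nhds,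
            self_mem_nhdsWithin] with s h2 h3 h4
          rw [h2, h0, add_zero] at h3
          rw [pow_succ']
          exact (mul_eq_zero.1 h3).resolve_left h4
        have h2 : ContinuousAt (fun s => ev s ((A ^ (n + 1)) x)) 0 :=
          hev.continuousAt.clm_apply continuousAt_const
        have h3 : ev 0 ((A ^ (n + 1)) x) = 0 :=
          tendsto_nhds_unique (h2.tendsto.mono_left nhdsWithin_le_nhds)
            (tendsto_const_nhds.congr' (h1.mono fun s hs => hs.symm))
        rw [eventually_nhdsWithin_iff] at h1
        filter_upwards [h1] with s hs
        by_cases hs0 : s = 0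
        · rw [hs0, h3]
        · exact hs hs0
    intro n
    rw [← hev0]
    exact (key n).self_of_nhds
  · intro k
    have hstep : ∀ k (q : X) (r : Fin (k + 1) → ℝ), (S ^ (k + 1)) q + ∑ i, r i • (S ^ (i : ℕ)) e =
        S ((S ^ k) q + ∑ i : Fin k, r i.succ • (S ^ (i : ℕ)) e) + r 0 • e := by
      intro k q r
      rw [Fin.sum_univ_succ]
      simp only [Fin.val_zero, pow_zero, one_apply_eq_self, map_add, map_sum, map_smul,
        Fin.val_succ, pow_succ', mul_apply_eq_comp]
      abel
    have hcx : ∀ x (t : ℝ), c (S x + t • e) = t := fun x t => by simp [hcS, hce]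
    have hAx : ∀ x (t : ℝ), A (S x + t • e) = x := fun x t => by simp [hAS, hAe]
    induction k with
    | zero =>
      constructor
      · rintro ⟨q, r⟩ ⟨q', r'⟩ h
        simp only [pow_zero, one_apply_eq_self, Finset.univ_eq_empty, Finset.sum_empty,
          add_zero] at h
        exact Prod.ext h (Subsingleton.elim _ _)
      · exact fun x => ⟨(x, 0), by simp⟩
    | succ k ih =>
      constructor
      · rintro ⟨q, r⟩ ⟨q', r'⟩ h
        simp only [hstep] at h
        have h1 := congrArg c h
        rw [hcx, hcx] at h1
        have h2 := congrArg A h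
        rw [hAx, hAx] at h2
        have h3 := ih.1 (a₁ := (q, fun i => r i.succ)) (a₂ := (q', fun i => r' i.succ)) h2
        have h4 : r 0 = r' 0 := h1
        rw [Prod.mk.injEq] at h3
        refine Prod.ext h3.1 (funext fun i => ?_)
        refine Fin.cases h4 (fun j => congrFun h3.2 j) i
      · intro x
        obtain ⟨⟨q, r⟩, hqr⟩ := ih.2 (A x)
        refine ⟨(q, Fin.cons (c x) r), ?_⟩
        simp only at hqr ⊢
        rw [hstep]
        simp only [Fin.cons_succ, Fin.cons_zero, hqr]
        exact (hdec x).symm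

end Weierstrass

section WeierstrassDivision

open Filter Topology

theorem AnalyticAt.continuousLinearMap_apply {E F G : Type*} [NormedAddCommGroup E]
    [NormedSpace ℝ E] [NormedAddCommGroup F] [NormedSpace ℝ F] [NormedAddCommGroup G]
    [NormedSpace ℝ G] {f : E → F →L[ℝ] G} {g : E → F} {x : E} (hf : AnalyticAt ℝ f x)
    (hg : AnalyticAt ℝ g x) : AnalyticAt ℝ (fun y => f y (g y)) x :=
  ((ContinuousLinearMap.id ℝ (F →L[ℝ] G)).analyticAt_bilinear (f x, g x)).comp₂ hf hg

/-- If `Ψ` is analytic and `Ψ 0` is bijective then `Ψ x y = G x` has an analytic solution `y`. -/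
theorem AnalyticAt.exists_solution {E Y X : Type*} [NormedAddCommGroup E] [NormedSpace ℝ E]
    [NormedAddCommGroup Y] [NormedSpace ℝ Y] [CompleteSpace Y] [NormedAddCommGroup X]
    [NormedSpace ℝ X] [CompleteSpace X] {Ψ : E → Y →L[ℝ] X} {G : E → X} {x₀ : E}
    (hΨ : AnalyticAt ℝ Ψ x₀) (hG : AnalyticAt ℝ G x₀) (hbij : Function.Bijective (Ψ x₀)) :
    ∃ y : E → Y, AnalyticAt ℝ y x₀ ∧ ∀ᶠ x in 𝓝 x₀, Ψ x (y x) = G x := by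
  let e := ContinuousLinearEquiv.ofBijective (Ψ x₀) (LinearMap.ker_eq_bot.2 hbij.1)
    (LinearMap.range_eq_top.2 hbij.2)
  let Φ : E → Y →L[ℝ] Y := fun x => (e.symm : X →L[ℝ] Y).comp (Ψ x)
  have hΦ : AnalyticAt ℝ Φ x₀ :=
    ((ContinuousLinearMap.compL ℝ Y X Y (e.symm : X →L[ℝ] Y)).analyticAt _).comp hΨ
  have hΦ0 : Φ x₀ = ((1 : (Y →L[ℝ] Y)ˣ) : Y →L[ℝ] Y) := by
    ext y
    exact e.symm_apply_apply y
  have hinv : AnalyticAt ℝ (fun x => Ring.inverse (Φ x)) x₀ := by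
    refine AnalyticAt.comp (g := Ring.inverse) (f := Φ) ?_ hΦ
    rw [hΦ0]
    exact analyticAt_inverse _
  refine ⟨fun x => Ring.inverse (Φ x) (e.symm (G x)), hinv.continuousLinearMap_apply
    (((e.symm : X →L[ℝ] Y).analyticAt _).comp hG), ?_⟩
  have hunit : ∀ᶠ x in 𝓝 x₀, IsUnit (Φ x) :=
    hΦ.continuousAt.eventually (Units.isOpen.mem_nhds (by
      rw [hΦ0]
      exact Units.isUnit _))
  filter_upwards [hunit] with x hx
  have h1 := DFunLike.congr_fun (Ring.mul_inverse_cancel _ hx) (e.symm (G x))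
  exact e.symm.injective h1

/-- Weierstrass division: analytic division with remainder by a function `h` of `(x, t)` such that
`t ↦ h (0, t)` has a zero of order `k` at the origin. -/
theorem AnalyticAt.exists_weierstrass_division {E : Type*} [NormedAddCommGroup E] [NormedSpace ℝ E]
    {g h : E × ℝ → ℝ} (hg : AnalyticAt ℝ g 0) (hh : AnalyticAt ℝ h 0) (k : ℕ) {u : ℝ → ℝ}
    (hu : AnalyticAt ℝ u 0) (hu0 : u 0 ≠ 0) (hhu : ∀ᶠ t in 𝓝 0, h (0, t) = t ^ k * u t) :
    ∃ q : E × ℝ → ℝ, AnalyticAt ℝ q 0 ∧ ∃ r : Fin k → E → ℝ, (∀ i, AnalyticAt ℝ (r i) 0) ∧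
      ∀ᶠ z in 𝓝 0, g z = q z * h z + ∑ i, r i z.1 * z.2 ^ (i : ℕ) := by
  obtain ⟨X, _, _, _, _, S, e, ev, hS, hev, hevS, heve, hsep, hbij⟩ := exists_powerSeriesSpace
  have hevSk : ∀ᶠ s in 𝓝 0, ∀ (k : ℕ) x, ev s ((S ^ k) x) = s ^ k * ev s x := by
    filter_upwards [hevS] with s hs k
    induction k with
    | zero => simp
    | succ k ih =>
      intro x
      rw [pow_succ', mul_apply_eq_comp, hs, ih]
      ring
  have hs1 : ∀ᶠ s : ℝ in 𝓝 0, |s| ≤ 1 := by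
    filter_upwards [Metric.ball_mem_nhds (0 : ℝ) one_pos] with s hs
    simpa using (Metric.mem_ball.1 hs).le
  have hfc : ∀ f : E × ℝ → ℝ, AnalyticAt ℝ f 0 → ∃ F : E × ℝ → X →L[ℝ] X, ∃ ε > 0,
      AnalyticOnNhd ℝ F (Metric.ball 0 ε) ∧ ∀ᶠ s in 𝓝 0, ∀ z ∈ Metric.ball (0 : E × ℝ) ε, ∀ x,
        ev s (F z x) = f (z.1, s * z.2) * ev s x := by
    intro f hf
    obtain ⟨F, ε, hε, hF, hFev⟩ := hf.exists_substSnd hS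
    refine ⟨F, ε, hε, hF, ?_⟩
    filter_upwards [hevSk, hs1] with s h1 h2 z hz x
    exact hFev z hz ((ev s).comp (ContinuousLinearMap.apply ℝ X x)) _ s h2 fun k => h1 k x
  obtain ⟨gS, εg, hεg, hgS, hgev⟩ := hfc g hg
  obtain ⟨hS', εh, hεh, hhS, hhev⟩ := hfc h hh
  have hu2 : AnalyticAt ℝ (fun z : E × ℝ => u z.2) 0 :=
    AnalyticAt.comp (g := u) (f := Prod.snd) hu analyticAt_snd
  obtain ⟨uS, εu, hεu, huS, huev⟩ := hfc _ hu2
  have huS0 : uS 0 = u 0 • 1 := by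
    ext x
    refine sub_eq_zero.1 (hsep _ ?_)
    filter_upwards [huev] with s hs
    rw [map_sub, hs 0 (Metric.mem_ball_self hεu)]
    simp
  have hunit : ∀ᶠ z in 𝓝 0, IsUnit (uS z) := by
    refine (huS 0 (Metric.mem_ball_self hεu)).continuousAt.eventually (Units.isOpen.mem_nhds ?_)
    change IsUnit (uS 0)
    rw [huS0, ← Algebra.algebraMap_eq_smul_one]
    exact (IsUnit.mk0 _ hu0).map _
  obtain ⟨ρ, hρ, hρg, hρh, hρu, hρunit⟩ : ∃ ρ : ℝ, 0 < ρ ∧ ((0 : E), ρ) ∈ Metric.ball 0 εg ∧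
      ((0 : E), ρ) ∈ Metric.ball 0 εh ∧ ((0 : E), ρ) ∈ Metric.ball 0 εu ∧ IsUnit (uS (0, ρ)) := by
    have hc : Tendsto (fun ρ : ℝ => ((0 : E), ρ)) (𝓝[>] 0) (𝓝 0) :=
      ((Continuous.prodMk_right (0 : E)).tendsto' 0 0 rfl).mono_left nhdsWithin_le_nhds
    exact ((eventually_mem_nhdsWithin (s := Set.Ioi (0 : ℝ)) (a := (0 : ℝ))).and
      ((hc.eventually (Metric.ball_mem_nhds _ hεg)).and
      ((hc.eventually (Metric.ball_mem_nhds _ hεh)).and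
      ((hc.eventually (Metric.ball_mem_nhds _ hεu)).and (hc.eventually hunit))))).exists
  have hpair : AnalyticAt ℝ (fun x : E => (x, ρ)) 0 := analyticAt_id.prod analyticAt_const
  have hpairc : Tendsto (fun x : E => (x, ρ)) (𝓝 0) (𝓝 (0, ρ)) := hpair.continuousAt
  have hH : AnalyticAt ℝ (fun x : E => hS' (x, ρ)) 0 :=
    AnalyticAt.comp (g := hS') (f := fun x : E => (x, ρ)) (hhS _ hρh) hpair
  have hG : AnalyticAt ℝ (fun x : E => gS (x, ρ) e) 0 :=
    (AnalyticAt.comp (g := gS) (f := fun x : E => (x, ρ)) (hgS _ hρg) hpair).continuousLinearMap_apply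
      analyticAt_const
  let Rm : (Fin k → ℝ) →L[ℝ] X :=
    ∑ i, (ContinuousLinearMap.proj (R := ℝ) (φ := fun _ : Fin k => ℝ) i).smulRight ((S ^ (i : ℕ)) e)
  have hRm : ∀ r, Rm r = ∑ i, r i • (S ^ (i : ℕ)) e := fun r => by simp [Rm, sum_apply]
  let Ψ : E → X × (Fin k → ℝ) →L[ℝ] X := fun x =>
    (hS' (x, ρ)).comp (ContinuousLinearMap.fst ℝ X _) + Rm.comp (ContinuousLinearMap.snd ℝ X _)
  have hΨ : AnalyticAt ℝ Ψ 0 :=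
    ((((ContinuousLinearMap.compL ℝ (X × (Fin k → ℝ)) X X).flip
      (ContinuousLinearMap.fst ℝ X _)).analyticAt _).comp hH).add analyticAt_const
  have hmulρ : Tendsto (fun s : ℝ => s * ρ) (𝓝 0) (𝓝 0) :=
    (continuous_id.mul continuous_const).tendsto' _ _ (by simp)
  have hH0 : ∀ q, hS' (0, ρ) q = (S ^ k) ((ρ ^ k • uS (0, ρ)) q) := by
    intro q
    refine sub_eq_zero.1 (hsep _ ?_)
    filter_upwards [hhev, huev, hevSk, hmulρ.eventually hhu] with s h1 h2 h3 h4
    rw [map_sub, h1 _ hρh, h3, smul_apply, map_smul, h2 _ hρu, h4, smul_eq_mul]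
    ring
  have hΨ0 : Function.Bijective (Ψ 0) := by
    have h1 : IsUnit (ρ ^ k • uS (0, ρ)) := by
      rw [Algebra.smul_def]
      exact ((IsUnit.mk0 _ (pow_pos hρ k).ne').map _).mul hρunit
    have h2 := (hbij k).comp ((ContinuousLinearMap.isUnit_iff_bijective.1 h1).prodMap
      (Function.bijective_id (α := Fin k → ℝ)))
    convert h2 using 1
    ext1 p
    change hS' (0, ρ) p.1 + Rm p.2 = _
    rw [hH0, hRm]
    rfl
  obtain ⟨y, hy, hyeq⟩ := hΨ.exists_solution hG hΨ0
  have hy1 : AnalyticAt ℝ (fun z : E × ℝ => (y z.1).1) 0 :=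
    (analyticAt_fst).comp (AnalyticAt.comp (g := y) (f := Prod.fst) hy analyticAt_fst)
  have hdiv : AnalyticAt ℝ (fun z : E × ℝ => ev (z.2 / ρ)) 0 := by
    refine AnalyticAt.comp (g := ev) (f := fun z : E × ℝ => z.2 / ρ) (by simpa using hev) ?_
    exact analyticAt_snd.div_const
  have hdivc : Tendsto (fun z : E × ℝ => z.2 / ρ) (𝓝 0) (𝓝 0) :=
    (continuous_snd.div_const ρ).tendsto' _ _ (by simp)
  have hfstc : Tendsto (Prod.fst : E × ℝ → E) (𝓝 0) (𝓝 0) := continuous_fst.tendsto' _ _ rfl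
  refine ⟨_, hdiv.continuousLinearMap_apply hy1, fun i x => (y x).2 i * (ρ ^ (i : ℕ))⁻¹, fun i => ?_,
    ?_⟩
  · refine AnalyticAt.mul ?_ analyticAt_const
    exact (((ContinuousLinearMap.proj (R := ℝ) (φ := fun _ : Fin k => ℝ) i).comp
      (ContinuousLinearMap.snd ℝ X _)).analyticAt _).comp hy
  · filter_upwards [hdivc.eventually hgev, hdivc.eventually hhev, hdivc.eventually hevSk,
      hdivc.eventually heve, hfstc.eventually hyeq,
      hfstc.eventually (hpairc.eventually (Metric.isOpen_ball.mem_nhds hρg)),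
      hfstc.eventually (hpairc.eventually (Metric.isOpen_ball.mem_nhds hρh))] with
      z h1 h2 h3 h4 h5 h6 h7
    have h8 := congrArg (ev (z.2 / ρ)) h5
    change ev (z.2 / ρ) (hS' (z.1, ρ) (y z.1).1 + Rm (y z.1).2) = _ at h8
    rw [map_add, h2 _ h7, h1 _ h6, hRm, map_sum, h4, div_mul_cancel₀ _ hρ.ne', mul_one] at h8
    rw [← h8, mul_comm]
    congr 1
    refine Finset.sum_congr rfl fun i _ => ?_
    rw [map_smul, h3, h4, smul_eq_mul, div_pow]
    ring

end WeierstrassDivision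

section Preparation

open Filter Topology

/-- The ring of functions which are analytic at the origin. -/
def analyticAtZero (E : Type*) [NormedAddCommGroup E] [NormedSpace ℝ E] : Subring (E → ℝ) where
  carrier := {f | AnalyticAt ℝ f 0}
  mul_mem' hf hg := AnalyticAt.mul hf hg
  one_mem' := analyticAt_const
  add_mem' hf hg := AnalyticAt.add hf hg
  zero_mem' := analyticAt_const
  neg_mem' hf := AnalyticAt.neg hf

namespace analyticAtZero

variable {E F : Type*} [NormedAddCommGroup E] [NormedSpace ℝ E] [NormedAddCommGroup F]
  [NormedSpace ℝ F]

/-- Composition with a continuous linear map. -/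
def pullback (π : E →L[ℝ] F) : analyticAtZero F →+* analyticAtZero E where
  toFun f := ⟨fun x => f.1 (π x), AnalyticAt.comp (g := f.1) (f := π)
    (by rw [map_zero]; exact f.2) (π.analyticAt 0)⟩
  map_one' := rfl
  map_mul' _ _ := rfl
  map_zero' := rfl
  map_add' _ _ := rfl

/-- A continuous linear functional as an analytic function. -/
def ofLinear (y : E →L[ℝ] ℝ) : analyticAtZero E := ⟨y, y.analyticAt 0⟩

/-- A nonzero analytic germ does not vanish identically along some direction. -/
theorem exists_direction (h : analyticAtZero E) (hh : ¬ ∀ᶠ x in 𝓝 0, h.1 x = 0) :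
    ∃ v : E, ¬ ∀ᶠ t : ℝ in 𝓝 0, h.1 (t • v) = 0 := by
  by_contra! hv
  apply hh
  obtain ⟨ε, hε, hball⟩ := Metric.eventually_nhds_iff_ball.1 h.2.eventually_analyticAt
  filter_upwards [Metric.ball_mem_nhds 0 hε] with x hx
  let I : Set ℝ := (fun t : ℝ => t • x) ⁻¹' Metric.ball 0 ε
  have hI : IsPreconnected I := by
    refine Convex.isPreconnected ?_
    exact (convex_ball (0 : E) ε).is_linear_preimage (IsLinearMap.isLinearMap_smul' x)
  have han : AnalyticOnNhd ℝ (fun t : ℝ => h.1 (t • x)) I := by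
    intro t ht
    exact AnalyticAt.comp (g := h.1) (f := fun t : ℝ => t • x) (hball _ ht)
      (analyticAt_id.smul analyticAt_const)
  have h0 : (0 : ℝ) ∈ I := by simpa [I] using hε
  have h1 : (1 : ℝ) ∈ I := by simpa [I] using hx
  have := han.eqOn_zero_of_preconnected_of_eventuallyEq_zero hI h0 (hv x) h1
  simpa using this


theorem exists_preparation (n : ℕ) : ∀ (E : Type u) [NormedAddCommGroup E] [NormedSpace ℝ E]
    [FiniteDimensional ℝ E], Module.finrank ℝ E = n → ∀ C : Set (analyticAtZero E),
    (∀ h ∈ C, h.1 0 = 0) →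
    ∃ (A : Subring (analyticAtZero E)) (m : ℕ) (y : Fin m → E →L[ℝ] ℝ) (v : Fin m → E)
      (s : Finset (analyticAtZero E)), (s : Set (analyticAtZero E)) ⊆ C ∧
      (∀ i j, y i (v j) = if i = j then 1 else 0) ∧
      (∀ r ∈ A, ∀ j x (t : ℝ), r.1 (x + t • v j) = r.1 x) ∧
      (∀ r ∈ A, r ∈ C → ∀ᶠ x in 𝓝 0, r.1 x = 0) ∧
      ∀ (N : ℕ) (g : analyticAtZero E),
        ∃ g₀ ∈ Subring.closure ((A : Set (analyticAtZero E)) ∪ Set.range fun j => ofLinear (y j)),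
        ∃ w ∈ Ideal.span (s : Set (analyticAtZero E)) ^ N,
          ∀ᶠ x in 𝓝 0, g.1 x = g₀.1 x + w.1 x := by
  induction n using Nat.strong_induction_on with
  | _ n ih =>
  intro E _ _ _ hn C hC
  by_cases hC0 : ∀ h ∈ C, ∀ᶠ x in 𝓝 0, h.1 x = 0
  · refine ⟨⊤, 0, Fin.elim0, Fin.elim0, ∅, by simp, fun i => i.elim0, fun r _ j => j.elim0,
      fun r _ hr => hC0 r hr, fun N g => ⟨g, Subring.subset_closure (Or.inl trivial), 0,
      Ideal.zero_mem _, Eventually.of_forall fun x => ?_⟩⟩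
    exact (add_zero _).symm
  obtain ⟨h, hhC, hh0⟩ : ∃ h ∈ C, ¬ ∀ᶠ x in 𝓝 0, h.1 x = 0 := by
    simpa only [not_forall, exists_prop] using hC0
  obtain ⟨v₀, hv₀⟩ := exists_direction h hh0
  have hv₀0 : v₀ ≠ 0 := by
    rintro rfl
    exact hv₀ (Eventually.of_forall fun t => by simpa using hC h hhC)
  obtain ⟨y₀, hy₀⟩ := SeparatingDual.exists_eq_one (R := ℝ) hv₀0
  let K : Submodule ℝ E := LinearMap.ker (y₀ : E →ₗ[ℝ] ℝ)
  have hK : Module.finrank ℝ K < n := by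
    rw [← hn]
    refine Submodule.finrank_lt fun htop => ?_
    have : v₀ ∈ K := by rw [htop]; trivial
    have h2 : y₀ v₀ = 0 := this
    exact one_ne_zero (hy₀.symm.trans h2)
  let π : E →L[ℝ] K := (ContinuousLinearMap.id ℝ E - y₀.smulRight v₀).codRestrict K fun x => by
    change y₀ (x - y₀ x • v₀) = 0
    simp [hy₀]
  have hπ : ∀ x, ((π x : K) : E) = x - y₀ x • v₀ := fun x => rfl
  have hπv : π v₀ = 0 := Subtype.ext (by rw [hπ, hy₀]; simp)
  have hπK : ∀ x : K, π (x : E) = x := fun x => Subtype.ext (by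
    have : y₀ x = 0 := x.2
    rw [hπ, this]; simp)
  obtain ⟨A, m, y, v, s, hs, hyv, hA, hAC, hdiv⟩ := ih _ hK K rfl {r | pullback π r ∈ C}
    (fun r hr => by
      have := hC _ hr
      change r.1 (π 0) = 0 at this
      rwa [map_zero] at this)
  classical
  let ι := pullback π
  let S : Finset (analyticAtZero E) := insert h (s.image ι)
  let Y : Fin (m + 1) → E →L[ℝ] ℝ := Fin.cons y₀ fun j => (y j).comp π
  let B := Subring.closure ((A.map ι : Set (analyticAtZero E)) ∪ Set.range fun j => ofLinear (Y j))
  have hιB : ∀ a ∈ Subring.closure ((A : Set (analyticAtZero K)) ∪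
      Set.range fun j => ofLinear (y j)), ι a ∈ B := by
    intro a ha
    have h1 : ι a ∈ (Subring.closure ((A : Set (analyticAtZero K)) ∪
      Set.range fun j => ofLinear (y j))).map ι := ⟨a, ha, rfl⟩
    rw [RingHom.map_closure] at h1
    refine Subring.closure_mono ?_ h1
    rw [Set.image_union]
    refine Set.union_subset_union (by rw [Subring.coe_map]) ?_
    rintro _ ⟨_, ⟨j, rfl⟩, rfl⟩
    exact ⟨j.succ, rfl⟩
  have hy₀B : ofLinear y₀ ∈ B := Subring.subset_closure (Or.inr ⟨0, rfl⟩)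
  have hιI : ∀ N, ∀ w ∈ Ideal.span (s : Set (analyticAtZero K)) ^ N, ι w ∈ Ideal.span S ^ N := by
    intro N w hw
    have h1 := Ideal.mem_map_of_mem ι hw
    rw [Ideal.map_pow, Ideal.map_span] at h1
    refine Ideal.pow_right_mono (Ideal.span_mono ?_) N h1
    rw [Finset.coe_insert, Finset.coe_image]
    exact Set.subset_insert _ _
  refine ⟨A.map ι, m + 1, Y, Fin.cons v₀ fun j => (v j : E), S, ?_, ?_, ?_, ?_, ?_⟩
  · intro g hg
    rcases Finset.mem_insert.1 (Finset.mem_coe.1 hg) with rfl | hg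
    · exact hhC
    · obtain ⟨r, hr, rfl⟩ := Finset.mem_image.1 hg
      exact hs hr
  · intro i j
    refine Fin.cases ?_ (fun i => ?_) i <;> refine Fin.cases ?_ (fun j => ?_) j
    · simp [Y, hy₀]
    · have : y₀ (v j) = 0 := (v j).2
      simp [Y, (Fin.succ_ne_zero _).symm]
    · simp [Y, hπv]
    · simp [Y, hπK, hyv]
  · rintro _ ⟨r, hr, rfl⟩ j x t
    change r.1 (π (x + t • _)) = r.1 (π x)
    rw [map_add, map_smul]
    refine Fin.cases ?_ (fun j => ?_) j
    · simp [hπv]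
    · simp only [Fin.cons_succ, hπK]
      exact hA r hr j _ t
  · rintro _ ⟨r, hr, rfl⟩ hrC
    have h1 : Tendsto π (𝓝 0) (𝓝 0) := π.continuous.tendsto' _ _ (map_zero _)
    exact h1.eventually (hAC r hr hrC)
  · intro N g
    have h1 : AnalyticAt ℝ (fun t : ℝ => h.1 (t • v₀)) 0 :=
      AnalyticAt.comp (g := h.1) (f := fun t : ℝ => t • v₀) (by rw [zero_smul]; exact h.2)
        (analyticAt_id.smul analyticAt_const)
    obtain ⟨k, u, hu, hu0, huh⟩ := h1.exists_eventuallyEq_pow_smul_nonzero_iff.2 hv₀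
    let Φ : K × ℝ →L[ℝ] E :=
      K.subtypeL.comp (ContinuousLinearMap.fst ℝ K ℝ) +
        (ContinuousLinearMap.snd ℝ K ℝ).smulRight v₀
    have hΦ : ∀ x, Φ (π x, y₀ x) = x := fun x => by
      change ((π x : K) : E) + y₀ x • v₀ = x
      rw [hπ]; abel
    obtain ⟨q, hq, r, hr, hqr⟩ := AnalyticAt.exists_weierstrass_division (pullback Φ g).2
      (pullback Φ (h ^ N)).2 (k * N) (hu.pow N) (pow_ne_zero N hu0) (by
        filter_upwards [huh] with t ht
        change h.1 (((0 : K) : E) + t • v₀) ^ N = _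
        rw [ZeroMemClass.coe_zero, zero_add, ht, smul_eq_mul, mul_pow, sub_zero, ← pow_mul]
        rfl)
    choose a ha w hw haw using fun i => hdiv N ⟨r i, hr i⟩
    let Q : analyticAtZero E := pullback (π.prod y₀) ⟨q, hq⟩
    have hπt : Tendsto π (𝓝 0) (𝓝 0) := π.continuous.tendsto' _ _ (map_zero _)
    have hπyt : Tendsto (π.prod y₀) (𝓝 0) (𝓝 0) :=
      (π.prod y₀).continuous.tendsto' _ _ (map_zero _)
    refine ⟨∑ i, ι (a i) * ofLinear y₀ ^ (i : ℕ), Subring.sum_mem _ fun i _ =>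
      B.mul_mem (hιB _ (ha i)) (B.pow_mem hy₀B _), Q * h ^ N + ∑ i, ι (w i) * ofLinear y₀ ^ (i : ℕ),
      Ideal.add_mem _ (Ideal.mul_mem_left _ _ (Ideal.pow_mem_pow (Ideal.subset_span ?_) N))
      (Ideal.sum_mem _ fun i _ => Ideal.mul_mem_right _ _ (hιI N _ (hw i))), ?_⟩
    · simp [S]
    · filter_upwards [hπyt.eventually hqr, hπt.eventually (eventually_all.2 haw)] with x h2 h3
      change g.1 (Φ (π x, y₀ x)) = q (π x, y₀ x) * h.1 (Φ (π x, y₀ x)) ^ N +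
        ∑ i, r i (π x) * y₀ x ^ (i : ℕ) at h2
      rw [hΦ] at h2
      simp only [Subring.coe_add, Pi.add_apply, AddSubmonoidClass.coe_finsetSum, Finset.sum_apply]
      rw [h2]
      change _ = ∑ i, (a i).1 (π x) * y₀ x ^ (i : ℕ) +
        (q (π x, y₀ x) * h.1 x ^ N + ∑ i, (w i).1 (π x) * y₀ x ^ (i : ℕ))
      rw [add_left_comm, ← Finset.sum_add_distrib]
      congr 1
      refine Finset.sum_congr rfl fun i _ => ?_
      rw [← add_mul]
      exact congrArg (· * _) (h3 i)

end analyticAtZero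

end Preparation

section AnalyticValuation

open Filter Topology

/-- Over a valuation ring, finitely many elements with powers divisible by `φ` are divisible by a
single such element. -/
theorem ValuationSubring.exists_common_divisor {F ι : Type*} [Field F] (V : ValuationSubring F)
    {φ : F} (s : Finset ι) (z : ι → F) (hzV : ∀ i ∈ s, z i ∈ V)
    (hz : ∀ i ∈ s, ∃ k : ℕ, z i ^ k / φ ∈ V) :
    ∃ β ∈ V, (∃ K : ℕ, β ^ K / φ ∈ V) ∧ ∀ i ∈ s, ∃ c ∈ V, z i = β * c := by
  classical
  induction s using Finset.induction_on with
  | empty => exact ⟨0, V.zero_mem, ⟨1, by simp [V.zero_mem]⟩, by simp⟩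
  | insert i s _ ih =>
    obtain ⟨β, hβ, hK, hs⟩ := ih (fun j hj => hzV j (Finset.mem_insert_of_mem hj))
      (fun j hj => hz j (Finset.mem_insert_of_mem hj))
    have hi := hzV i (Finset.mem_insert_self i s)
    by_cases hβ0 : β = 0
    · refine ⟨z i, hi, hz i (Finset.mem_insert_self i s), fun j hj => ?_⟩
      rcases Finset.mem_insert.1 hj with rfl | hj
      · exact ⟨1, V.one_mem, (mul_one _).symm⟩
      · obtain ⟨c, -, hc⟩ := hs j hj
        exact ⟨0, V.zero_mem, by rw [hc, hβ0]; simp⟩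
    by_cases hzβ : z i / β ∈ V
    · refine ⟨β, hβ, hK, fun j hj => ?_⟩
      rcases Finset.mem_insert.1 hj with rfl | hj
      · exact ⟨_, hzβ, by field_simp⟩
      · exact hs j hj
    · have h1 : β / z i ∈ V := by
        have := (V.mem_or_inv_mem (z i / β)).resolve_left hzβ
        rwa [inv_div] at this
      have hz0 : z i ≠ 0 := by
        rintro h0
        rw [h0, zero_div] at hzβ
        exact hzβ V.zero_mem
      refine ⟨z i, hi, hz i (Finset.mem_insert_self i s), fun j hj => ?_⟩
      rcases Finset.mem_insert.1 hj with rfl | hj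
      · exact ⟨1, V.one_mem, (mul_one _).symm⟩
      · obtain ⟨c, hc, hjc⟩ := hs j hj
        exact ⟨β / z i * c, V.mul_mem _ _ h1 hc, by rw [hjc]; field_simp⟩

namespace analyticAtZero

/-- An analytic function does not divide all its partial derivatives in a valuation ring in which it
generates the smallest nonzero prime. -/
theorem false_of_valuation {E : Type*} [NormedAddCommGroup E] [NormedSpace ℝ E]
    [FiniteDimensional ℝ E] {F : Type*} [Field F] [CharZero F] (V : ValuationSubring F)
    (ρ : analyticAtZero E →+* F) (δ : E → analyticAtZero E → F)
    (hρV : ∀ g, ρ g ∈ V) (hδV : ∀ v g, δ v g ∈ V)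
    (hρ : ∀ g h : analyticAtZero E, (∀ᶠ x in 𝓝 0, g.1 x = h.1 x) → ρ g = ρ h)
    (hδ : ∀ v, ∀ g h : analyticAtZero E, (∀ᶠ x in 𝓝 0, g.1 x = h.1 x) → δ v g = δ v h)
    (hadd : ∀ v g h, δ v (g + h) = δ v g + δ v h)
    (hmul : ∀ v g h, δ v (g * h) = ρ g * δ v h + ρ h * δ v g)
    (hinv : ∀ v, ∀ r : analyticAtZero E, (∀ x (t : ℝ), r.1 (x + t • v) = r.1 x) → δ v r = 0)
    (hlin : ∀ v y, y v = 1 → δ v (ofLinear y) = 1)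
    (f : analyticAtZero E) (hf : (ρ f)⁻¹ ∉ V) (hδf : ∀ v, δ v f / ρ f ∈ V)
    (hV : ∀ z, (∀ k : ℕ, ρ f / z ^ k ∈ V) → z⁻¹ ∈ V) : False := by
  set φ := ρ f with hφ
  have hφ0 : φ ≠ 0 := by
    intro h0
    rw [h0, inv_zero] at hf
    exact hf V.zero_mem
  obtain ⟨A, m, y, v, s, hs, hyv, hA, hAC, hdiv⟩ := exists_preparation _ E rfl
    {h : analyticAtZero E | h.1 0 = 0 ∧ ∃ k : ℕ, ρ h ^ k / φ ∈ V} (fun h hh => hh.1)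
  obtain ⟨β, hβ, ⟨K, hK⟩, hβs⟩ := V.exists_common_divisor s (fun h => ρ h) (fun h _ => hρV h)
    (fun h hh => (hs hh).2)
  -- elements of large powers of the ideal generated by `s` are small
  let J : ℕ → Ideal (analyticAtZero E) := fun N =>
    { carrier := {g | ∃ c ∈ V, ρ g = β ^ (N + 1) * c ∧ ∀ v, ∃ d ∈ V, δ v g = β ^ N * d}
      zero_mem' := ⟨0, V.zero_mem, by simp, fun v => ⟨0, V.zero_mem, by
        rw [mul_zero]; exact hinv v 0 fun _ _ => rfl⟩⟩
      add_mem' := by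
        rintro g h ⟨c, hc, hgc, hg⟩ ⟨c', hc', hhc, hh⟩
        refine ⟨c + c', V.add_mem _ _ hc hc', by rw [map_add, hgc, hhc]; ring, fun v => ?_⟩
        obtain ⟨d, hd, hgd⟩ := hg v
        obtain ⟨d', hd', hhd⟩ := hh v
        exact ⟨d + d', V.add_mem _ _ hd hd', by rw [hadd, hgd, hhd]; ring⟩
      smul_mem' := by
        rintro g h ⟨c, hc, hhc, hh⟩
        refine ⟨ρ g * c, V.mul_mem _ _ (hρV g) hc, by rw [smul_eq_mul, map_mul, hhc]; ring,
          fun v => ?_⟩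
        obtain ⟨d, hd, hhd⟩ := hh v
        refine ⟨ρ g * d + β * c * δ v g, V.add_mem _ _ (V.mul_mem _ _ (hρV g) hd)
          (V.mul_mem _ _ (V.mul_mem _ _ hβ hc) (hδV v g)), ?_⟩
        rw [smul_eq_mul, hmul, hhd, hhc]
        ring }
  have hJ0 : Ideal.span (s : Set (analyticAtZero E)) ≤ J 0 := by
    refine Ideal.span_le.2 fun h hh => ?_
    obtain ⟨c, hc, hhc⟩ := hβs h hh
    exact ⟨c, hc, by rw [hhc]; ring, fun v => ⟨_, hδV v h, by ring⟩⟩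
  have hJ : ∀ N, Ideal.span (s : Set (analyticAtZero E)) ^ (N + 1) ≤ J N := by
    intro N
    induction N with
    | zero => simpa using hJ0
    | succ N ih =>
      rw [pow_succ]
      refine (Ideal.mul_mono ih hJ0).trans (Ideal.mul_le.2 ?_)
      rintro g ⟨c, hc, hgc, hg⟩ h ⟨c', hc', hhc, hh⟩
      refine ⟨c * c', V.mul_mem _ _ hc hc', by rw [map_mul, hgc, hhc]; ring, fun v => ?_⟩
      obtain ⟨d, hd, hgd⟩ := hg v
      refine ⟨c * δ v h + c' * d, V.add_mem _ _ (V.mul_mem _ _ hc (hδV v h))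
        (V.mul_mem _ _ hc' hd), ?_⟩
      rw [hmul, hgc, hhc, hgd]
      ring
  obtain ⟨g, hg, w, hw, hfgw⟩ := hdiv (2 * K + 1) f
  have hfgw' : ∀ᶠ x in 𝓝 0, f.1 x = (g + w).1 x := hfgw
  obtain ⟨c, hc, hwc, hw⟩ := hJ _ hw
  have hβK : β ^ (2 * K) = φ ^ 2 * (β ^ K / φ) ^ 2 := by
    rw [mul_comm, pow_mul]; field_simp
  have hρg : ρ g = φ * (1 - φ * ((β ^ K / φ) ^ 2 * β * c)) := by
    have h1 := hρ _ _ hfgw'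
    rw [map_add, hwc, ← hφ, pow_succ, hβK] at h1
    linear_combination -h1
  have hb : (β ^ K / φ) ^ 2 * β * c ∈ V := V.mul_mem _ _ (V.mul_mem _ _ (pow_mem hK 2) hβ) hc
  set b := (β ^ K / φ) ^ 2 * β * c
  have hφV : φ ∈ V := hρV f
  have hunit : (1 - φ * b)⁻¹ ∈ V ∧ 1 - φ * b ≠ 0 := by
    rcases IsLocalRing.isUnit_or_isUnit_one_sub_self (⟨φ * b, V.mul_mem _ _ hφV hb⟩ : V) with
      h | h
    · exfalso
      obtain ⟨⟨d, hd⟩, hd1⟩ := h.exists_right_inv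
      have h2 : φ * b * d = 1 := congrArg Subtype.val hd1
      refine hf ?_
      rw [inv_eq_of_mul_eq_one_right (b := b * d) (by rw [← h2]; ring)]
      exact V.mul_mem _ _ hb hd
    · obtain ⟨⟨d, hd⟩, hd1⟩ := h.exists_right_inv
      have h2 : (1 - φ * b) * d = 1 := congrArg Subtype.val hd1
      exact ⟨by rwa [inv_eq_of_mul_eq_one_right h2], left_ne_zero_of_mul_eq_one h2⟩
  have hρg0 : ρ g ≠ 0 := by
    rw [hρg]
    exact mul_ne_zero hφ0 hunit.2
  have hρginv : (ρ g)⁻¹ ∉ V := by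
    intro h
    apply hf
    have h1 : φ⁻¹ = (ρ g)⁻¹ * (1 - φ * b) := by
      have := hunit.2
      rw [hρg]; field_simp
    rw [h1]
    exact V.mul_mem _ _ h (V.sub_mem V.one_mem (V.mul_mem _ _ hφV hb))
  have hδg : ∀ v, δ v g / ρ g ∈ V := by
    intro v
    obtain ⟨d, hd, hwd⟩ := hw v
    have h1 := hδ v _ _ hfgw'
    rw [hadd, hwd, hβK] at h1
    have h2 : δ v g / ρ g = (δ v f / φ - φ * ((β ^ K / φ) ^ 2 * d)) * (1 - φ * b)⁻¹ := by
      have := hunit.2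
      rw [hρg, eq_sub_of_add_eq h1.symm]
      field_simp
    rw [h2]
    exact V.mul_mem _ _ (V.sub_mem (hδf v) (V.mul_mem _ _ hφV
      (V.mul_mem _ _ (pow_mem hK 2) hd))) hunit.1
  -- the field generated by the image of `A`
  let L : Subfield F := Subfield.closure (ρ '' A)
  have hρinv : ∀ r ∈ A, (ρ r)⁻¹ ∈ V := by
    intro r hr
    by_cases hr0 : r.1 0 = 0
    · by_cases hrC : ∃ k : ℕ, ρ r ^ k / φ ∈ V
      · have h1 : ρ r = ρ 0 := hρ _ _ (hAC r hr ⟨hr0, hrC⟩)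
        rw [h1, map_zero, inv_zero]
        exact V.zero_mem
      · push Not at hrC
        refine hV _ fun k => ?_
        have := (V.mem_or_inv_mem _).resolve_left (hrC k)
        rwa [inv_div] at this
    · let r' : analyticAtZero E := ⟨fun x => (r.1 x)⁻¹, AnalyticAt.inv r.2 hr0⟩
      have h1 : ρ (r * r') = ρ 1 := by
        refine hρ _ _ ?_
        filter_upwards [r.2.continuousAt.eventually_ne hr0] with x hx
        exact mul_inv_cancel₀ hx
      rw [map_mul, map_one] at h1
      rw [inv_eq_of_mul_eq_one_right h1]
      exact hρV r'
  have hLV : ∀ x ∈ L, x ∈ V := by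
    intro x hx
    have h0 : ∀ x ∈ Subring.closure (ρ '' A), ∃ r ∈ A, ρ r = x := by
      intro x hx
      have h1 : Subring.closure (ρ '' A) ≤ A.map ρ :=
        Subring.closure_le.2 (by rw [Subring.coe_map])
      exact h1 hx
    obtain ⟨a, ha, b, hb, rfl⟩ := Subfield.mem_closure_iff.1 hx
    obtain ⟨r, hr, rfl⟩ := h0 a ha
    obtain ⟨r', hr', rfl⟩ := h0 b hb
    rw [div_eq_mul_inv]
    exact V.mul_mem _ _ (hρV r) (hρinv r' hr')
  have hpoly : ∃ P : MvPolynomial (Fin m) L,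
      MvPolynomial.aeval (fun j => ρ (ofLinear (y j))) P = ρ g ∧
      ∀ j, MvPolynomial.aeval (fun j => ρ (ofLinear (y j))) (MvPolynomial.pderiv j P) =
        δ (v j) g := by
    clear hfgw hfgw' hρg hρg0 hρginv hδg
    induction hg using Subring.closure_induction with
    | mem x hx =>
      rcases hx with hx | ⟨i, rfl⟩
      · refine ⟨MvPolynomial.C ⟨ρ x, Subfield.subset_closure ⟨x, hx, rfl⟩⟩, ?_, fun j => ?_⟩
        · simp
          rfl
        · rw [MvPolynomial.pderiv_C, map_zero, hinv _ _ (hA x hx j)]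
      · refine ⟨MvPolynomial.X i, by simp, fun j => ?_⟩
        rw [MvPolynomial.pderiv_X, Pi.single_apply]
        by_cases hij : i = j
        · subst hij
          rw [hlin _ _ (by simp [hyv])]
          simp
        · rw [hinv]
          · simp [hij]
          · intro x t
            change y i (x + t • v j) = y i x
            simp [hyv, hij]
    | zero => exact ⟨0, by simp, fun j => by
        rw [map_zero, map_zero]; exact (hinv _ 0 fun _ _ => rfl).symm⟩
    | one => exact ⟨1, by simp, fun j => by
        rw [MvPolynomial.pderiv_one, map_zero]; exact (hinv _ 1 fun _ _ => rfl).symm⟩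
    | add a b _ _ iha ihb =>
      obtain ⟨P, hP, hP'⟩ := iha
      obtain ⟨Q, hQ, hQ'⟩ := ihb
      exact ⟨P + Q, by simp [hP, hQ], fun j => by simp [hP', hQ', hadd]⟩
    | neg a _ iha =>
      obtain ⟨P, hP, hP'⟩ := iha
      refine ⟨-P, by simp [hP], fun j => ?_⟩
      have h1 := hadd (v j) a (-a)
      rw [add_neg_cancel, hinv _ 0 fun _ _ => rfl] at h1
      simp only [map_neg, hP']
      linear_combination h1
    | mul a b _ _ iha ihb =>
      obtain ⟨P, hP, hP'⟩ := iha
      obtain ⟨Q, hQ, hQ'⟩ := ihb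
      refine ⟨P * Q, by simp [hP, hQ], fun j => ?_⟩
      rw [Derivation.leibniz, hmul, smul_eq_mul, smul_eq_mul, map_add, map_mul, map_mul, hP, hQ,
        hP', hQ']
  obtain ⟨P, hP, hP'⟩ := hpoly
  refine no_logarithm V.toSubring (fun x hx => ?_) (fun c => hLV c.1 c.2)
    (fun j => ρ (ofLinear (y j))) (fun j => δ (v j) g / ρ g) (fun j => hρV _) (fun j => hδg _)
    P (fun j => ?_) (by rwa [hP]) (by rwa [hP])
  · obtain ⟨z, hz⟩ := (IsIntegrallyClosed.isIntegral_iff (R := V) (K := F)).1 hx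
    rw [← hz]
    exact z.2
  · rw [hP, hP', mul_div_cancel₀ _ hρg0]

end analyticAtZero

end AnalyticValuation

section Lojasiewicz

open Filter Topology

theorem ValuationSubring.exists_of_infinitesimal {F : Type*} [Field F] [LinearOrder F]
    [IsStrictOrderedRing F] {φ : F} (hφ : 0 ≤ φ) (h2 : ∀ k : ℕ, 2 ^ k * φ ≤ 1) :
    ∃ V : ValuationSubring F, ∀ z, z ∈ V ↔ ∀ k : ℕ, |z| ^ k * φ ≤ 1 := by
  let S : Set F := {z | ∀ k : ℕ, |z| ^ k * φ ≤ 1}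
  have hmono : ∀ {z w : F}, w ∈ S → |z| ≤ |w| → z ∈ S := fun hw hzw k =>
    (mul_le_mul_of_nonneg_right (pow_le_pow_left₀ (abs_nonneg _) hzw k) hφ).trans (hw k)
  have hmul : ∀ {z w : F}, z ∈ S → w ∈ S → z * w ∈ S := by
    have hsq : ∀ {z : F}, z ∈ S → z * z ∈ S := fun {z} hz k => by
      rw [abs_mul, ← sq, ← pow_mul]; exact hz _
    intro z w hz hw
    rcases le_total |z| |w| with h | h
    · exact hmono (hsq hw) (by rw [abs_mul, abs_mul]; gcongr)
    · exact hmono (hsq hz) (by rw [abs_mul, abs_mul]; gcongr)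
  have h2S : (2 : F) ∈ S := fun k => by rw [abs_two]; exact h2 k
  have h1S : (1 : F) ∈ S := hmono h2S (by rw [abs_one, abs_two]; exact one_le_two)
  refine ⟨{ carrier := S
            mul_mem' := hmul
            one_mem' := h1S
            zero_mem' := hmono h1S (by simp)
            add_mem' := fun {z w} hz hw => ?_
            neg_mem' := fun {z} hz => hmono hz (abs_neg z).le
            mem_or_inv_mem' := fun z => ?_ }, fun z => Iff.rfl⟩
  · rcases le_total |z| |w| with h | h
    · refine hmono (hmul h2S hw) ((abs_add_le z w).trans ?_)
      rw [abs_mul, abs_two]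
      linarith
    · refine hmono (hmul h2S hz) ((abs_add_le z w).trans ?_)
      rw [abs_mul, abs_two]
      linarith
  · rcases le_total |z| 1 with h | h
    · exact Or.inl (hmono h1S (by simpa using h))
    · exact Or.inr (hmono h1S (by rw [abs_inv, abs_one]; exact inv_le_one_of_one_le₀ h))

open Hyperreal in
/-- The Łojasiewicz gradient inequality. -/
theorem AnalyticAt.exists_lojasiewicz {E : Type*} [NormedAddCommGroup E] [NormedSpace ℝ E]
    [FiniteDimensional ℝ E] {f : E → ℝ} (hf : AnalyticAt ℝ f 0) (hf0 : f 0 = 0) :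
    ∃ q : ℕ, 1 ≤ q ∧ ∀ᶠ x in 𝓝 0, |f x| ^ q ≤ ‖fderiv ℝ f x‖ ^ (q + 1) := by
  by_contra! hcon
  have hlt : ∀ᶠ x in 𝓝 0, |f x| < 1 := by
    have h1 : ContinuousAt (fun x => |f x|) 0 := hf.continuousAt.abs
    exact h1.eventually_lt_const (by simp [hf0])
  have hex : ∀ n : ℕ, ∃ x : E, ‖x‖ < 1 / ((n : ℝ) + 1) ∧ |f x| < 1 ∧
      ‖fderiv ℝ f x‖ ^ (n + 2) < |f x| ^ (n + 1) := by
    intro n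
    have h1 : ∃ᶠ x in 𝓝 0, ‖fderiv ℝ f x‖ ^ (n + 2) < |f x| ^ (n + 1) := hcon (n + 1) (by omega)
    have h2 : ∀ᶠ x : E in 𝓝 0, ‖x‖ < 1 / ((n : ℝ) + 1) := by
      filter_upwards [Metric.ball_mem_nhds (0 : E) (Nat.one_div_pos_of_nat (n := n))] with x hx
      simpa using hx
    obtain ⟨x, hx⟩ := (h1.and_eventually (h2.and hlt)).exists
    exact ⟨x, hx.2.1, hx.2.2, hx.1⟩
  choose x hxn hx1 hxf using hex
  have hx : Tendsto x (hyperfilter ℕ) (𝓝 0) :=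
    (squeeze_zero_norm (fun n => (hxn n).le) tendsto_one_div_add_atTop_nhds_zero_nat).mono_left
      Nat.hyperfilter_le_atTop
  have hfx : ∀ n, 0 < |f (x n)| := fun n =>
    (abs_nonneg _).lt_of_ne fun h => by
      have := hxf n
      rw [← h, zero_pow (by omega)] at this
      exact absurd this (not_lt.2 (by positivity))
  have hfx0 : Tendsto (fun n => |f (x n)|) (hyperfilter ℕ) (𝓝 0) := by
    have h1 : ContinuousAt (fun x => |f x|) 0 := hf.continuousAt.abs
    have h2 := h1.tendsto.comp hx
    rw [hf0, abs_zero] at h2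
    exact h2
  have heq : ∀ a b : ℕ → ℝ, ofSeq a = ofSeq b ↔ ∀ᶠ n in hyperfilter ℕ, a n = b n := fun a b =>
    Germ.coe_eq
  have hconst : ∀ c : ℝ, Tendsto (fun n => c * |f (x n)|) (hyperfilter ℕ) (𝓝 0) := fun c => by
    simpa using hfx0.const_mul c
  have hconst1 : ∀ c : ℝ, ∀ᶠ n in hyperfilter ℕ, c * |f (x n)| ≤ 1 := fun c =>
    (hconst c).eventually_le_const one_pos
  obtain ⟨V, hV⟩ := ValuationSubring.exists_of_infinitesimal (φ := ofSeq fun n => |f (x n)|)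
    (ofSeq_le_ofSeq.2 (Eventually.of_forall fun n => abs_nonneg (f (x n))))
    (fun k => ofSeq_le_ofSeq.2 (hconst1 (2 ^ k)))
  have hmem : ∀ a : ℕ → ℝ, ofSeq a ∈ V ↔
      ∀ k : ℕ, ∀ᶠ n in hyperfilter ℕ, |a n| ^ k * |f (x n)| ≤ 1 := fun a =>
    (hV _).trans (forall_congr' fun k => ofSeq_le_ofSeq (f := fun n => |a n| ^ k * |f (x n)|) (g := 1))
  have hmono : ∀ a b : ℕ → ℝ, ofSeq b ∈ V → (∀ᶠ n in hyperfilter ℕ, |a n| ≤ |b n|) →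
      ofSeq a ∈ V := by
    intro a b hb hab
    rw [hmem] at hb ⊢
    intro k
    filter_upwards [hb k, hab] with n h1 h2
    exact le_trans (by gcongr) h1
  have hconstV : ∀ c : ℝ, (ofSeq fun _ => c) ∈ V := fun c => (hmem _).2 fun k => hconst1 (|c| ^ k)
  have hbdd : ∀ g : E → ℝ, ContinuousAt g 0 → (ofSeq fun n => g (x n)) ∈ V := by
    intro g hg
    refine hmono _ _ (hconstV (|g 0| + 1)) ?_
    have h1 : ContinuousAt (fun x => |g x|) 0 := hg.abs
    filter_upwards [(h1.tendsto.comp hx).eventually_le_const (lt_add_one |g 0|)] with n hn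
    exact hn.trans (le_abs_self _)
  have hdiff : ∀ g : analyticAtZero E, ∀ᶠ n in hyperfilter ℕ, DifferentiableAt ℝ g.1 (x n) :=
    fun g => hx.eventually (g.2.eventually_analyticAt.mono fun y hy => hy.differentiableAt)
  let ρ : analyticAtZero E →+* ℝ* :=
    { toFun := fun g => ofSeq fun n => g.1 (x n)
      map_one' := rfl
      map_mul' := fun _ _ => rfl
      map_zero' := rfl
      map_add' := fun _ _ => rfl }
  refine analyticAtZero.false_of_valuation V ρ (fun v g => ofSeq fun n => fderiv ℝ g.1 (x n) v)
    (fun g => hbdd _ g.2.continuousAt) (fun v g => hbdd (fun y => fderiv ℝ g.1 y v) ?_)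
    (fun g h hgh => (heq _ _).2 (hx.eventually hgh)) (fun v g h hgh => (heq _ _).2 ?_)
    (fun v g h => (heq _ (fun n => fderiv ℝ g.1 (x n) v + fderiv ℝ h.1 (x n) v)).2 ?_)
    (fun v g h => (heq _ (fun n => g.1 (x n) * fderiv ℝ h.1 (x n) v +
      h.1 (x n) * fderiv ℝ g.1 (x n) v)).2 ?_) (fun v r hr => (heq _ 0).2 ?_)
    (fun v y hy => (heq _ 1).2 ?_) ⟨f, hf⟩ ?_ ?_ ?_
  · exact g.2.fderiv.continuousAt.clm_apply continuousAt_const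
  · have h1 : g.1 =ᶠ[𝓝 0] h.1 := hgh
    filter_upwards [hx.eventually (h1.fderiv (𝕜 := ℝ))] with n hn
    rw [hn]
  · filter_upwards [hdiff g, hdiff h] with n h1 h2
    exact DFunLike.congr_fun (fderiv_add h1 h2) v
  · filter_upwards [hdiff g, hdiff h] with n h1 h2
    exact DFunLike.congr_fun (fderiv_mul h1 h2) v
  · filter_upwards [hdiff r] with n h1
    rw [← h1.lineDeriv_eq_fderiv]
    simp [lineDeriv, hr]
  · refine Eventually.of_forall fun n => ?_
    change fderiv ℝ (fun z => y z) (x n) v = 1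
    rw [y.fderiv, hy]
  · intro h
    have h1 : (ofSeq fun n => (f (x n))⁻¹) ∈ V := h
    obtain ⟨n, hn⟩ := ((hmem _).1 h1 2).exists
    have h2 := hfx n
    rw [abs_inv, sq, mul_assoc, inv_mul_cancel₀ h2.ne', mul_one] at hn
    exact absurd ((one_lt_inv₀ h2).2 (hx1 n)) (not_lt.2 hn)
  · intro v
    have h1 : (ofSeq fun n => ‖fderiv ℝ f (x n)‖ / |f (x n)|) ∈ V := by
      rw [hmem]
      intro k
      filter_upwards [(eventually_ge_atTop k).filter_mono Nat.hyperfilter_le_atTop] with n hn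
      have h2 := hfx n
      rw [abs_div, abs_norm, abs_abs]
      rcases le_total (‖fderiv ℝ f (x n)‖ / |f (x n)|) 1 with h3 | h3
      · exact mul_le_one₀ (pow_le_one₀ (by positivity) h3) h2.le (hx1 n).le
      · calc (‖fderiv ℝ f (x n)‖ / |f (x n)|) ^ k * |f (x n)|
            ≤ (‖fderiv ℝ f (x n)‖ / |f (x n)|) ^ (n + 2) * |f (x n)| := by
              gcongr
              omega
          _ = ‖fderiv ℝ f (x n)‖ ^ (n + 2) / |f (x n)| ^ (n + 1) := by
              rw [div_pow, pow_succ |f (x n)| (n + 1)]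
              field_simp
          _ ≤ 1 := by
              rw [div_le_one (by positivity)]
              exact (hxf n).le
    have h2 : (ofSeq fun n => ‖v‖ * (‖fderiv ℝ f (x n)‖ / |f (x n)|)) ∈ V :=
      V.mul_mem _ _ (hconstV ‖v‖) h1
    change (ofSeq fun n => fderiv ℝ f (x n) v / f (x n)) ∈ V
    refine hmono _ _ h2 (Eventually.of_forall fun n => ?_)
    rw [abs_div, abs_mul, abs_norm, abs_div, abs_norm, abs_abs, ← mul_div_assoc, mul_comm ‖v‖]
    gcongr
    exact (fderiv ℝ f (x n)).le_opNorm v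
  · intro z hz
    rw [hV]
    intro k
    have h1 := (hV _).1 (hz (2 * k)) 1
    change |ρ ⟨f, hf⟩ / z ^ (2 * k)| ^ 1 * |ρ ⟨f, hf⟩| ≤ 1 at h1
    change |z⁻¹| ^ k * |ρ ⟨f, hf⟩| ≤ 1
    rw [← sq_le_one_iff₀ (by positivity)]
    refine le_trans (le_of_eq ?_) h1
    rw [abs_div, abs_pow, abs_inv, mul_pow, ← pow_mul, inv_pow, mul_comm k 2]
    ring

end Lojasiewicz

open Set in
theorem hasSum_primitive_of_hasDerivAt {F : Type*} [NormedAddCommGroup F] [NormedSpace ℝ F]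
    [CompleteSpace F] {φ φ' : ℝ → F} {a : ℕ → F} (ha : Summable fun n => ‖a n‖)
    (hderiv : ∀ t ∈ Icc (0 : ℝ) 1, HasDerivAt φ (φ' t) t)
    (hcont : ContinuousOn φ' (Icc 0 1))
    (hsum : ∀ t ∈ Icc (0 : ℝ) 1, HasSum (fun n => t ^ n • a n) (φ' t)) :
    HasSum (fun n : ℕ => ((n : ℝ) + 1)⁻¹ • a n) (φ 1 - φ 0) := by
  have h_int := intervalIntegral.hasSum_integral_of_dominated_convergence
    (μ := MeasureTheory.volume) (a := 0) (b := 1) (F := fun n (t : ℝ) => t ^ n • a n)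
    (f := φ') (fun n _ => ‖a n‖)
    (fun n => (by fun_prop : Continuous fun t : ℝ => t ^ n • a n).aestronglyMeasurable)
    (fun n => .of_forall fun t ht => by
      rw [uIoc_of_le zero_le_one] at ht
      rw [norm_smul, norm_pow, Real.norm_eq_abs, abs_of_pos ht.1]
      exact mul_le_of_le_one_left (norm_nonneg _) (pow_le_one₀ ht.1.le ht.2))
    (.of_forall fun _ _ => ha) (by simp)
    (.of_forall fun t ht => by
      rw [uIoc_of_le zero_le_one] at ht
      exact hsum t (Ioc_subset_Icc_self ht))
  rw [intervalIntegral.integral_eq_sub_of_hasDerivAt (f := φ)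
    (fun t ht => hderiv t (by rwa [uIcc_of_le zero_le_one] at ht))
    (ContinuousOn.intervalIntegrable (by rwa [uIcc_of_le zero_le_one]))] at h_int
  simpa [intervalIntegral.integral_smul_const, integral_pow] using h_int

open Set Filter Topology in
theorem AnalyticAt.of_eventually_hasFDerivAt {V F : Type*} [NormedAddCommGroup V] [NormedSpace ℝ V]
    [NormedAddCommGroup F] [NormedSpace ℝ F] [CompleteSpace F]
    {E : V → F} {E' : V → V →L[ℝ] F} {x : V}
    (hE : ∀ᶠ y in 𝓝 x, HasFDerivAt E (E' y) y) (hE' : AnalyticAt ℝ E' x) :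
    AnalyticAt ℝ E x := by
  obtain ⟨p, r₀, hp₀⟩ := hE'
  obtain ⟨ε, ε0, hε⟩ := EMetric.mem_nhds_iff.1 hE
  have hr : 0 < min r₀ ε := lt_min hp₀.r_pos ε0
  set r := min r₀ ε
  have hp : HasFPowerSeriesOnBall E' p x r := hp₀.mono hr (min_le_left _ _)
  let s : FormalMultilinearSeries ℝ V (V →L[ℝ] F) := fun n => ((n : ℝ) + 1)⁻¹ • p n
  have hs : p.radius ≤ s.radius := by
    refine FormalMultilinearSeries.radius_le_of_le fun n => ?_
    have h1 : ((n : ℝ) + 1)⁻¹ ≤ 1 := inv_le_one_of_one_le₀ (by linarith [n.cast_nonneg (α := ℝ)])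
    have h2 : 0 ≤ ((n : ℝ) + 1)⁻¹ := by positivity
    simp only [s, norm_smul, Real.norm_eq_abs, abs_of_nonneg h2]
    exact mul_le_of_le_one_left (norm_nonneg _) h1
  refine ⟨s.unshift (E x), r, ?_, hr, fun {y} hy => ?_⟩
  · rw [FormalMultilinearSeries.radius_unshift]
    exact hp.r_le.trans hs
  have hball : ∀ t ∈ Icc (0 : ℝ) 1, t • y ∈ Metric.eball (0 : V) r := by
    intro t ht
    simp only [Metric.mem_eball, edist_zero_right, enorm_smul] at hy ⊢
    refine lt_of_le_of_lt (mul_le_of_le_one_left (zero_le) ?_) hy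
    rw [Real.enorm_eq_ofReal ht.1]
    exact ENNReal.ofReal_le_one.2 ht.2
  let a : ℕ → F := fun n => p n (fun _ => y) y
  have hsum : ∀ t ∈ Icc (0 : ℝ) 1, HasSum (fun n => t ^ n • a n) (E' (x + t • y) y) := by
    intro t ht
    have := (ContinuousLinearMap.apply ℝ F y).hasSum (hp.hasSum (hball t ht))
    simpa [a, Function.comp_def, (p _).map_smul_univ] using this
  have ha : Summable fun n => ‖a n‖ := by
    have := p.summable_norm_apply (x := y) (by
      exact Metric.eball_subset_eball hp.r_le hy)
    refine Summable.of_nonneg_of_le (fun _ => norm_nonneg _) (fun n => ?_) (this.mul_right ‖y‖)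
    exact (p n fun _ => y).le_opNorm y
  have hderiv : ∀ t ∈ Icc (0 : ℝ) 1,
      HasDerivAt (fun t : ℝ => E (x + t • y)) (E' (x + t • y) y) t := by
    intro t ht
    have h1 : x + t • y ∈ Metric.eball x ε := by
      have := hball t ht
      rw [Metric.mem_eball, edist_zero_right] at this
      simpa [Metric.mem_eball, edist_eq_enorm_sub] using this.trans_le (min_le_right _ _)
    have h2 : HasDerivAt (fun t : ℝ => x + t • y) y t := by
      simpa using ((hasDerivAt_id t).smul_const y).const_add x
    have h3 : HasFDerivAt E (E' (x + t • y)) (x + t • y) := hε h1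
    exact h3.comp_hasDerivAt t h2
  have hcont : ContinuousOn (fun t : ℝ => E' (x + t • y) y) (Icc 0 1) := by
    have := hp.continuousOn
    refine ContinuousOn.clm_apply (this.comp (by fun_prop) fun t ht => ?_) continuousOn_const
    have := hball t ht
    simpa [Metric.mem_eball, edist_eq_enorm_sub] using this
  have h_int := hasSum_primitive_of_hasDerivAt ha hderiv hcont hsum
  simp only [one_smul, zero_smul, add_zero] at h_int
  have hzero : (s.unshift (E x) 0) (fun _ => y) = E x := rfl
  have hshift (n : ℕ) : (s.unshift (E x) (n + 1)) (fun _ => y) = ((n : ℝ) + 1)⁻¹ • a n := rfl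
  have := HasSum.zero_add (f := fun n => (s.unshift (E x) n) fun _ => y)
    (by simpa only [hshift] using h_int)
  rwa [hzero, add_sub_cancel] at this

open Filter Topology in
theorem AnalyticAt.exists_localInverse {V W : Type*} [NormedAddCommGroup V] [NormedSpace ℝ V]
    [CompleteSpace V] [NormedAddCommGroup W] [NormedSpace ℝ W] {f : V → W} {e : V ≃L[ℝ] W}
    {x : V} (hf : AnalyticAt ℝ f x) (hf' : HasFDerivAt f (e : V →L[ℝ] W) x) :
    ∃ g : W → V, AnalyticAt ℝ g (f x) ∧ g (f x) = x ∧ (∀ᶠ y in 𝓝 x, g (f y) = y) ∧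
      ∀ᶠ z in 𝓝 (f x), f (g z) = z := by
  have hs : HasStrictFDerivAt f (e : V →L[ℝ] W) x := hf'.fderiv ▸ hf.hasStrictFDerivAt
  exact ⟨hs.localInverse f e x, (hs.toOpenPartialHomeomorph f).analyticAt_symm'
    hs.mem_toOpenPartialHomeomorph_source hf hf'.fderiv, hs.localInverse_apply_image,
    hs.eventually_left_inverse, hs.eventually_right_inverse⟩

/-- A Fredholm operator of index zero that is symmetric for a definite embedding becomes
invertible after adding a projection onto its kernel. -/
theorem ContinuousLinearMap.exists_equiv_add_ker_projection {V W : Type*}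
    [NormedAddCommGroup V] [NormedSpace ℝ V] [CompleteSpace V]
    [NormedAddCommGroup W] [NormedSpace ℝ W] [CompleteSpace W]
    (T' : V →L[ℝ] W) (T : W →L[ℝ] (V →L[ℝ] ℝ)) (hdef : ∀ x : V, x ≠ 0 → 0 < T (T' x) x)
    (L : V →L[ℝ] W) [FiniteDimensional ℝ (LinearMap.ker (L : V →ₗ[ℝ] W))]
    [FiniteDimensional ℝ (W ⧸ LinearMap.range (L : V →ₗ[ℝ] W))]
    (hindex : Module.finrank ℝ (LinearMap.ker (L : V →ₗ[ℝ] W)) =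
      Module.finrank ℝ (W ⧸ LinearMap.range (L : V →ₗ[ℝ] W)))
    (hsymm : ∀ v w, T (L v) w = T (L w) v) :
    ∃ (P : V →L[ℝ] LinearMap.ker (L : V →ₗ[ℝ] W)) (e : V ≃L[ℝ] W),
      ∀ v, e v = L v + T' (P v) := by
  set K := LinearMap.ker (L : V →ₗ[ℝ] W)
  obtain ⟨P, hP⟩ := Submodule.ClosedComplemented.of_finiteDimensional K
  have hK (k : K) : L k = 0 := k.2
  have hdisj (v : V) (k : K) (h : L v = T' k) : k = 0 := by
    by_contra hk
    have := hdef k (by simpa using hk)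
    rw [← h, hsymm, hK] at this
    simp at this
  let B : V →L[ℝ] W := L + T' ∘L K.subtypeL ∘L P
  have hB (v : V) : B v = L v + T' (P v) := rfl
  have hinj : LinearMap.ker (B : V →ₗ[ℝ] W) = ⊥ := by
    refine LinearMap.ker_eq_bot'.2 fun v hv => ?_
    have hv : L v + T' (P v) = 0 := hv
    have hPv : P v = 0 := by
      simpa using hdisj v (-(P v)) (by simpa using eq_neg_of_add_eq_zero_left hv)
    have hLv : L v = 0 := by simpa [hPv] using hv
    have := hP ⟨v, hLv⟩
    rw [hPv] at this
    exact (congrArg Subtype.val this).symm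
  have hsurj : LinearMap.range (B : V →ₗ[ℝ] W) = ⊤ := by
    let g : K →ₗ[ℝ] W ⧸ LinearMap.range (L : V →ₗ[ℝ] W) :=
      (LinearMap.range (L : V →ₗ[ℝ] W)).mkQ ∘ₗ (T' : V →ₗ[ℝ] W) ∘ₗ K.subtype
    have hg : Function.Injective g := by
      refine (injective_iff_map_eq_zero g).2 fun k hk => ?_
      obtain ⟨v, hv⟩ := (Submodule.Quotient.mk_eq_zero _).1 hk
      exact hdisj v k hv
    have hg' := (LinearMap.injective_iff_surjective_of_finrank_eq_finrank hindex).1 hg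
    refine LinearMap.range_eq_top.2 fun w => ?_
    obtain ⟨k, hk⟩ := hg' (Submodule.Quotient.mk w)
    obtain ⟨v, hv⟩ := (Submodule.Quotient.eq _).1 hk
    have hv : L v = T' k - w := hv
    refine ⟨-v + P v + k, ?_⟩
    change B _ = w
    rw [hB]
    simp [hP, hK, hv]
  exact ⟨P, .ofBijective B hinj hsurj, hB⟩

theorem Real.rpow_one_sub_le_mul_of_pow_le {a b s m c d : ℝ} {q : ℕ} (hq : 1 ≤ q)
    (ha : 0 ≤ a) (hb : 0 ≤ b) (hs : 0 ≤ s) (hm : 0 ≤ m) (hm1 : m ≤ 1) (hc : 0 ≤ c) (hd : 1 ≤ d)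
    (hsab : s ≤ a + b) (haq : a ^ q ≤ (c * m) ^ (q + 1)) (hbm : b ≤ d * m ^ 2) :
    s ^ ((1 : ℝ) - 1 / (q + 1)) ≤ (c + d) * m := by
  have hq' : (1 : ℝ) ≤ q := by exact_mod_cast hq
  set t : ℝ := (1 : ℝ) - 1 / (q + 1) with ht
  have ht1 : t ≤ 1 := by
    have : (0 : ℝ) ≤ 1 / (q + 1) := by positivity
    linarith
  have ht2 : 1 / 2 ≤ t := by
    have : (1 : ℝ) / (q + 1) ≤ 1 / 2 := by gcongr; linarith
    linarith
  have htq : t = q * (((q + 1 : ℕ) : ℝ))⁻¹ := by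
    rw [ht]; push_cast; field_simp; ring
  have h1 : a ^ t ≤ c * m := by
    rw [htq, Real.rpow_mul ha, Real.rpow_natCast]
    calc (a ^ q) ^ (((q + 1 : ℕ) : ℝ))⁻¹ ≤ ((c * m) ^ (q + 1)) ^ (((q + 1 : ℕ) : ℝ))⁻¹ := by gcongr
      _ = c * m := Real.pow_rpow_inv_natCast (by positivity) (by positivity)
  have h2 : b ^ t ≤ d * m := by
    calc b ^ t ≤ (d * m ^ 2) ^ t := by gcongr
      _ = d ^ t * (m ^ 2) ^ t := Real.mul_rpow (by positivity) (by positivity)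
      _ ≤ d * m := by
        gcongr
        · simpa using Real.rpow_le_rpow_of_exponent_le hd ht1
        · rw [← Real.rpow_natCast, ← Real.rpow_mul hm]
          simpa using Real.rpow_le_rpow_of_exponent_ge' hm hm1 zero_le_one
            (show (1 : ℝ) ≤ (2 : ℕ) * t by push_cast; linarith)
  calc s ^ t ≤ (a + b) ^ t := by gcongr
    _ ≤ a ^ t + b ^ t := Real.rpow_add_le_add_rpow ha hb (by linarith) ht1
    _ ≤ (c + d) * m := by linarith

open Filter Topology in
/-- Lyapunov–Schmidt reduction of the Łojasiewicz gradient inequality to finite dimension. -/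
theorem lojasiewicz_of_lyapunovSchmidt {V W K : Type*} [NormedAddCommGroup V] [NormedSpace ℝ V]
    [CompleteSpace V] [NormedAddCommGroup W] [NormedSpace ℝ W] [CompleteSpace W]
    [NormedAddCommGroup K] [NormedSpace ℝ K] [FiniteDimensional ℝ K]
    {E : V → ℝ} {M : V → W} {x₀ : V} (T : W →L[ℝ] (V →L[ℝ] ℝ)) (A : K →L[ℝ] W) (P : V →L[ℝ] K)
    {e : V ≃L[ℝ] W} {L : V →L[ℝ] W} (he : ∀ v, e v = L v + A (P v))
    (hE : ∀ᶠ x in 𝓝 x₀, HasFDerivAt E (T (M x)) x) (hM : AnalyticAt ℝ M x₀) (hM0 : M x₀ = 0)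
    (hM' : HasFDerivAt M L x₀) :
    ∃ (C : ℝ) (q : ℕ), 0 < C ∧ 1 ≤ q ∧
      ∀ᶠ x in 𝓝 x₀, |E x - E x₀| ^ ((1 : ℝ) - 1 / (q + 1)) ≤ C * ‖M x‖ := by
  let Φ : V → W := fun x => M x + A (P (x - x₀))
  have hΦ0 : Φ x₀ = 0 := by simp [Φ, hM0]
  have hsub : HasFDerivAt (fun x => P (x - x₀)) P x₀ :=
    P.hasFDerivAt.comp x₀ ((hasFDerivAt_id x₀).sub_const x₀)
  have hsuba : AnalyticAt ℝ (fun x => P (x - x₀)) x₀ :=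
    (P.analyticAt _).comp (analyticAt_id.sub analyticAt_const)
  have hΦ : AnalyticAt ℝ Φ x₀ := hM.add ((A.analyticAt _).comp hsuba)
  have hΦ' : HasFDerivAt Φ (e : V →L[ℝ] W) x₀ := by
    have h1 := hM'.add (A.hasFDerivAt.comp x₀ hsub)
    have h2 : (e : V →L[ℝ] W) = L + A ∘L P := ContinuousLinearMap.ext he
    rw [h2]
    exact h1
  obtain ⟨Ψ, hΨ, hΨ0, hleft, hright⟩ := hΦ.exists_localInverse hΦ'
  rw [hΦ0] at hΨ hΨ0 hright
  have hEa : AnalyticAt ℝ E x₀ :=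
    .of_eventually_hasFDerivAt hE ((T.analyticAt _).comp hM)
  let y : K → V := fun k => Ψ (A k)
  have hy0 : y 0 = x₀ := by simp [y, hΨ0]
  have hya : AnalyticAt ℝ y 0 := by
    have : AnalyticAt ℝ Ψ (A 0) := by simpa using hΨ
    exact this.comp (A.analyticAt 0)
  have hytend : Tendsto y (𝓝 0) (𝓝 x₀) := by simpa [hy0] using hya.continuousAt.tendsto
  obtain ⟨q, hq, hloj⟩ := AnalyticAt.exists_lojasiewicz (f := fun k => E (y k) - E x₀)
    ((AnalyticAt.comp (by rwa [hy0]) hya).sub analyticAt_const) (by simp [hy0])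
  obtain ⟨c₁, s₁, hs₁, hlip₁⟩ := (hΨ.contDiffAt (n := 1)).exists_lipschitzOnWith
  obtain ⟨c₂, s₂, hs₂, hlip₂⟩ := (hM.contDiffAt (n := 1)).exists_lipschitzOnWith
  obtain ⟨c₃, s₃, hs₃, hlip₃⟩ := (hya.contDiffAt (n := 1)).exists_lipschitzOnWith
  obtain ⟨r, r0, hr⟩ := Metric.eventually_nhds_iff_ball.1 (hE.and hs₂)
  have hgrad : ∀ᶠ k in 𝓝 (0 : K),
      |E (y k) - E x₀| ^ q ≤ (‖T‖ * ‖M (y k)‖ * c₃) ^ (q + 1) := by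
    filter_upwards [hloj, hya.eventually_analyticAt, hytend.eventually hE,
      eventually_eventually_nhds.2 hs₃] with k hk hyk hEk hsk
    refine hk.trans (pow_le_pow_left₀ (norm_nonneg _) ?_ _)
    have h1 : HasFDerivAt (fun k => E (y k) - E x₀) (T (M (y k)) ∘L fderiv ℝ y k) k :=
      (hEk.comp k hyk.differentiableAt.hasFDerivAt).sub_const _
    rw [h1.fderiv]
    refine (ContinuousLinearMap.opNorm_comp_le _ _).trans ?_
    gcongr
    · exact T.le_opNorm _
    · exact norm_fderiv_le_of_lipschitzOn ℝ hsk hlip₃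
  have hPtend : Tendsto (fun x => P (x - x₀)) (𝓝 x₀) (𝓝 0) := by
    simpa using hsuba.continuousAt.tendsto
  have hAtend : Tendsto (fun x => A (P (x - x₀))) (𝓝 x₀) (𝓝 0) := by
    simpa [Function.comp_def] using (A.continuous.tendsto 0).comp hPtend
  have hΦtend : Tendsto Φ (𝓝 x₀) (𝓝 0) := by simpa [hΦ0] using hΦ.continuousAt.tendsto
  have hMtend : Tendsto M (𝓝 x₀) (𝓝 0) := by simpa [hM0] using hM.continuousAt.tendsto
  have hball : Metric.ball x₀ r ∈ 𝓝 x₀ := Metric.ball_mem_nhds _ r0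
  set d : ℝ := ‖T‖ * (1 + c₂ * c₁) * c₁ + 1 with hd
  have hd1 : 1 ≤ d := by
    have : 0 ≤ ‖T‖ * (1 + c₂ * c₁) * c₁ := by positivity
    linarith
  refine ⟨‖T‖ * (‖A‖ * ‖P‖ * c₁) * c₃ + d, q, by positivity, hq, ?_⟩
  filter_upwards [hleft, hPtend.eventually hgrad, hΦtend.eventually hs₁, hAtend.eventually hs₁,
    hAtend.eventually hright, hball, (hytend.comp hPtend).eventually hball,
    hMtend.eventually (Metric.ball_mem_nhds _ one_pos)]
    with x hx hxgrad hxs hxs' hxr hxb hyb hxm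
  set k : K := P (x - x₀) with hk
  have hxy : ‖x - y k‖ ≤ c₁ * ‖M x‖ := by
    have := hlip₁.norm_sub_le hxs hxs'
    have h1 : Φ x - A k = M x := add_sub_cancel_right _ _
    rwa [hx, h1] at this
  have hMy : ‖M (y k)‖ ≤ ‖A‖ * ‖P‖ * c₁ * ‖M x‖ := by
    have h1 : M (y k) = A (P (x - y k)) := by
      have : M (y k) + A (P (y k - x₀)) = A k := hxr
      rw [eq_sub_of_add_eq this, hk, ← map_sub, ← map_sub, sub_sub_sub_cancel_right]
    calc ‖M (y k)‖ ≤ ‖A‖ * (‖P‖ * ‖x - y k‖) := by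
          rw [h1]
          exact A.le_opNorm_of_le (P.le_opNorm _)
      _ ≤ ‖A‖ * (‖P‖ * (c₁ * ‖M x‖)) := by gcongr
      _ = _ := by ring
  have hExy : |E x - E (y k)| ≤ d * ‖M x‖ ^ 2 := by
    have hseg : segment ℝ x (y k) ⊆ Metric.ball x₀ r := (convex_ball _ _).segment_subset hxb hyb
    have h1 : ‖E x - E (y k)‖ ≤ ‖T‖ * ((1 + c₂ * c₁) * ‖M x‖) * ‖x - y k‖ := by
      refine (convex_segment x (y k)).norm_image_sub_le_of_norm_hasFDerivWithin_le
        (fun z hz => ((hr z (hseg hz)).1).hasFDerivWithinAt) (fun z hz => ?_)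
        (right_mem_segment ℝ _ _) (left_mem_segment ℝ _ _)
      refine T.le_opNorm_of_le ?_
      have h2 := hlip₂.norm_sub_le (hr z (hseg hz)).2 (hr x hxb).2
      have h3 : ‖z - x‖ ≤ ‖x - y k‖ := by
        rw [norm_sub_rev x]
        exact norm_sub_le_of_mem_segment hz
      calc ‖M z‖ ≤ ‖M x‖ + ‖M z - M x‖ := norm_le_norm_add_norm_sub' _ _
        _ ≤ ‖M x‖ + c₂ * (c₁ * ‖M x‖) := by
          gcongr
          exact h2.trans (by gcongr; exact h3.trans hxy)
        _ = _ := by ring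
    calc |E x - E (y k)| ≤ ‖T‖ * ((1 + c₂ * c₁) * ‖M x‖) * (c₁ * ‖M x‖) :=
          h1.trans (by gcongr)
      _ = (d - 1) * ‖M x‖ ^ 2 := by rw [hd]; ring
      _ ≤ d * ‖M x‖ ^ 2 := by gcongr; linarith
  refine Real.rpow_one_sub_le_mul_of_pow_le hq (abs_nonneg (E (y k) - E x₀)) (abs_nonneg _)
    (abs_nonneg _) (norm_nonneg _) (by simpa using (mem_ball_zero_iff.1 hxm).le) (by positivity) hd1
    ?_ (hxgrad.trans (pow_le_pow_left₀ (by positivity) ?_ _)) hExy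
  · rw [add_comm]
    exact abs_sub_le _ _ _
  · calc ‖T‖ * ‖M (y k)‖ * c₃ ≤ ‖T‖ * (‖A‖ * ‖P‖ * c₁ * ‖M x‖) * c₃ := by gcongr
      _ = _ := by ring

/-- **Łojasiewicz–Simon gradient inequality of Feehan–Maridakis** (Proposition 3.1).
Let `V, W` be real Banach spaces, `T' : V → W` and `T : W → V*` injective continuous
linear maps such that `j = T ∘ T'` is a definite embedding.  Let `U ⊆ V` be open,
`E : U → ℝ` a `C²` function with first derivative `E'(x) ∈ V*` and second derivative
`E''(x∞)` at a critical point `x∞ ∈ U`.  Assume there is a real-analytic map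
`M : U → W` with `T(M x) = E'(x)` for `x ∈ U`, and a Fredholm operator `L : V → W`
of index zero with `T (L v) = E''(x∞)(v, ·)` for all `v ∈ V`.  Then there exist
`C ∈ (0,∞)`, `σ ∈ (0,1]` and `θ ∈ (0, 1/2]` such that for all `x ∈ U` with
`‖x − x∞‖ ≤ σ` one has `|E x − E x∞| ^ (1−θ) ≤ C ‖M x‖`. -/
theorem lojasiewicz_simon_feehan_maridakis
    {V W : Type*}
    [NormedAddCommGroup V] [NormedSpace ℝ V] [CompleteSpace V]
    [NormedAddCommGroup W] [NormedSpace ℝ W] [CompleteSpace W]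
    (T' : V →L[ℝ] W) (T : W →L[ℝ] (V →L[ℝ] ℝ))
    (hT'inj : Function.Injective T') (hTinj : Function.Injective T)
    -- `j := T ∘ T'` is a definite embedding
    (hdef : ∀ x : V, x ≠ 0 → 0 < T (T' x) x)
    (U : Set V) (hU : IsOpen U)
    (E : V → ℝ) (E' : V → (V →L[ℝ] ℝ)) (E'' : V →L[ℝ] (V →L[ℝ] ℝ))
    (xinf : V) (hxinf : xinf ∈ U)
    -- `E` is twice continuously Fréchet differentiable on `U`
    (hE' : ∀ x ∈ U, HasFDerivAt E (E' x) x)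
    (hE'cont : ContinuousOn E' U)
    (hE'' : HasFDerivAt E' E'' xinf)
    -- `x∞` is a critical point of `E`
    (hcrit : E' xinf = 0)
    -- real-analytic gradient map `M` representing `E'` through `T`
    (M : V → W) (hMa : AnalyticOnNhd ℝ M U)
    (hM : ∀ x ∈ U, T (M x) = E' x)
    -- `L` is a Fredholm operator of index zero representing `E''(x∞)` through `T`
    (L : V →L[ℝ] W)
    (hkerfin : FiniteDimensional ℝ (LinearMap.ker (L : V →ₗ[ℝ] W)))
    (hranclosed : IsClosed ((LinearMap.range (L : V →ₗ[ℝ] W) : Submodule ℝ W) : Set W))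
    (hcokerfin : FiniteDimensional ℝ (W ⧸ LinearMap.range (L : V →ₗ[ℝ] W)))
    (hindexzero :
      Module.finrank ℝ (LinearMap.ker (L : V →ₗ[ℝ] W)) =
        Module.finrank ℝ (W ⧸ LinearMap.range (L : V →ₗ[ℝ] W)))
    (hL : ∀ v : V, T (L v) = E'' v) :
    ∃ C σ θ : ℝ, 0 < C ∧ σ ∈ Set.Ioc (0 : ℝ) 1 ∧ θ ∈ Set.Ioc (0 : ℝ) (1 / 2) ∧
      ∀ x ∈ U, ‖x - xinf‖ ≤ σ →
        |E x - E xinf| ^ ((1 : ℝ) - θ) ≤ C * ‖M x‖ := by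
  have hnhds : ∀ᶠ x in nhds xinf, x ∈ U := hU.mem_nhds hxinf
  have hEd : ∀ᶠ x in nhds xinf, HasFDerivAt E (E' x) x := hnhds.mono hE'
  have hEd' : ∀ᶠ x in nhds xinf, HasFDerivAt E (T (M x)) x :=
    hnhds.mono fun x hx => by simpa [hM x hx] using hE' x hx
  have hsymm (v w : V) : T (L v) w = T (L w) v := by
    rw [hL, hL]
    exact second_derivative_symmetric_of_eventually_of_real hEd hE'' v w
  obtain ⟨P, e, he⟩ :=
    ContinuousLinearMap.exists_equiv_add_ker_projection T' T hdef L hindexzero hsymm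
  have hMan : AnalyticAt ℝ M xinf := hMa xinf hxinf
  have hM0 : M xinf = 0 := hTinj (by rw [hM xinf hxinf, hcrit, map_zero])
  have hM' : HasFDerivAt M L xinf := by
    have h1 := hMan.differentiableAt.hasFDerivAt
    have h2 : HasFDerivAt E' (T ∘L fderiv ℝ M xinf) xinf :=
      (T.hasFDerivAt.comp xinf h1).congr_of_eventuallyEq
        (hnhds.mono fun x hx => (hM x hx).symm)
    have h3 : fderiv ℝ M xinf = L := by
      ext1 v
      refine hTinj ?_
      rw [hL, hE''.unique h2]
      rfl
    rwa [h3] at h1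
  obtain ⟨C, q, hC, hq, h⟩ := lojasiewicz_of_lyapunovSchmidt T
    (T' ∘L (LinearMap.ker (L : V →ₗ[ℝ] W)).subtypeL) P he hEd' hMan hM0 hM'
  obtain ⟨r, hr, hball⟩ := Metric.eventually_nhds_iff.1 h
  refine ⟨C, min 1 (r / 2), 1 / (q + 1), hC, ⟨by positivity, min_le_left _ _⟩,
    ⟨by positivity, ?_⟩, fun x _ hx => hball ?_⟩
  · have : (1 : ℝ) ≤ q := by exact_mod_cast hq
    gcongr
    linarith
  · rw [dist_eq_norm]
    linarith [hx.trans (min_le_right _ _)]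
end

section
/- (Banach algebra property of Sobolev spaces, Lemma 2.8, Euclidean core.) Let k ∈ ℕ with k ≥ 1 and let p ∈ [1,∞) satisfy p > 2n/k. Then there is a constant C > 0, depending only on n, k and p, such that for all smooth functions f, g : ℝ^n → ℝ one has ‖f·g‖_{W^{k,p}(B)} ≤ C ‖f‖_{W^{k,p}(B)} ‖g‖_{W^{k,p}(B)}. -/
open MeasureTheory

/-- The Sobolev norm `‖f‖_{W^{k,p}(B)} = Σ_{j=0}^{k} (∫_B ‖D^j f‖^p)^{1/p}` of a smooth
function on the open unit ball `B ⊂ ℝⁿ`, where `D^j f` is the `j`-th iterated Fréchet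
derivative. -/
noncomputable def sobolevNormBall (n k : ℕ) (p : ℝ)
    (f : EuclideanSpace ℝ (Fin n) → ℝ) : ℝ :=
  ∑ j ∈ Finset.range (k + 1),
    (∫ x in Metric.ball (0 : EuclideanSpace ℝ (Fin n)) 1,
        ‖iteratedFDeriv ℝ j f x‖ ^ p) ^ (1 / p)

section BallLp

variable {E G : Type*} [NormedAddCommGroup E] [MeasurableSpace E] [NormedAddCommGroup G]

/-- The `L^p` norm of a function over the open unit ball. -/
noncomputable def ballLpNorm (μ : Measure E) (p : ℝ) (F : E → G) : ℝ :=
  (∫ x in Metric.ball (0 : E) 1, ‖F x‖ ^ p ∂μ) ^ (1 / p)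

theorem ballLpNorm_nonneg (μ : Measure E) (p : ℝ) (F : E → G) : 0 ≤ ballLpNorm μ p F :=
  Real.rpow_nonneg (integral_nonneg fun _ => Real.rpow_nonneg (norm_nonneg _) _) _

variable [NormedSpace ℝ E] [FiniteDimensional ℝ E] [BorelSpace E]
  (μ : Measure E) [μ.IsAddHaarMeasure]

theorem Continuous.integrableOn_unitBall {F : E → G} (hF : Continuous F) :
    IntegrableOn F (Metric.ball (0 : E) 1) μ :=
  (hF.continuousOn.integrableOn_compact (isCompact_closedBall (0 : E) 1)).mono_set
    Metric.ball_subset_closedBall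

instance isFiniteMeasure_restrict_unitBall :
    IsFiniteMeasure (μ.restrict (Metric.ball (0 : E) 1)) :=
  ⟨by simpa using Metric.isBounded_ball.measure_lt_top⟩

theorem Continuous.memLp_unitBall {F : E → G} (hF : Continuous F) (q : ENNReal) :
    MemLp F q (μ.restrict (Metric.ball (0 : E) 1)) := by
  obtain ⟨C, hC⟩ := (isCompact_closedBall (0 : E) 1).exists_bound_of_continuousOn hF.continuousOn
  refine MemLp.of_bound (hF.integrableOn_unitBall μ).aestronglyMeasurable C ?_
  filter_upwards [ae_restrict_mem measurableSet_ball] with x hx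
  exact hC x (Metric.ball_subset_closedBall hx)

theorem eLpNorm_unitBall_eq_ofReal {F : E → G} (hF : Continuous F) {p : ℝ} (hp : 1 ≤ p) :
    eLpNorm F (ENNReal.ofReal p) (μ.restrict (Metric.ball (0 : E) 1)) =
      ENNReal.ofReal (ballLpNorm μ p F) := by
  have hp0 : 0 < p := by linarith
  rw [MemLp.eLpNorm_eq_integral_rpow_norm (by simpa using hp0) ENNReal.ofReal_ne_top
    (hF.memLp_unitBall μ _), ENNReal.toReal_ofReal hp0.le, ballLpNorm, one_div]

theorem setIntegral_norm_unitBall_le {F : E → G} (hF : Continuous F) {p : ℝ} (hp : 1 ≤ p) :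
    ∫ x in Metric.ball (0 : E) 1, ‖F x‖ ∂μ ≤
      ballLpNorm μ p F * μ.real (Metric.ball (0 : E) 1) ^ (1 - 1 / p) := by
  have hp0 : 0 < p := by linarith
  have hFm := (hF.integrableOn_unitBall μ).aestronglyMeasurable
  have h := eLpNorm_le_eLpNorm_mul_rpow_measure_univ (p := 1) (q := ENNReal.ofReal p)
    (by simpa using hp) hFm
  rw [eLpNorm_unitBall_eq_ofReal μ hF hp, ENNReal.toReal_ofReal hp0.le,
    eLpNorm_one_eq_lintegral_enorm] at h
  have hexp : 0 ≤ 1 - 1 / p := by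
    rw [sub_nonneg, div_le_one hp0]; exact hp
  rw [integral_norm_eq_lintegral_enorm hFm]
  refine (ENNReal.toReal_mono ?_ h).trans_eq ?_
  · refine ENNReal.mul_ne_top ENNReal.ofReal_ne_top (ENNReal.rpow_ne_top_of_nonneg ?_ ?_)
    · simpa using hexp
    · exact measure_ne_top _ _
  · rw [ENNReal.toReal_mul, ENNReal.toReal_ofReal (ballLpNorm_nonneg μ p F),
      ← ENNReal.toReal_rpow]
    simp [Measure.real]

theorem ballLpNorm_le_mul {H : Type*} [NormedAddCommGroup H] {F : E → G} {φ : E → H}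
    (hF : Continuous F) (hφ : Continuous φ) {p : ℝ} (hp : 1 ≤ p) {c : ℝ} (hc : 0 ≤ c)
    (h : ∀ x ∈ Metric.ball (0 : E) 1, ‖F x‖ ≤ c * ‖φ x‖) :
    ballLpNorm μ p F ≤ c * ballLpNorm μ p φ := by
  have h1 := eLpNorm_le_mul_eLpNorm_of_ae_le_mul (μ := μ.restrict (Metric.ball (0 : E) 1))
    ((ae_restrict_mem measurableSet_ball).mono h) (ENNReal.ofReal p)
  rwa [eLpNorm_unitBall_eq_ofReal μ hF hp, eLpNorm_unitBall_eq_ofReal μ hφ hp,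
    ← ENNReal.ofReal_mul hc,
    ENNReal.ofReal_le_ofReal_iff (mul_nonneg hc (ballLpNorm_nonneg μ p φ))] at h1

theorem ballLpNorm_le_sum {ι : Type*} (t : Finset ι) {F : E → G} {φ : ι → E → ℝ}
    (hF : Continuous F) (hφ : ∀ i, Continuous (φ i)) {p : ℝ} (hp : 1 ≤ p)
    (h : ∀ x, ‖F x‖ ≤ ∑ i ∈ t, φ i x) :
    ballLpNorm μ p F ≤ ∑ i ∈ t, ballLpNorm μ p (φ i) := by
  have h1 : eLpNorm F (ENNReal.ofReal p) (μ.restrict (Metric.ball (0 : E) 1)) ≤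
      eLpNorm (∑ i ∈ t, φ i) (ENNReal.ofReal p) (μ.restrict (Metric.ball (0 : E) 1)) := by
    refine eLpNorm_mono_ae (Filter.Eventually.of_forall fun x => (h x).trans ?_)
    rw [Finset.sum_apply]
    exact le_abs_self _
  have h2 := h1.trans (eLpNorm_sum_le
    (fun i _ => ((hφ i).integrableOn_unitBall μ).aestronglyMeasurable) (by simpa using hp))
  rw [eLpNorm_unitBall_eq_ofReal μ hF hp,
    Finset.sum_congr rfl fun i _ => eLpNorm_unitBall_eq_ofReal μ (hφ i) hp,
    ← ENNReal.ofReal_sum_of_nonneg fun i _ => ballLpNorm_nonneg μ p (φ i)] at h2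
  exact (ENNReal.ofReal_le_ofReal_iff
    (Finset.sum_nonneg fun i _ => ballLpNorm_nonneg μ p (φ i))).1 h2

/-- Contracting the unit ball towards one of its points costs at most the Jacobian factor. -/
theorem setIntegral_unitBall_comp_contraction_le {H : E → ℝ} (hH : Continuous H)
    (hH0 : ∀ z, 0 ≤ H z) {x : E} (hx : x ∈ Metric.ball (0 : E) 1) {s : ℝ} (hs0 : 0 < s)
    (hs1 : s ≤ 1) :
    ∫ y in Metric.ball (0 : E) 1, H (x + s • (y - x)) ∂μ ≤
      (s ^ Module.finrank ℝ E)⁻¹ * ∫ y in Metric.ball (0 : E) 1, H y ∂μ := by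
  set B := Metric.ball (0 : E) 1
  have hint : Integrable (B.indicator H) μ :=
    (integrable_indicator_iff measurableSet_ball).2 (hH.integrableOn_unitBall μ)
  have hform : ∀ y, x + s • (y - x) = (x - s • x) + s • y := fun y => by
    rw [smul_sub]; abel
  have h1 : ∫ y, B.indicator H ((x - s • x) + s • y) ∂μ =
      (s ^ Module.finrank ℝ E)⁻¹ * ∫ y in B, H y ∂μ := by
    rw [Measure.integral_comp_smul μ (fun z => B.indicator H ((x - s • x) + z)) s,
      integral_add_left_eq_self, integral_indicator measurableSet_ball,
      abs_of_nonneg (by positivity), smul_eq_mul]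
  rw [← h1, ← integral_indicator measurableSet_ball]
  refine integral_mono_of_nonneg (Filter.Eventually.of_forall fun y => ?_)
    ((hint.comp_add_left (x - s • x)).comp_smul hs0.ne') (Filter.Eventually.of_forall fun y => ?_)
  · exact Set.indicator_nonneg (fun _ _ => hH0 _) _
  · by_cases hy : y ∈ B
    · have hmem : x + s • (y - x) ∈ B :=
        (convex_ball (0 : E) 1).add_smul_sub_mem hx hy ⟨hs0.le, hs1⟩
      rw [hform] at hmem
      have hy' : y ∈ Metric.ball (0 : E) 1 := hy
      simp only [Set.indicator_of_mem hy', hform, Set.indicator_of_mem hmem, le_refl]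
    · rw [Set.indicator_of_notMem hy]
      exact Set.indicator_nonneg (fun _ _ => hH0 _) _

theorem setIntegral_norm_unitBall_comp_contraction_le {F : E → G} (hF : Continuous F) {p : ℝ}
    (hp : 1 ≤ p) {x : E} (hx : x ∈ Metric.ball (0 : E) 1) {s : ℝ} (hs0 : 0 < s) (hs1 : s ≤ 1) :
    ∫ y in Metric.ball (0 : E) 1, ‖F (x + s • (y - x))‖ ∂μ ≤
      s ^ (-(Module.finrank ℝ E / p : ℝ)) *
        (ballLpNorm μ p F * μ.real (Metric.ball (0 : E) 1) ^ (1 - 1 / p)) := by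
  have hp0 : 0 < p := by linarith
  have hI : 0 ≤ ∫ y in Metric.ball (0 : E) 1, ‖F y‖ ^ p ∂μ :=
    integral_nonneg fun _ => Real.rpow_nonneg (norm_nonneg _) _
  have hc : Continuous fun z => ‖F z‖ ^ p := hF.norm.rpow_const fun _ => Or.inr hp0.le
  have h1 := setIntegral_norm_unitBall_le μ (F := fun y => F (x + s • (y - x)))
    (by fun_prop) hp
  have h2 := setIntegral_unitBall_comp_contraction_le μ hc
    (fun _ => Real.rpow_nonneg (norm_nonneg _) _) hx hs0 hs1
  have h3 : ballLpNorm μ p (fun y => F (x + s • (y - x))) ≤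
      s ^ (-(Module.finrank ℝ E / p : ℝ)) * ballLpNorm μ p F := by
    refine (Real.rpow_le_rpow (integral_nonneg fun _ => Real.rpow_nonneg (norm_nonneg _) _) h2
      (by positivity)).trans_eq ?_
    rw [Real.mul_rpow (by positivity) hI, ← Real.rpow_natCast, ← Real.rpow_neg hs0.le,
      ← Real.rpow_mul hs0.le, ballLpNorm]
    congr 2
    ring
  rw [← mul_assoc]
  exact h1.trans (mul_le_mul_of_nonneg_right h3 (Real.rpow_nonneg measureReal_nonneg _))

end BallLp

/-- Iterating the estimate `h j s ≤ h j 1 + c ∫ₛ¹ h (j + 1)`, with the weights of Taylor's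
formula. -/
theorem le_sum_add_integral_pow_mul {h : ℕ → ℝ → ℝ} {c : ℝ} (hc : 0 ≤ c)
    (hcont : ∀ j, Continuous (h j)) (h0 : ∀ j s, 0 ≤ h j s)
    (hstep : ∀ j, ∀ s ∈ Set.Icc (0 : ℝ) 1, h j s ≤ h j 1 + c * ∫ r in s..1, h (j + 1) r)
    (i m : ℕ) :
    h i 0 ≤ (∑ j ∈ Finset.range (m + 1), c ^ j * h (i + j) 1) +
      c ^ (m + 1) * ∫ s in (0 : ℝ)..1, s ^ m * h (i + m + 1) s := by
  induction m with
  | zero => simpa using hstep i 0 ⟨le_rfl, zero_le_one⟩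
  | succ m ih =>
    set q := i + m + 1 with hq
    set u : ℝ → ℝ := fun s => h q 1 + c * ∫ r in s..1, h (q + 1) r with hu
    have hud : ∀ s, HasDerivAt u (-(c * h (q + 1) s)) s := fun s => by
      have := ((intervalIntegral.integral_hasDerivAt_left
        ((hcont (q + 1)).intervalIntegrable s 1)
        (hcont (q + 1)).stronglyMeasurable.stronglyMeasurableAtFilter
        (hcont (q + 1)).continuousAt).const_mul c).const_add (h q 1)
      simpa [hu] using this
    have huc : Continuous u := continuous_iff_continuousAt.2 fun s => (hud s).continuousAt
    have hvd : ∀ s : ℝ, HasDerivAt (fun s : ℝ => s ^ (m + 1) / (m + 1)) (s ^ m) s := fun s => by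
      have := (hasDerivAt_pow (m + 1) s).div_const ((m : ℝ) + 1)
      convert! this using 1
      push_cast
      field_simp
    have hparts := intervalIntegral.integral_mul_deriv_eq_deriv_mul (a := 0) (b := 1)
      (fun s _ => hud s) (fun s _ => hvd s)
      ((((hcont (q + 1)).const_mul c).neg).intervalIntegrable _ _)
      ((continuous_pow m).intervalIntegrable _ _)
    have hle : ∫ s in (0 : ℝ)..1, s ^ m * h q s ≤ ∫ s in (0 : ℝ)..1, u s * s ^ m := by
      refine intervalIntegral.integral_mono_on zero_le_one
        (((continuous_pow m).mul (hcont q)).intervalIntegrable _ _)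
        ((huc.mul (continuous_pow m)).intervalIntegrable _ _) fun s hs => ?_
      rw [mul_comm]
      exact mul_le_mul_of_nonneg_right (hstep q s hs) (pow_nonneg hs.1 _)
    set J := ∫ s in (0 : ℝ)..1, s ^ (m + 1) * h (q + 1) s with hJ
    have hJ0 : 0 ≤ J := intervalIntegral.integral_nonneg zero_le_one
      fun s hs => mul_nonneg (pow_nonneg hs.1 _) (h0 _ _)
    have hJeq : ∫ s in (0 : ℝ)..1, -(c * h (q + 1) s) * (s ^ (m + 1) / (m + 1)) =
        -(c / (m + 1)) * J := by
      rw [hJ, ← intervalIntegral.integral_const_mul]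
      congr 1
      ext s
      ring
    have hval : ∫ s in (0 : ℝ)..1, u s * s ^ m = (h q 1 + c * J) / (m + 1) := by
      rw [hparts, hJeq]
      simp [hu]
      ring
    have hdiv : (h q 1 + c * J) / (m + 1) ≤ h q 1 + c * J :=
      div_le_self (add_nonneg (h0 _ _) (mul_nonneg hc hJ0)) (by simp)
    have hfin := mul_le_mul_of_nonneg_left (hle.trans (hval.trans_le hdiv))
      (pow_nonneg hc (m + 1))
    have hq' : i + (m + 1) = q := by omega
    rw [Finset.sum_range_succ, hq']
    calc h i 0 ≤ _ := ih
      _ ≤ _ := add_le_add_right hfin _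
      _ = _ := by ring

section Taylor

variable {E F : Type*} [NormedAddCommGroup E] [NormedSpace ℝ E]
  [NormedAddCommGroup F] [NormedSpace ℝ F]

theorem ContDiff.norm_iteratedFDeriv_segment_le {f : E → F} (hf : ContDiff ℝ (⊤ : ℕ∞) f)
    [CompleteSpace F] (x y : E) {c : ℝ} (hc : ‖y - x‖ ≤ c) (j : ℕ) {s : ℝ} (hs : s ≤ 1) :
    ‖iteratedFDeriv ℝ j f (x + s • (y - x))‖ ≤ ‖iteratedFDeriv ℝ j f (x + (1 : ℝ) • (y - x))‖ +
      c * ∫ r in s..1, ‖iteratedFDeriv ℝ (j + 1) f (x + r • (y - x))‖ := by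
  have hdiff : Differentiable ℝ (iteratedFDeriv ℝ j f) :=
    hf.differentiable_iteratedFDeriv (by exact_mod_cast WithTop.coe_lt_top _)
  have hcf : Continuous (fderiv ℝ (iteratedFDeriv ℝ j f)) :=
    (hf.iteratedFDeriv_right (m := 1) (i := j) (by exact_mod_cast le_top)).continuous_fderiv
      (by simp)
  have hcn : Continuous (iteratedFDeriv ℝ (j + 1) f) :=
    hf.continuous_iteratedFDeriv (by exact_mod_cast le_top)
  have hd : ∀ r : ℝ, HasDerivAt (fun r : ℝ => iteratedFDeriv ℝ j f (x + r • (y - x)))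
      (fderiv ℝ (iteratedFDeriv ℝ j f) (x + r • (y - x)) (y - x)) r := fun r => by
    have hl : HasDerivAt (fun r : ℝ => x + r • (y - x)) (y - x) r := by
      simpa using ((hasDerivAt_id r).smul_const (y - x)).const_add x
    exact (hdiff _).hasFDerivAt.comp_hasDerivAt r hl
  have hdc : Continuous fun r : ℝ =>
      fderiv ℝ (iteratedFDeriv ℝ j f) (x + r • (y - x)) (y - x) := by fun_prop
  have hftc := intervalIntegral.integral_eq_sub_of_hasDerivAt (a := s) (b := 1)
    (fun r _ => hd r) (hdc.intervalIntegrable _ _)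
  have hbound : ‖∫ r in s..1, fderiv ℝ (iteratedFDeriv ℝ j f) (x + r • (y - x)) (y - x)‖ ≤
      c * ∫ r in s..1, ‖iteratedFDeriv ℝ (j + 1) f (x + r • (y - x))‖ := by
    rw [← intervalIntegral.integral_const_mul]
    refine (intervalIntegral.norm_integral_le_integral_norm hs).trans
      (intervalIntegral.integral_mono_on hs (hdc.norm.intervalIntegrable _ _)
        (Continuous.intervalIntegrable (by fun_prop) _ _) fun r _ => ?_)
    rw [← norm_fderiv_iteratedFDeriv, mul_comm]
    exact (ContinuousLinearMap.le_opNorm _ _).trans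
      (mul_le_mul_of_nonneg_left hc (norm_nonneg _))
  have hsub : iteratedFDeriv ℝ j f (x + s • (y - x)) =
      iteratedFDeriv ℝ j f (x + (1 : ℝ) • (y - x)) -
        ∫ r in s..1, fderiv ℝ (iteratedFDeriv ℝ j f) (x + r • (y - x)) (y - x) := by
    rw [hftc]; abel
  rw [hsub]
  exact (norm_sub_le _ _).trans (add_le_add_right hbound _)

/-- A norm form of Taylor's formula along the segment from `x` to `y`. -/
theorem ContDiff.norm_iteratedFDeriv_le_sum_add_integral {f : E → F}
    (hf : ContDiff ℝ (⊤ : ℕ∞) f) [CompleteSpace F] (x y : E) {c : ℝ} (hc : ‖y - x‖ ≤ c)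
    (i m : ℕ) :
    ‖iteratedFDeriv ℝ i f x‖ ≤
      (∑ j ∈ Finset.range (m + 1), c ^ j * ‖iteratedFDeriv ℝ (i + j) f y‖) +
      c ^ (m + 1) * ∫ s in (0 : ℝ)..1,
        s ^ m * ‖iteratedFDeriv ℝ (i + m + 1) f (x + s • (y - x))‖ := by
  have hcn : ∀ j, Continuous (iteratedFDeriv ℝ j f) := fun j =>
    hf.continuous_iteratedFDeriv (by exact_mod_cast le_top)
  have := le_sum_add_integral_pow_mul
    (h := fun j s => ‖iteratedFDeriv ℝ j f (x + s • (y - x))‖)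
    ((norm_nonneg _).trans hc) (fun j => by have := hcn j; fun_prop) (fun _ _ => norm_nonneg _)
    (fun j s hs => hf.norm_iteratedFDeriv_segment_le x y hc j hs.2) i m
  simpa using this

end Taylor

section SupBound

variable {E F : Type*} [NormedAddCommGroup E] [NormedSpace ℝ E] [FiniteDimensional ℝ E]
  [MeasurableSpace E] [BorelSpace E] [NormedAddCommGroup F] [NormedSpace ℝ F] [CompleteSpace F]
  (μ : Measure E) [μ.IsAddHaarMeasure]

theorem integral_pow_mul_contraction_le {G : Type*} [NormedAddCommGroup G] {Φ : E → G}
    (hΦ : Continuous Φ) {p : ℝ} (hp : 1 ≤ p) {m : ℕ} (hm : Module.finrank ℝ E / p < m + 1)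
    {x : E} (hx : x ∈ Metric.ball (0 : E) 1) :
    ∫ y in Metric.ball (0 : E) 1, (∫ s in (0 : ℝ)..1, s ^ m * ‖Φ (x + s • (y - x))‖) ∂μ ≤
      (m + 1 - Module.finrank ℝ E / p)⁻¹ *
        (ballLpNorm μ p Φ * μ.real (Metric.ball (0 : E) 1) ^ (1 - 1 / p)) := by
  set B := Metric.ball (0 : E) 1
  set a : ℝ := Module.finrank ℝ E / p
  set N := ballLpNorm μ p Φ * μ.real B ^ (1 - 1 / p)
  have hcont : Continuous (Function.uncurry fun (s : ℝ) (y : E) =>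
      s ^ m * ‖Φ (x + s • (y - x))‖) := by
    unfold Function.uncurry
    fun_prop
  have hint : Integrable (Function.uncurry fun (s : ℝ) (y : E) =>
      s ^ m * ‖Φ (x + s • (y - x))‖)
      ((volume.restrict (Set.uIoc (0 : ℝ) 1)).prod (μ.restrict B)) := by
    rw [Measure.prod_restrict]
    refine IntegrableOn.mono_set (hcont.continuousOn.integrableOn_compact
      ((isCompact_uIcc (a := (0 : ℝ)) (b := 1)).prod (isCompact_closedBall (0 : E) 1))) ?_
    exact Set.prod_mono Set.uIoc_subset_uIcc Metric.ball_subset_closedBall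
  rw [← intervalIntegral_integral_swap hint]
  have hr : -1 < (m : ℝ) - a := by linarith
  have hval : ∫ s in (0 : ℝ)..1, s ^ ((m : ℝ) - a) * N = (m + 1 - a)⁻¹ * N := by
    have hne : (m : ℝ) - a + 1 ≠ 0 := by linarith
    rw [intervalIntegral.integral_mul_const, integral_rpow (Or.inl hr), Real.one_rpow,
      Real.zero_rpow hne, sub_zero, one_div]
    congr 2
    ring
  rw [← hval]
  refine intervalIntegral.integral_mono_on_of_le_Ioo zero_le_one ?_
    ((intervalIntegral.intervalIntegrable_rpow' hr).mul_const N) fun s hs => ?_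
  · rw [intervalIntegrable_iff]
    exact hint.integral_prod_left
  · rw [integral_const_mul, sub_eq_add_neg, Real.rpow_add hs.1, Real.rpow_natCast, mul_assoc]
    exact mul_le_mul_of_nonneg_left
      (setIntegral_norm_unitBall_comp_contraction_le μ hΦ hp hx hs.1 hs.2.le)
      (pow_nonneg hs.1.le m)

/-- Taylor's formula in norm form, averaged over the unit ball. -/
theorem measureReal_unitBall_mul_norm_iteratedFDeriv_le {f : E → F}
    (hf : ContDiff ℝ (⊤ : ℕ∞) f) {x : E} (hx : x ∈ Metric.ball (0 : E) 1) (i m : ℕ) :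
    μ.real (Metric.ball (0 : E) 1) * ‖iteratedFDeriv ℝ i f x‖ ≤
      (∑ j ∈ Finset.range (m + 1),
        2 ^ j * ∫ y in Metric.ball (0 : E) 1, ‖iteratedFDeriv ℝ (i + j) f y‖ ∂μ) +
      2 ^ (m + 1) * ∫ y in Metric.ball (0 : E) 1, (∫ s in (0 : ℝ)..1,
        s ^ m * ‖iteratedFDeriv ℝ (i + m + 1) f (x + s • (y - x))‖) ∂μ := by
  set B := Metric.ball (0 : E) 1
  have hcn : ∀ j, Continuous (iteratedFDeriv ℝ j f) := fun j =>
    hf.continuous_iteratedFDeriv (by exact_mod_cast le_top)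
  have hI1 : ∀ j, IntegrableOn (fun y => (2 : ℝ) ^ j * ‖iteratedFDeriv ℝ (i + j) f y‖) B μ :=
    fun j => ((hcn (i + j)).norm.const_mul _).integrableOn_unitBall μ
  have hc2 : Continuous fun y : E => ∫ s in (0 : ℝ)..1,
      s ^ m * ‖iteratedFDeriv ℝ (i + m + 1) f (x + s • (y - x))‖ := by
    refine intervalIntegral.continuous_parametric_intervalIntegral_of_continuous' ?_ 0 1
    have := hcn (i + m + 1)
    unfold Function.uncurry
    fun_prop
  have hI2 := (hc2.const_mul ((2 : ℝ) ^ (m + 1))).integrableOn_unitBall μ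
  have h1 := setIntegral_mono_on (μ := μ) (s := B)
    (f := fun _ => ‖iteratedFDeriv ℝ i f x‖)
    (continuous_const.integrableOn_unitBall μ)
    ((integrable_finsetSum (Finset.range (m + 1)) fun j _ => hI1 j).add hI2)
    measurableSet_ball fun y hy =>
      hf.norm_iteratedFDeriv_le_sum_add_integral x y (c := 2) (by
        rw [mem_ball_zero_iff] at hx hy
        linarith [norm_sub_le y x]) i m
  simp only [Pi.add_apply] at h1
  rw [integral_add (integrable_finsetSum (Finset.range (m + 1)) fun j _ => hI1 j) hI2,
    integral_finsetSum _ fun j _ => hI1 j] at h1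
  simpa [integral_const_mul, setIntegral_const] using h1

/-- The Sobolev embedding into bounded functions on the unit ball, for an arbitrary
derivative. -/
theorem exists_norm_iteratedFDeriv_le_sum_ballLpNorm {p : ℝ} (hp : 1 ≤ p) {m : ℕ}
    (hm : Module.finrank ℝ E / p < m + 1) (i : ℕ) :
    ∃ C : ℝ, 0 ≤ C ∧ ∀ f : E → F, ContDiff ℝ (⊤ : ℕ∞) f → ∀ x ∈ Metric.ball (0 : E) 1,
      ‖iteratedFDeriv ℝ i f x‖ ≤
        C * ∑ j ∈ Finset.range (m + 2), ballLpNorm μ p (iteratedFDeriv ℝ (i + j) f) := by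
  set B := Metric.ball (0 : E) 1
  set a : ℝ := Module.finrank ℝ E / p
  set K := μ.real B ^ (1 - 1 / p)
  have hV : 0 < μ.real B :=
    ENNReal.toReal_pos (Metric.measure_ball_pos μ 0 one_pos).ne'
      Metric.isBounded_ball.measure_lt_top.ne
  have hK : 0 ≤ K := Real.rpow_nonneg measureReal_nonneg _
  have ha : 0 < (m + 1 - a)⁻¹ := inv_pos.2 (by linarith)
  refine ⟨2 ^ (m + 1) * K * (1 + (m + 1 - a)⁻¹) / μ.real B, by positivity, fun f hf x hx => ?_⟩
  have hcn : ∀ j, Continuous (iteratedFDeriv ℝ j f) := fun j =>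
    hf.continuous_iteratedFDeriv (by exact_mod_cast le_top)
  set N : ℕ → ℝ := fun j => ballLpNorm μ p (iteratedFDeriv ℝ (i + j) f)
  have hN : ∀ j, 0 ≤ N j := fun j => ballLpNorm_nonneg _ _ _
  have hmain := measureReal_unitBall_mul_norm_iteratedFDeriv_le μ hf hx i m
  have hlast : ∫ y in B, (∫ s in (0 : ℝ)..1,
      s ^ m * ‖iteratedFDeriv ℝ (i + m + 1) f (x + s • (y - x))‖) ∂μ ≤
      (m + 1 - a)⁻¹ * (N (m + 1) * K) :=
    integral_pow_mul_contraction_le μ (hcn (i + m + 1)) hp hm hx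
  have hsum : (∑ j ∈ Finset.range (m + 1),
      (2 : ℝ) ^ j * ∫ y in B, ‖iteratedFDeriv ℝ (i + j) f y‖ ∂μ) ≤
      2 ^ (m + 1) * K * ∑ j ∈ Finset.range (m + 1), N j := by
    rw [Finset.mul_sum]
    refine Finset.sum_le_sum fun j hj => ?_
    have hpow : (2 : ℝ) ^ j ≤ 2 ^ (m + 1) :=
      pow_le_pow_right₀ one_le_two (Finset.mem_range.1 hj).le
    have hint : ∫ y in B, ‖iteratedFDeriv ℝ (i + j) f y‖ ∂μ ≤ N j * K :=
      setIntegral_norm_unitBall_le μ (hcn (i + j)) hp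
    calc _ ≤ (2 : ℝ) ^ j * (N j * K) := mul_le_mul_of_nonneg_left hint (by positivity)
      _ ≤ 2 ^ (m + 1) * (N j * K) := mul_le_mul_of_nonneg_right hpow (mul_nonneg (hN j) hK)
      _ = _ := by ring
  have hlast' := mul_le_mul_of_nonneg_left hlast (pow_nonneg (zero_le_two (α := ℝ)) (m + 1))
  rw [div_mul_eq_mul_div, le_div_iff₀ hV, mul_comm, Finset.sum_range_succ]
  refine (hmain.trans (add_le_add hsum hlast')).trans ?_
  change _ ≤ 2 ^ (m + 1) * K * (1 + (m + 1 - a)⁻¹) *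
    (∑ j ∈ Finset.range (m + 1), N j + N (m + 1))
  clear_value N K a
  have hS : 0 ≤ ∑ j ∈ Finset.range (m + 1), N j := Finset.sum_nonneg fun j _ => hN j
  have hprod : 0 ≤ 2 ^ (m + 1) * K * (m + 1 - a)⁻¹ * ∑ j ∈ Finset.range (m + 1), N j := by
    positivity
  have hprod' : 0 ≤ 2 ^ (m + 1) * K * N (m + 1) := mul_nonneg (by positivity) (hN _)
  linarith

end SupBound

theorem sobolevNormBall_eq_sum (n k : ℕ) (p : ℝ) (f : EuclideanSpace ℝ (Fin n) → ℝ) :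
    sobolevNormBall n k p f =
      ∑ j ∈ Finset.range (k + 1), ballLpNorm volume p (iteratedFDeriv ℝ j f) := rfl

theorem sobolevNormBall_nonneg (n k : ℕ) (p : ℝ) (f : EuclideanSpace ℝ (Fin n) → ℝ) :
    0 ≤ sobolevNormBall n k p f :=
  Finset.sum_nonneg fun _ _ => ballLpNorm_nonneg _ _ _

theorem ballLpNorm_le_sobolevNormBall {n k : ℕ} (p : ℝ) (f : EuclideanSpace ℝ (Fin n) → ℝ)
    {j : ℕ} (hj : j ≤ k) :
    ballLpNorm volume p (iteratedFDeriv ℝ j f) ≤ sobolevNormBall n k p f :=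
  Finset.single_le_sum (f := fun j => ballLpNorm volume p (iteratedFDeriv ℝ j f))
    (fun _ _ => ballLpNorm_nonneg _ _ _) (Finset.mem_range.2 (Nat.lt_succ_of_le hj))

/-- Derivatives of order at most `k / 2` are bounded on the unit ball by the `W^{k,p}` norm. -/
theorem exists_norm_iteratedFDeriv_le_sobolevNormBall {n k : ℕ} (hk : 1 ≤ k) {p : ℝ}
    (hp : 1 ≤ p) (hpk : p > 2 * n / k) :
    ∃ C : ℝ, 0 ≤ C ∧ ∀ i, 2 * i ≤ k → ∀ f : EuclideanSpace ℝ (Fin n) → ℝ,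
      ContDiff ℝ (⊤ : ℕ∞) f → ∀ x ∈ Metric.ball (0 : EuclideanSpace ℝ (Fin n)) 1,
        ‖iteratedFDeriv ℝ i f x‖ ≤ C * sobolevNormBall n k p f := by
  have hp0 : 0 < p := by linarith
  have hk0 : (0 : ℝ) < k := by exact_mod_cast hk
  have key : ∀ i, ∃ C : ℝ, 0 ≤ C ∧ (2 * i ≤ k → ∀ f : EuclideanSpace ℝ (Fin n) → ℝ,
      ContDiff ℝ (⊤ : ℕ∞) f → ∀ x ∈ Metric.ball (0 : EuclideanSpace ℝ (Fin n)) 1,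
        ‖iteratedFDeriv ℝ i f x‖ ≤ C * sobolevNormBall n k p f) := by
    intro i
    by_cases hi : 2 * i ≤ k
    swap
    · exact ⟨0, le_rfl, fun h => absurd h hi⟩
    obtain ⟨m, rfl⟩ : ∃ m, k = i + (m + 1) := ⟨k - i - 1, by omega⟩
    have hm : (Module.finrank ℝ (EuclideanSpace ℝ (Fin n)) : ℝ) / p < m + 1 := by
      rw [finrank_euclideanSpace_fin, div_lt_iff₀ hp0]
      rw [gt_iff_lt, div_lt_iff₀ hk0] at hpk
      have hi' : (i : ℝ) ≤ m + 1 := by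
        have : i ≤ m + 1 := by omega
        exact_mod_cast this
      push_cast at hpk
      nlinarith
    obtain ⟨C, hC, h⟩ := exists_norm_iteratedFDeriv_le_sum_ballLpNorm
      (F := ℝ) (volume : Measure (EuclideanSpace ℝ (Fin n))) hp hm i
    refine ⟨C, hC, fun _ f hf x hx => (h f hf x hx).trans (mul_le_mul_of_nonneg_left ?_ hC)⟩
    rw [sobolevNormBall_eq_sum, show i + (m + 1) + 1 = i + (m + 2) by ring,
      Finset.sum_range_add _ i (m + 2)]
    exact le_add_of_nonneg_left (Finset.sum_nonneg fun j _ =>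
      ballLpNorm_nonneg volume p (iteratedFDeriv ℝ j f))
  choose C hC h using key
  refine ⟨∑ i ∈ Finset.range (k + 1), C i, Finset.sum_nonneg fun i _ => hC i,
    fun i hi f hf x hx => (h i hi f hf x hx).trans (mul_le_mul_of_nonneg_right ?_
      (sobolevNormBall_nonneg n k p f))⟩
  exact Finset.single_le_sum (fun i _ => hC i) (Finset.mem_range.2 (by omega))

/-- **Banach algebra property of Sobolev spaces** (Lemma 2.8, Euclidean core).
Let `k ≥ 1` and `p ∈ [1,∞)` with `p > 2n/k`.  Then there is a constant `C > 0`,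
depending only on `n`, `k` and `p`, such that for all smooth `f, g : ℝⁿ → ℝ` one has
`‖f·g‖_{W^{k,p}(B)} ≤ C ‖f‖_{W^{k,p}(B)} ‖g‖_{W^{k,p}(B)}`. -/
theorem sobolev_banach_algebra (n : ℕ) (hn : 1 ≤ n) (k : ℕ) (hk : 1 ≤ k)
    (p : ℝ) (hp : 1 ≤ p) (hpk : p > 2 * n / k) :
    ∃ C : ℝ, 0 < C ∧
      ∀ f g : EuclideanSpace ℝ (Fin n) → ℝ, ContDiff ℝ (⊤ : ℕ∞) f → ContDiff ℝ (⊤ : ℕ∞) g →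
        sobolevNormBall n k p (f * g) ≤
          C * sobolevNormBall n k p f * sobolevNormBall n k p g := by
  obtain ⟨C, hC, hsup⟩ := exists_norm_iteratedFDeriv_le_sobolevNormBall hk hp hpk
  refine ⟨(∑ j ∈ Finset.range (k + 1), ∑ i ∈ Finset.range (j + 1), (j.choose i : ℝ) * C) + 1,
    by positivity, fun f g hf hg => ?_⟩
  have hcf : ∀ j, Continuous (iteratedFDeriv ℝ j f) := fun j =>
    hf.continuous_iteratedFDeriv (by exact_mod_cast le_top)
  have hcg : ∀ j, Continuous (iteratedFDeriv ℝ j g) := fun j =>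
    hg.continuous_iteratedFDeriv (by exact_mod_cast le_top)
  have hcfg : ∀ j, Continuous (iteratedFDeriv ℝ j (f * g)) := fun j =>
    (hf.mul hg).continuous_iteratedFDeriv (by exact_mod_cast le_top)
  have hSf := sobolevNormBall_nonneg n k p f
  have hSg := sobolevNormBall_nonneg n k p g
  have hterm : ∀ j ∈ Finset.range (k + 1), ∀ i ∈ Finset.range (j + 1),
      ballLpNorm volume p (fun x => (j.choose i : ℝ) * ‖iteratedFDeriv ℝ i f x‖ *
        ‖iteratedFDeriv ℝ (j - i) g x‖) ≤
      (j.choose i : ℝ) * C * (sobolevNormBall n k p f * sobolevNormBall n k p g) := by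
    intro j hj i hi
    rw [Finset.mem_range] at hj hi
    have hcφ : Continuous fun x => (j.choose i : ℝ) * ‖iteratedFDeriv ℝ i f x‖ *
        ‖iteratedFDeriv ℝ (j - i) g x‖ := by
      have := hcf i
      have := hcg (j - i)
      fun_prop
    by_cases h : 2 * i ≤ k
    · refine (ballLpNorm_le_mul volume hcφ (hcg (j - i)) hp
        (c := j.choose i * (C * sobolevNormBall n k p f)) (by positivity) fun x hx => ?_).trans
        ((mul_le_mul_of_nonneg_left (ballLpNorm_le_sobolevNormBall p g (k := k) (by omega))
          (by positivity)).trans_eq (by ring))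
      rw [Real.norm_of_nonneg (by positivity)]
      gcongr
      exact hsup i h f hf x hx
    · refine (ballLpNorm_le_mul volume hcφ (hcf i) hp
        (c := j.choose i * (C * sobolevNormBall n k p g)) (by positivity) fun x hx => ?_).trans
        ((mul_le_mul_of_nonneg_left (ballLpNorm_le_sobolevNormBall p f (k := k) (by omega))
          (by positivity)).trans_eq (by ring))
      rw [Real.norm_of_nonneg (by positivity), mul_right_comm]
      gcongr
      exact hsup (j - i) (by omega) g hg x hx
  have hj : ∀ j ∈ Finset.range (k + 1), ballLpNorm volume p (iteratedFDeriv ℝ j (f * g)) ≤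
      (∑ i ∈ Finset.range (j + 1), (j.choose i : ℝ) * C) *
        (sobolevNormBall n k p f * sobolevNormBall n k p g) := by
    intro j hj
    rw [Finset.sum_mul]
    refine (ballLpNorm_le_sum volume (Finset.range (j + 1)) (hcfg j)
      (φ := fun i x => (j.choose i : ℝ) * ‖iteratedFDeriv ℝ i f x‖ *
        ‖iteratedFDeriv ℝ (j - i) g x‖) (fun i => ?_) hp fun x => ?_).trans
      (Finset.sum_le_sum (hterm j hj))
    · have := hcf i
      have := hcg (j - i)
      fun_prop
    · exact norm_iteratedFDeriv_mul_le hf hg x (by exact_mod_cast le_top)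
  rw [sobolevNormBall_eq_sum n k p (f * g)]
  refine (Finset.sum_le_sum hj).trans ?_
  rw [← Finset.sum_mul, mul_assoc]
  exact mul_le_mul_of_nonneg_right (by linarith) (mul_nonneg hSf hSg)
end

section
/- (Poincaré-type inequality for triple-junction triples, Proposition 2.10, flat model.) There is a constant C > 0, depending only on n and γ¹, γ², γ³, such that every triple ρ = (ρ¹, ρ², ρ³) as in the context satisfies Σ_{i=1}^{3} ∫_B |ρ^i(x)|² dx ≤ C Σ_{i=1}^{3} ∫_B ‖∇ρ^i(x)‖² dx, where ∇ρ^i denotes the (total) derivative of ρ^i. -/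
open MeasureTheory

/-- Cauchy–Schwarz against the constant function on a finite measure space. -/
lemma sq_integral_le_measureReal_mul_integral_sq {α : Type*} [MeasurableSpace α] {μ : Measure α}
    [IsFiniteMeasure μ] {f : α → ℝ} (hf : Integrable f μ) (hf2 : Integrable (fun x => f x ^ 2) μ) :
    (∫ x, f x ∂μ) ^ 2 ≤ μ.real Set.univ * ∫ x, f x ^ 2 ∂μ := by
  rcases eq_or_ne μ 0 with rfl | hμ
  · simp
  set V := μ.real Set.univ
  set I := ∫ x, f x ∂μ
  have hVpos : 0 < V := by
    have : NeZero μ := ⟨hμ⟩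
    exact measureReal_univ_pos
  have h0 : 0 ≤ ∫ x, (V * f x - I) ^ 2 ∂μ := integral_nonneg fun x => sq_nonneg _
  have h1 : ∫ x, (V * f x - I) ^ 2 ∂μ = V ^ 2 * ∫ x, f x ^ 2 ∂μ - 2 * V * I * I + I ^ 2 * V := by
    have : ∀ x, (V * f x - I) ^ 2 = V ^ 2 * f x ^ 2 - 2 * V * I * f x + I ^ 2 := fun x => by ring
    simp_rw [this]
    have hi : Integrable (fun x => V ^ 2 * f x ^ 2 - 2 * V * I * f x) μ :=
      (hf2.const_mul _).sub (hf.const_mul _)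
    rw [integral_add hi (integrable_const _),
      integral_sub (hf2.const_mul _) (hf.const_mul _), integral_const_mul, integral_const_mul,
      integral_const, smul_eq_mul, mul_comm (μ.real _)]
  rw [h1] at h0
  have h2 : 0 ≤ V * (V * ∫ x, f x ^ 2 ∂μ - I ^ 2) := by linarith
  linarith [nonneg_of_mul_nonneg_right h2 hVpos]

section UnitBall

open Metric Set

variable {E : Type*} [NormedAddCommGroup E] [NormedSpace ℝ E]

lemma norm_add_three_smul_sq_le (a b c : ℝ) (x y z : E) :
    ‖a • x + b • y + c • z‖ ^ 2 ≤
      (a ^ 2 + b ^ 2 + c ^ 2) * (‖x‖ ^ 2 + ‖y‖ ^ 2 + ‖z‖ ^ 2) := by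
  have h : ‖a • x + b • y + c • z‖ ≤ |a| * ‖x‖ + |b| * ‖y‖ + |c| * ‖z‖ := by
    simpa only [norm_smul, Real.norm_eq_abs] using
      norm_add₃_le (a := a • x) (b := b • y) (c := c • z)
  refine (pow_le_pow_left₀ (norm_nonneg _) h 2).trans ?_
  rw [← sq_abs a, ← sq_abs b, ← sq_abs c]
  nlinarith [sq_nonneg (|a| * ‖y‖ - |b| * ‖x‖), sq_nonneg (|a| * ‖z‖ - |c| * ‖x‖),
    sq_nonneg (|b| * ‖z‖ - |c| * ‖y‖)]

/-- The energy density `‖∇f‖²` on the open unit ball, extended by zero. -/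
noncomputable def ballEnergyDensity (f : E → ℝ) : E → ENNReal :=
  (ball (0 : E) 1).indicator fun z => ENNReal.ofReal (‖fderiv ℝ f z‖ ^ 2)

lemma norm_add_smul_le_combo {x v : E} {T t : ℝ} (ht0 : 0 ≤ t) (htT : t ≤ T) (hT : 0 < T) :
    ‖x + t • v‖ ≤ (1 - t / T) * ‖x‖ + t / T * ‖x + T • v‖ := by
  have h : x + t • v = (1 - t / T) • x + (t / T) • (x + T • v) := by
    rw [smul_add, smul_smul, div_mul_cancel₀ _ hT.ne', sub_smul, one_smul]
    abel
  have h1 : t / T ≤ 1 := (div_le_one hT).2 htT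
  rw [h]
  refine (norm_add_le _ _).trans_eq ?_
  rw [norm_smul, norm_smul, Real.norm_of_nonneg (by linarith), Real.norm_of_nonneg (by positivity)]

/-- The fundamental theorem of calculus along a segment of the unit ball, combined with
Cauchy–Schwarz. -/
lemma ofReal_sq_sub_le_lintegral_segment {f : E → ℝ} {O : Set E} (hO : IsOpen O)
    (hB : closedBall (0 : E) 1 ⊆ O) (hf : ContDiffOn ℝ 1 f O) {x v : E} {T : ℝ} (hT : 0 ≤ T)
    (hx : x ∈ ball (0 : E) 1) (hy : x + T • v ∈ closedBall (0 : E) 1) :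
    ENNReal.ofReal ((f (x + T • v) - f x) ^ 2) ≤
      ENNReal.ofReal (T * ‖v‖ ^ 2) * ∫⁻ t in Ioo 0 T, ballEnergyDensity f (x + t • v) := by
  rcases hT.eq_or_lt with rfl | hT
  · simp
  rw [mem_ball_zero_iff] at hx
  rw [mem_closedBall_zero_iff] at hy
  have hclosed : ∀ t ∈ Icc 0 T, x + t • v ∈ O := fun t ht => hB <| by
    have h1 : t / T ≤ 1 := (div_le_one hT).2 ht.2
    have h0 : 0 ≤ t / T := div_nonneg ht.1 hT.le
    rw [mem_closedBall_zero_iff]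
    nlinarith [norm_add_smul_le_combo (x := x) (v := v) ht.1 ht.2 hT]
  have hopen : ∀ t ∈ Ioo 0 T, x + t • v ∈ ball (0 : E) 1 := fun t ht => by
    have h1 : t / T < 1 := (div_lt_one hT).2 ht.2
    have h0 : 0 ≤ t / T := div_nonneg ht.1.le hT.le
    rw [mem_ball_zero_iff]
    nlinarith [norm_add_smul_le_combo (x := x) (v := v) ht.1.le ht.2.le hT]
  set φ : ℝ → ℝ := fun t => fderiv ℝ f (x + t • v) v
  have hline : Continuous fun t : ℝ => x + t • v := by fun_prop
  have hdf : ContinuousOn (fun t : ℝ => fderiv ℝ f (x + t • v)) (Icc 0 T) :=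
    (hf.continuousOn_fderiv_of_isOpen hO le_rfl).comp hline.continuousOn hclosed
  have hφc : ContinuousOn φ (Icc 0 T) := hdf.clm_apply continuousOn_const
  have hderiv : ∀ t ∈ uIcc 0 T, HasDerivAt (fun t : ℝ => f (x + t • v)) (φ t) t := by
    intro t ht
    rw [uIcc_of_le hT.le] at ht
    have h1 : HasFDerivAt f (fderiv ℝ f (x + t • v)) (x + t • v) :=
      ((hf.differentiableOn one_ne_zero).differentiableAt
        (hO.mem_nhds (hclosed t ht))).hasFDerivAt
    have h2 : HasDerivAt (fun t : ℝ => x + t • v) v t := by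
      simpa using ((hasDerivAt_id t).smul_const v).const_add x
    exact h1.comp_hasDerivAt t h2
  have hftc : ∫ t in Ioo 0 T, φ t = f (x + T • v) - f x := by
    rw [← integral_Ioc_eq_integral_Ioo, ← intervalIntegral.integral_of_le hT.le,
      intervalIntegral.integral_eq_sub_of_hasDerivAt hderiv
        (ContinuousOn.intervalIntegrable (by rwa [uIcc_of_le hT.le]))]
    simp
  have hint : ∀ {g : ℝ → ℝ}, ContinuousOn g (Icc 0 T) → IntegrableOn g (Ioo 0 T) := fun hg =>
    (hg.integrableOn_compact isCompact_Icc).mono_set Ioo_subset_Icc_self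
  have hCS := sq_integral_le_measureReal_mul_integral_sq (hint hφc) (hint (hφc.pow 2))
  have hmono : ∫ t in Ioo 0 T, φ t ^ 2 ≤
      ∫ t in Ioo 0 T, ‖v‖ ^ 2 * ‖fderiv ℝ f (x + t • v)‖ ^ 2 := by
    refine integral_mono (hint (hφc.pow 2)) (hint (continuousOn_const.mul (hdf.norm.pow 2)))
      fun t => ?_
    rw [← sq_abs, ← mul_pow, mul_comm]
    exact pow_le_pow_left₀ (abs_nonneg _) ((fderiv ℝ f (x + t • v)).le_opNorm v) 2
  have hreal : (f (x + T • v) - f x) ^ 2 ≤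
      T * ‖v‖ ^ 2 * ∫ t in Ioo 0 T, ‖fderiv ℝ f (x + t • v)‖ ^ 2 := by
    rw [hftc] at hCS
    rw [integral_const_mul] at hmono
    have : (volume.restrict (Ioo 0 T)).real univ = T := by simp [hT.le]
    rw [this] at hCS
    nlinarith
  refine (ENNReal.ofReal_le_ofReal hreal).trans_eq ?_
  have hsq : ContinuousOn (fun t => ‖fderiv ℝ f (x + t • v)‖ ^ 2) (Icc 0 T) := hdf.norm.pow 2
  rw [ENNReal.ofReal_mul (by positivity), ofReal_integral_eq_lintegral_ofReal
    (hint hsq) (Filter.Eventually.of_forall fun t => by positivity)]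
  congr 1
  refine setLIntegral_congr_fun measurableSet_Ioo fun t ht => ?_
  simp [ballEnergyDensity, indicator_of_mem (hopen t ht)]

variable [MeasurableSpace E] [BorelSpace E]

variable [FiniteDimensional ℝ E]

lemma measurable_ballEnergyDensity (f : E → ℝ) : Measurable (ballEnergyDensity f) := by
  have : CompleteSpace E := FiniteDimensional.complete ℝ E
  exact (((measurable_fderiv ℝ f).norm.pow_const 2).ennreal_ofReal).indicator measurableSet_ball

variable (μ : Measure E) [μ.IsAddHaarMeasure]

lemma setLIntegral_ball_sq_le_of_eq_zero_on_sphere [Nontrivial E] {f : E → ℝ} {O : Set E}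
    (hO : IsOpen O) (hB : closedBall (0 : E) 1 ⊆ O) (hf : ContDiffOn ℝ 1 f O)
    (h0 : ∀ x ∈ sphere (0 : E) 1, f x = 0) :
    ∫⁻ x in ball (0 : E) 1, ENNReal.ofReal (f x ^ 2) ∂μ ≤
      4 * ∫⁻ x, ballEnergyDensity f x ∂μ := by
  obtain ⟨e, he⟩ := exists_norm_eq E zero_le_one
  have hG := measurable_ballEnergyDensity f
  have hpt : ∀ x ∈ ball (0 : E) 1, ENNReal.ofReal (f x ^ 2) ≤
      2 * ∫⁻ t in Ioo (0 : ℝ) 2, ballEnergyDensity f (x + t • e) := by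
    intro x hx
    have hx' := mem_ball_zero_iff.1 hx
    have hc : ContinuousOn (fun t : ℝ => ‖x + t • e‖) (Icc 0 2) := by fun_prop
    have h2 : 1 ≤ ‖x + (2 : ℝ) • e‖ := by
      have := norm_sub_norm_le ((2 : ℝ) • e) (-x)
      rw [norm_smul, he, norm_neg, sub_neg_eq_add, add_comm _ x] at this
      norm_num at this
      linarith
    obtain ⟨T, hT, hTe⟩ := intermediate_value_Icc (by norm_num) hc
      (show (1 : ℝ) ∈ Icc _ _ from ⟨by simpa using hx'.le, h2⟩)
    have := ofReal_sq_sub_le_lintegral_segment hO hB hf hT.1 hx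
      (mem_closedBall_zero_iff.2 (le_of_eq hTe))
    rw [h0 _ (mem_sphere_zero_iff_norm.2 hTe), he, zero_sub, neg_sq] at this
    refine this.trans (mul_le_mul' ?_ (lintegral_mono_set (Ioo_subset_Ioo_right hT.2)))
    rw [show (2 : ENNReal) = ENNReal.ofReal 2 by simp]
    exact ENNReal.ofReal_le_ofReal (by linarith [hT.2])
  calc ∫⁻ x in ball (0 : E) 1, ENNReal.ofReal (f x ^ 2) ∂μ
      ≤ ∫⁻ x in ball (0 : E) 1, 2 * (∫⁻ t in Ioo (0 : ℝ) 2, ballEnergyDensity f (x + t • e)) ∂μ :=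
        setLIntegral_mono' measurableSet_ball hpt
    _ ≤ ∫⁻ x, 2 * (∫⁻ t in Ioo (0 : ℝ) 2, ballEnergyDensity f (x + t • e)) ∂μ :=
        setLIntegral_le_lintegral _ _
    _ = 2 * ∫⁻ t in Ioo (0 : ℝ) 2, ∫⁻ x, ballEnergyDensity f (x + t • e) ∂μ := by
        rw [lintegral_const_mul' _ _ (by simp), lintegral_lintegral_swap]
        have hm : Measurable fun p : E × ℝ => p.1 + p.2 • e := by fun_prop
        exact (hG.comp hm).aemeasurable
    _ = 4 * ∫⁻ x, ballEnergyDensity f x ∂μ := by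
        simp_rw [lintegral_add_right_eq_self]
        rw [setLIntegral_const, Real.volume_Ioo]
        simp only [sub_zero, ENNReal.ofReal_ofNat]
        ring

lemma lintegral_comp_smul_add_le {s : ℝ} (hs : 1 / 2 ≤ s) (c : E) {g : E → ENNReal}
    (hg : Measurable g) :
    ∫⁻ x, g (s • x + c) ∂μ ≤ 2 ^ Module.finrank ℝ E * ∫⁻ x, g x ∂μ := by
  have hs0 : 0 < s := by linarith
  have h1 : ∫⁻ x, g (s • x + c) ∂μ = ∫⁻ x, g (x + c) ∂(μ.map (s • ·)) := by
    rw [lintegral_map (by fun_prop) (by fun_prop)]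
  rw [h1, Measure.map_addHaar_smul μ hs0.ne', lintegral_smul_measure, lintegral_add_right_eq_self,
    smul_eq_mul]
  gcongr
  rw [abs_of_pos (by positivity), show (2 : ENNReal) = ENNReal.ofReal 2 by simp,
    ← ENNReal.ofReal_pow (by norm_num)]
  apply ENNReal.ofReal_le_ofReal
  rw [← inv_pow]
  gcongr
  rw [inv_le_comm₀ hs0 (by norm_num)]
  linarith

lemma lintegral_lintegral_ball_sq_sub_le {f : E → ℝ} {O : Set E}
    (hO : IsOpen O) (hB : closedBall (0 : E) 1 ⊆ O) (hf : ContDiffOn ℝ 1 f O) :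
    ∫⁻ x in ball (0 : E) 1, ∫⁻ y in ball (0 : E) 1, ENNReal.ofReal ((f y - f x) ^ 2) ∂μ ∂μ ≤
      4 * (2 ^ Module.finrank ℝ E * μ (ball 0 1) * ∫⁻ x, ballEnergyDensity f x ∂μ) := by
  have hG := measurable_ballEnergyDensity f
  set G := ballEnergyDensity f
  set ν := μ.restrict (ball (0 : E) 1) with hν
  have hpt : ∀ x ∈ ball (0 : E) 1, ∀ y ∈ ball (0 : E) 1, ENNReal.ofReal ((f y - f x) ^ 2) ≤
      4 * ∫⁻ t in Ioo (0 : ℝ) 1, G (x + t • (y - x)) := by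
    intro x hx y hy
    have := ofReal_sq_sub_le_lintegral_segment (x := x) (v := y - x) hO hB hf zero_le_one hx
      (by simpa using (mem_ball_zero_iff.1 hy).le)
    simp only [one_smul, add_sub_cancel] at this
    refine this.trans (mul_le_mul_left ?_ _)
    rw [show (4 : ENNReal) = ENNReal.ofReal 4 by simp]
    apply ENNReal.ofReal_le_ofReal
    have h := norm_sub_le y x
    rw [mem_ball_zero_iff] at hx hy
    nlinarith [norm_nonneg (y - x)]
  have hslice : ∀ t ∈ Ioo (0 : ℝ) 1, ∫⁻ x, ∫⁻ y, G (x + t • (y - x)) ∂ν ∂ν ≤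
      2 ^ Module.finrank ℝ E * μ (ball 0 1) * ∫⁻ x, G x ∂μ := by
    intro t ht
    have key : ∀ s : ℝ, 1 / 2 ≤ s → ∀ c : E → E,
        ∫⁻ x, ∫⁻ y, G (s • y + c x) ∂ν ∂ν ≤
          2 ^ Module.finrank ℝ E * μ (ball 0 1) * ∫⁻ x, G x ∂μ := by
      intro s hs c
      calc ∫⁻ x, ∫⁻ y, G (s • y + c x) ∂ν ∂ν
          ≤ ∫⁻ x, 2 ^ Module.finrank ℝ E * ∫⁻ x, G x ∂μ ∂ν :=
            lintegral_mono fun x => (setLIntegral_le_lintegral _ _).trans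
              (lintegral_comp_smul_add_le μ hs (c x) hG)
        _ = _ := by
            rw [lintegral_const, hν, Measure.restrict_apply_univ]
            ring
    rcases le_total (1 / 2) t with h | h
    · convert key t h (fun x => (1 - t) • x) using 6
      module
    · have hm : Measurable fun p : E × E => p.1 + t • (p.2 - p.1) := by fun_prop
      rw [lintegral_lintegral_swap (f := fun x y => G (x + t • (y - x))) (hG.comp hm).aemeasurable]
      convert key (1 - t) (by linarith) (fun x => t • x) using 6
      module
  calc ∫⁻ x, ∫⁻ y, ENNReal.ofReal ((f y - f x) ^ 2) ∂ν ∂ν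
      ≤ ∫⁻ x, ∫⁻ y, 4 * (∫⁻ t in Ioo (0 : ℝ) 1, G (x + t • (y - x))) ∂ν ∂ν :=
        setLIntegral_mono' measurableSet_ball fun x hx =>
          setLIntegral_mono' measurableSet_ball fun y hy => hpt x hx y hy
    _ = 4 * ∫⁻ x, ∫⁻ y, (∫⁻ t in Ioo (0 : ℝ) 1, G (x + t • (y - x))) ∂ν ∂ν := by
        simp_rw [lintegral_const_mul' 4 _ (by simp)]
    _ = 4 * ∫⁻ t in Ioo (0 : ℝ) 1, ∫⁻ x, ∫⁻ y, G (x + t • (y - x)) ∂ν ∂ν := by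
        have hm : ∀ x : E, Measurable fun p : E × ℝ => x + p.2 • (p.1 - x) := fun x => by fun_prop
        have h1 : ∀ x, ∫⁻ y, (∫⁻ t in Ioo (0 : ℝ) 1, G (x + t • (y - x))) ∂ν =
            ∫⁻ t in Ioo (0 : ℝ) 1, ∫⁻ y, G (x + t • (y - x)) ∂ν := fun x =>
          lintegral_lintegral_swap (hG.comp (g := G) (hm x)).aemeasurable
        simp_rw [h1]
        rw [lintegral_lintegral_swap]
        apply Measurable.aemeasurable
        have : Measurable fun p : (E × ℝ) × E => G (p.1.1 + p.1.2 • (p.2 - p.1.1)) :=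
          hG.comp (by fun_prop)
        exact this.lintegral_prod_right'
    _ ≤ 4 * ∫⁻ t in Ioo (0 : ℝ) 1, 2 ^ Module.finrank ℝ E * μ (ball 0 1) * ∫⁻ x, G x ∂μ := by
        gcongr 4 * ?_
        exact setLIntegral_mono' measurableSet_Ioo hslice
    _ = _ := by simp

lemma integrableOn_ball_of_continuousOn_closedBall {f : E → ℝ}
    (hf : ContinuousOn f (closedBall (0 : E) 1)) : IntegrableOn f (ball (0 : E) 1) μ := by
  have : ProperSpace E := FiniteDimensional.proper_real E
  exact (hf.integrableOn_compact (isCompact_closedBall 0 1)).mono_set ball_subset_closedBall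

variable {μ}

lemma lintegral_ballEnergyDensity {f : E → ℝ}
    (hf : ContinuousOn (fderiv ℝ f) (closedBall (0 : E) 1)) :
    ∫⁻ x, ballEnergyDensity f x ∂μ =
      ENNReal.ofReal (∫ x in ball (0 : E) 1, ‖fderiv ℝ f x‖ ^ 2 ∂μ) := by
  have hc : ContinuousOn (fun x => ‖fderiv ℝ f x‖ ^ 2) (closedBall (0 : E) 1) := hf.norm.pow 2
  rw [ofReal_integral_eq_lintegral_ofReal (integrableOn_ball_of_continuousOn_closedBall μ hc)
    (Filter.Eventually.of_forall fun x => by positivity), ballEnergyDensity,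
    lintegral_indicator measurableSet_ball]

/-- **Friedrichs inequality** on the unit ball. -/
lemma integral_ball_sq_le_of_eq_zero_on_sphere [Nontrivial E] {f : E → ℝ} {O : Set E}
    (hO : IsOpen O) (hB : closedBall (0 : E) 1 ⊆ O) (hf : ContDiffOn ℝ 1 f O)
    (h0 : ∀ x ∈ sphere (0 : E) 1, f x = 0) :
    ∫ x in ball (0 : E) 1, f x ^ 2 ∂μ ≤ 4 * ∫ x in ball (0 : E) 1, ‖fderiv ℝ f x‖ ^ 2 ∂μ := by
  have hc : ContinuousOn (fun x => f x ^ 2) (closedBall (0 : E) 1) :=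
    (hf.continuousOn.mono hB).pow 2
  have h := setLIntegral_ball_sq_le_of_eq_zero_on_sphere μ hO hB hf h0
  rw [lintegral_ballEnergyDensity ((hf.continuousOn_fderiv_of_isOpen hO le_rfl).mono hB),
    ← ofReal_integral_eq_lintegral_ofReal (integrableOn_ball_of_continuousOn_closedBall μ hc)
    (Filter.Eventually.of_forall fun x => sq_nonneg _),
    show (4 : ENNReal) = ENNReal.ofReal 4 by simp, ← ENNReal.ofReal_mul (by norm_num)] at h
  exact (ENNReal.ofReal_le_ofReal_iff (by positivity)).1 h

/-- **Poincaré inequality** on the unit ball. -/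
lemma integral_ball_sq_le {f : E → ℝ} {O : Set E}
    (hO : IsOpen O) (hB : closedBall (0 : E) 1 ⊆ O) (hf : ContDiffOn ℝ 1 f O) :
    ∫ x in ball (0 : E) 1, f x ^ 2 ∂μ ≤
      2 ^ (Module.finrank ℝ E + 1) * (∫ x in ball (0 : E) 1, ‖fderiv ℝ f x‖ ^ 2 ∂μ) +
        (∫ x in ball (0 : E) 1, f x ∂μ) ^ 2 / μ.real (ball 0 1) := by
  have : ProperSpace E := FiniteDimensional.proper_real E
  have hfc : ContinuousOn f (closedBall (0 : E) 1) := hf.continuousOn.mono hB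
  have hi1 : IntegrableOn f (ball (0 : E) 1) μ :=
    integrableOn_ball_of_continuousOn_closedBall μ hfc
  have hi2 : IntegrableOn (fun x => f x ^ 2) (ball (0 : E) 1) μ :=
    integrableOn_ball_of_continuousOn_closedBall μ (hfc.pow 2)
  have h := lintegral_lintegral_ball_sq_sub_le μ hO hB hf
  rw [lintegral_ballEnergyDensity ((hf.continuousOn_fderiv_of_isOpen hO le_rfl).mono hB)] at h
  have hVpos : 0 < μ.real (ball (0 : E) 1) :=
    ENNReal.toReal_pos (measure_ball_pos μ 0 one_pos).ne' measure_ball_lt_top.ne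
  have hV : μ (ball (0 : E) 1) = ENNReal.ofReal (μ.real (ball 0 1)) := by simp [measureReal_def,
    ENNReal.ofReal_toReal measure_ball_lt_top.ne]
  have hVν : (μ.restrict (ball (0 : E) 1)).real univ = μ.real (ball 0 1) := by simp
  have : IsFiniteMeasure (μ.restrict (ball (0 : E) 1)) := ⟨by simp [measure_ball_lt_top]⟩
  rw [hV] at h
  rw [IntegrableOn] at hi1 hi2
  set V := μ.real (ball (0 : E) 1)
  set D := ∫ x in ball (0 : E) 1, ‖fderiv ℝ f x‖ ^ 2 ∂μ
  have hD : 0 ≤ D := integral_nonneg fun x => by positivity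
  set ν := μ.restrict (ball (0 : E) 1)
  set F := ∫ x, f x ∂ν
  set S := ∫ x, f x ^ 2 ∂ν
  have hexp : ∀ x y, (f y - f x) ^ 2 = f y ^ 2 - 2 * f x * f y + f x ^ 2 := fun x y => by ring
  have hi3 : ∀ x, Integrable (fun y => f y ^ 2 - 2 * f x * f y) ν := fun x =>
    hi2.sub (hi1.const_mul _)
  have hin : ∀ x, ∫ y, (f y - f x) ^ 2 ∂ν = S - 2 * F * f x + V * f x ^ 2 := fun x => by
    simp_rw [hexp]
    rw [integral_add (hi3 x) (integrable_const _), integral_sub hi2 (hi1.const_mul _),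
      integral_const_mul, integral_const, smul_eq_mul, hVν]
    ring
  have hin' : ∀ x, ∫⁻ y, ENNReal.ofReal ((f y - f x) ^ 2) ∂ν =
      ENNReal.ofReal (S - 2 * F * f x + V * f x ^ 2) := fun x => by
    rw [← hin, ofReal_integral_eq_lintegral_ofReal _
      (Filter.Eventually.of_forall fun y => sq_nonneg _)]
    simp_rw [hexp]
    exact (hi3 x).add (integrable_const _)
  have hi4 : Integrable (fun x => S - 2 * F * f x) ν := (integrable_const _).sub (hi1.const_mul _)
  have hout : ∫ x, S - 2 * F * f x + V * f x ^ 2 ∂ν = 2 * V * S - 2 * F ^ 2 := by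
    rw [integral_add hi4 (hi2.const_mul _), integral_sub (integrable_const _) (hi1.const_mul _),
      integral_const_mul, integral_const_mul, integral_const, smul_eq_mul, hVν]
    ring
  have hi5 : Integrable (fun x => S - 2 * F * f x + V * f x ^ 2) ν := hi4.add (hi2.const_mul _)
  simp_rw [hin'] at h
  rw [← ofReal_integral_eq_lintegral_ofReal hi5
    (Filter.Eventually.of_forall fun x => by
      simp only [Pi.zero_apply, ← hin]
      exact integral_nonneg fun y => sq_nonneg _), hout,
    show (4 : ENNReal) = ENNReal.ofReal 4 by simp,
    show (2 : ENNReal) = ENNReal.ofReal 2 by simp, ← ENNReal.ofReal_pow (by norm_num),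
    ← ENNReal.ofReal_mul (by positivity), ← ENNReal.ofReal_mul (by positivity),
    ← ENNReal.ofReal_mul (by positivity), ENNReal.ofReal_le_ofReal_iff (by positivity)] at h
  rw [← sub_le_iff_le_add', le_div_iff₀ hVpos, pow_succ]
  linarith

end UnitBall

/-- **Poincaré-type inequality for triple-junction triples**
(Proposition 2.10, flat model).  Let `B ⊂ ℝⁿ` be the open unit ball and fix
`γ¹, γ², γ³ > 0`.  There is a constant `C > 0`, depending only on `n` and the `γⁱ`,
such that every triple `ρ = (ρ¹, ρ², ρ³)` of `C¹` functions on a neighborhood of the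
closed unit ball satisfying the linearized concurrency condition
`γ¹ρ¹ + γ²ρ² + γ³ρ³ = 0` on `∂B` and the linearized volume condition
`∫_B ρ¹ = ∫_B ρ² = ∫_B ρ³` satisfies
`Σᵢ ∫_B |ρⁱ|² ≤ C Σᵢ ∫_B ‖∇ρⁱ‖²`. -/
theorem poincare_triple_junction (n : ℕ) (hn : 1 ≤ n)
    (γ₁ γ₂ γ₃ : ℝ) (hγ₁ : 0 < γ₁) (hγ₂ : 0 < γ₂) (hγ₃ : 0 < γ₃) :
    ∃ C : ℝ, 0 < C ∧
      ∀ ρ₁ ρ₂ ρ₃ : EuclideanSpace ℝ (Fin n) → ℝ,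
        (∃ O : Set (EuclideanSpace ℝ (Fin n)), IsOpen O ∧
            Metric.closedBall (0 : EuclideanSpace ℝ (Fin n)) 1 ⊆ O ∧
            ContDiffOn ℝ 1 ρ₁ O ∧ ContDiffOn ℝ 1 ρ₂ O ∧ ContDiffOn ℝ 1 ρ₃ O) →
        (∀ x ∈ Metric.sphere (0 : EuclideanSpace ℝ (Fin n)) 1,
            γ₁ * ρ₁ x + γ₂ * ρ₂ x + γ₃ * ρ₃ x = 0) →
        (∫ x in Metric.ball (0 : EuclideanSpace ℝ (Fin n)) 1, ρ₁ x) =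
          (∫ x in Metric.ball (0 : EuclideanSpace ℝ (Fin n)) 1, ρ₂ x) →
        (∫ x in Metric.ball (0 : EuclideanSpace ℝ (Fin n)) 1, ρ₂ x) =
          (∫ x in Metric.ball (0 : EuclideanSpace ℝ (Fin n)) 1, ρ₃ x) →
        (∫ x in Metric.ball (0 : EuclideanSpace ℝ (Fin n)) 1, |ρ₁ x| ^ 2) +
          (∫ x in Metric.ball (0 : EuclideanSpace ℝ (Fin n)) 1, |ρ₂ x| ^ 2) +
          (∫ x in Metric.ball (0 : EuclideanSpace ℝ (Fin n)) 1, |ρ₃ x| ^ 2) ≤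
        C * ((∫ x in Metric.ball (0 : EuclideanSpace ℝ (Fin n)) 1, ‖fderiv ℝ ρ₁ x‖ ^ 2) +
          (∫ x in Metric.ball (0 : EuclideanSpace ℝ (Fin n)) 1, ‖fderiv ℝ ρ₂ x‖ ^ 2) +
          (∫ x in Metric.ball (0 : EuclideanSpace ℝ (Fin n)) 1, ‖fderiv ℝ ρ₃ x‖ ^ 2)) := by
  have hne : Nontrivial (EuclideanSpace ℝ (Fin n)) := by
    have : Nonempty (Fin n) := ⟨⟨0, hn⟩⟩
    infer_instance
  set Q := γ₁ ^ 2 + γ₂ ^ 2 + γ₃ ^ 2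
  set Γ := γ₁ + γ₂ + γ₃
  have hΓpos : 0 < Γ := by positivity
  refine ⟨2 ^ (n + 1) + 12 * Q / Γ ^ 2, by positivity, ?_⟩
  rintro ρ₁ ρ₂ ρ₃ ⟨O, hO, hB, h₁, h₂, h₃⟩ hbd h12 h23
  simp_rw [sq_abs]
  have p₁ := integral_ball_sq_le (μ := volume) hO hB h₁
  have p₂ := integral_ball_sq_le (μ := volume) hO hB h₂
  have p₃ := integral_ball_sq_le (μ := volume) hO hB h₃
  rw [finrank_euclideanSpace_fin] at p₁ p₂ p₃
  rw [h12] at p₁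
  rw [← h23] at p₃
  set u : EuclideanSpace ℝ (Fin n) → ℝ := fun x => γ₁ * ρ₁ x + γ₂ * ρ₂ x + γ₃ * ρ₃ x with hu
  have hudiff : ContDiffOn ℝ 1 u O :=
    ((contDiffOn_const.mul h₁).add (contDiffOn_const.mul h₂)).add (contDiffOn_const.mul h₃)
  have hfried := integral_ball_sq_le_of_eq_zero_on_sphere (μ := volume) hO hB hudiff hbd
  have hint : ∀ {f : EuclideanSpace ℝ (Fin n) → ℝ}, ContDiffOn ℝ 1 f O →
      IntegrableOn f (Metric.ball 0 1) := fun hf =>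
    integrableOn_ball_of_continuousOn_closedBall volume (hf.continuousOn.mono hB)
  have hint' : ∀ {f : EuclideanSpace ℝ (Fin n) → ℝ}, ContDiffOn ℝ 1 f O →
      IntegrableOn (fun x => ‖fderiv ℝ f x‖ ^ 2) (Metric.ball 0 1) := fun hf =>
    integrableOn_ball_of_continuousOn_closedBall volume
      (((hf.continuousOn_fderiv_of_isOpen hO le_rfl).mono hB).norm.pow 2)
  have hfin : IsFiniteMeasure (volume.restrict (Metric.ball (0 : EuclideanSpace ℝ (Fin n)) 1)) :=
    ⟨by simp [measure_ball_lt_top]⟩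
  have hCS := sq_integral_le_measureReal_mul_integral_sq (hint hudiff)
    (hint (hudiff.pow 2))
  rw [measureReal_restrict_apply_univ] at hCS
  have hmean : ∫ x in Metric.ball 0 1, u x = Γ * ∫ x in Metric.ball 0 1, ρ₂ x := by
    have i₁ := (hint h₁).const_mul γ₁
    have i₂ := (hint h₂).const_mul γ₂
    have i₃ := (hint h₃).const_mul γ₃
    have i₁₂ : IntegrableOn (fun x => γ₁ * ρ₁ x + γ₂ * ρ₂ x) (Metric.ball 0 1) := i₁.add i₂
    rw [hu, integral_add i₁₂ i₃, integral_add i₁ i₂, integral_const_mul, integral_const_mul,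
      integral_const_mul, h12, ← h23]
    ring
  have hgrad : ∫ x in Metric.ball 0 1, ‖fderiv ℝ u x‖ ^ 2 ≤
      Q * ((∫ x in Metric.ball 0 1, ‖fderiv ℝ ρ₁ x‖ ^ 2) +
        (∫ x in Metric.ball 0 1, ‖fderiv ℝ ρ₂ x‖ ^ 2) +
        (∫ x in Metric.ball 0 1, ‖fderiv ℝ ρ₃ x‖ ^ 2)) := by
    have i₁₂ : IntegrableOn (fun x => ‖fderiv ℝ ρ₁ x‖ ^ 2 + ‖fderiv ℝ ρ₂ x‖ ^ 2)
        (Metric.ball 0 1) := (hint' h₁).add (hint' h₂)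
    rw [← integral_add (hint' h₁) (hint' h₂), ← integral_add i₁₂ (hint' h₃),
      ← integral_const_mul]
    refine setIntegral_mono_on (hint' hudiff) ((i₁₂.add (hint' h₃)).const_mul Q)
      measurableSet_ball fun x hx => ?_
    have hx' : O ∈ nhds x := hO.mem_nhds (hB (Metric.ball_subset_closedBall hx))
    have d : ∀ {f : EuclideanSpace ℝ (Fin n) → ℝ}, ContDiffOn ℝ 1 f O →
        HasFDerivAt f (fderiv ℝ f x) x := fun hf =>
      ((hf.differentiableOn one_ne_zero).differentiableAt hx').hasFDerivAt
    have hd := (((d h₁).const_mul γ₁).add ((d h₂).const_mul γ₂)).add ((d h₃).const_mul γ₃)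
    have hd' : fderiv ℝ u x = _ := hd.fderiv
    rw [hd']
    exact norm_add_three_smul_sq_le _ _ _ _ _ _
  have hVpos : 0 < volume.real (Metric.ball (0 : EuclideanSpace ℝ (Fin n)) 1) :=
    ENNReal.toReal_pos (Metric.measure_ball_pos _ 0 one_pos).ne' measure_ball_lt_top.ne
  rw [hmean] at hCS
  set V := volume.real (Metric.ball (0 : EuclideanSpace ℝ (Fin n)) 1)
  set F := ∫ x in Metric.ball 0 1, ρ₂ x
  set D := (∫ x in Metric.ball 0 1, ‖fderiv ℝ ρ₁ x‖ ^ 2) +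
    (∫ x in Metric.ball 0 1, ‖fderiv ℝ ρ₂ x‖ ^ 2) +
    (∫ x in Metric.ball 0 1, ‖fderiv ℝ ρ₃ x‖ ^ 2) with hD
  have hF : F ^ 2 / V ≤ 4 * Q / Γ ^ 2 * D := by
    rw [div_le_iff₀ hVpos, div_mul_eq_mul_div, div_mul_eq_mul_div, le_div_iff₀ (by positivity)]
    have := mul_le_mul_of_nonneg_left (hfried.trans (mul_le_mul_of_nonneg_left hgrad zero_le_four))
      hVpos.le
    linarith
  calc _ ≤ 2 ^ (n + 1) * D + 3 * (F ^ 2 / V) := by rw [hD]; linarith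
    _ ≤ 2 ^ (n + 1) * D + 3 * (4 * Q / Γ ^ 2 * D) := by gcongr
    _ = (2 ^ (n + 1) + 12 * Q / Γ ^ 2) * D := by ring
end

section
/- (Closedness of a direct sum of subspaces; abstracted from the proof of Lemma 4.2.) Let Z₁ and Z₂ be closed subspaces of X with Z₁ ∩ Z₂ = {0}, and let T : X → Y be a continuous linear map such that T z = 0 for all z ∈ Z₁ and such that there is a constant c > 0 with ‖z‖ ≤ c ‖T z‖ for all z ∈ Z₂. Then the subspace Z₁ + Z₂ is closed in X. -/
/-- **Closedness of a direct sum of subspaces** (abstracted from the proof of Lemma 4.2).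
Let `X` be a real Banach space, `Y` a real normed space, `Z₁, Z₂` closed subspaces of `X`
with `Z₁ ∩ Z₂ = {0}`, and `T : X → Y` a continuous linear map vanishing on `Z₁` and
bounded below (by `c > 0`) on `Z₂`.  Then `Z₁ + Z₂` is closed in `X`. -/
theorem closed_direct_sum {X Y : Type*}
    [NormedAddCommGroup X] [NormedSpace ℝ X] [CompleteSpace X]
    [NormedAddCommGroup Y] [NormedSpace ℝ Y]
    (Z₁ Z₂ : Submodule ℝ X)
    (hZ₁ : IsClosed (Z₁ : Set X)) (hZ₂ : IsClosed (Z₂ : Set X))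
    (hdisj : Z₁ ⊓ Z₂ = ⊥)
    (T : X →L[ℝ] Y)
    (hT₁ : ∀ z ∈ Z₁, T z = 0)
    (c : ℝ) (hc : 0 < c) (hT₂ : ∀ z ∈ Z₂, ‖z‖ ≤ c * ‖T z‖) :
    IsClosed ((Z₁ ⊔ Z₂ : Submodule ℝ X) : Set X) := by
  refine IsSeqClosed.isClosed fun x p hx hxp => ?_
  choose a ha b hb hab using fun n => Submodule.mem_sup.1 (hx n)
  have hTb (n : ℕ) : T (b n) = T (x n) := by
    rw [← hab n, map_add, hT₁ _ (ha n), zero_add]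
  have hTx : CauchySeq fun n => T (x n) := ((T.continuous.tendsto p).comp hxp).cauchySeq
  have hbC : CauchySeq b := by
    rw [Metric.cauchySeq_iff] at hTx ⊢
    intro ε hε
    obtain ⟨N, hN⟩ := hTx (ε / c) (div_pos hε hc)
    refine ⟨N, fun m hm n hn => ?_⟩
    have h₁ := hN m hm n hn
    have h₂ := hT₂ _ (Z₂.sub_mem (hb m) (hb n))
    rw [dist_eq_norm, lt_div_iff₀' hc] at h₁
    rw [map_sub, hTb, hTb] at h₂
    rw [dist_eq_norm]
    exact h₂.trans_lt h₁
  obtain ⟨q, hq⟩ := cauchySeq_tendsto_of_complete hbC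
  have hqZ : q ∈ Z₂ := hZ₂.mem_of_tendsto hq (.of_forall hb)
  have hpq : p - q ∈ Z₁ := hZ₁.mem_of_tendsto (hxp.sub hq)
    (.of_forall fun n => by simpa [← hab n] using ha n)
  exact Submodule.mem_sup.2 ⟨p - q, hpq, q, hqZ, sub_add_cancel p q⟩
end
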